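/- arXiv:1108.2866 — 2 statements merged into one kernel-verified Lean document; each statement's English description precedes it below -/
import Mathlib

section
/- Let n1, n2 be positive integers with 3 ≤ n1 and n1 dividing n2, and let G = C_{n1} ⊕ C_{n2}. Then C_0(G) is nonempty. -/
/-- `S` contains a short zero-sum subsequence: a nonempty subsequence with sum `0`
whose length is at most `exp(G)`. -/
def HasShortZeroSumSubseq {G : Type*} [AddCommGroup G] (S : Multiset G) : Prop :=
  ∃ T, T ≤ S ∧ T.sum = 0 ∧ 1 ≤ Multiset.card T ∧ Multiset.card T ≤ AddMonoid.exponent G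

/-- `η G` : the smallest `d` such that every sequence over `G` of length at least `d`
contains a short zero-sum subsequence. -/
noncomputable def etaConst (G : Type*) [AddCommGroup G] : ℕ :=
  sInf {d : ℕ | ∀ S : Multiset G, d ≤ Multiset.card S → HasShortZeroSumSubseq S}

/-- `D G` : the Davenport constant, the smallest `d` such that every sequence over `G`
of length at least `d` contains a nonempty zero-sum subsequence. -/
noncomputable def davenport (G : Type*) [AddCommGroup G] : ℕ :=
  sInf {d : ℕ | ∀ S : Multiset G, d ≤ Multiset.card S → ∃ T, T ≤ S ∧ T ≠ 0 ∧ T.sum = 0}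

/-- `C₀(G)` : the set of `t ∈ [D(G)+1, η(G)-1]` such that every zero-sum sequence over
`G` of length exactly `t` contains a short zero-sum subsequence. -/
def C0 (G : Type*) [AddCommGroup G] : Set ℕ :=
  {t | davenport G + 1 ≤ t ∧ t ≤ etaConst G - 1 ∧
    ∀ S : Multiset G, Multiset.card S = t → S.sum = 0 → HasShortZeroSumSubseq S}

theorem Multiset.exists_map_eq_of_le_map {α β : Type*} {f : α → β} {s : Multiset α}
    {t : Multiset β} (h : t ≤ s.map f) : ∃ u ≤ s, u.map f = t := by
  induction s using Quotient.inductionOn with | _ l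
  induction t using Quotient.inductionOn with | _ m
  obtain ⟨m', hm, hs⟩ := h
  obtain ⟨l', hl, rfl⟩ := List.sublist_map_iff.1 hs
  exact ⟨l', hl.subperm, Quotient.sound hm⟩

theorem Multiset.exists_le_card_eq {α : Type*} {s : Multiset α} {n : ℕ} (h : n ≤ card s) :
    ∃ t ≤ s, card t = n := by
  induction s using Quotient.inductionOn with | _ l
  exact ⟨l.take n, (l.take_sublist n).subperm, by simpa using h⟩

/-- Olson's bound for elementary abelian groups, by the Chevalley–Warning theorem. -/
theorem exists_finset_sum_eq_zero_of_card_lt {p : ℕ} [Fact p.Prime] {ι σ : Type*} [Fintype ι]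
    [Fintype σ] (f : ι → σ → ZMod p) (h : Fintype.card σ * (p - 1) < Fintype.card ι) :
    ∃ t : Finset ι, t.Nonempty ∧ ∑ i ∈ t, f i = 0 := by
  classical
  have hp : p.Prime := Fact.out
  let F : σ → MvPolynomial ι (ZMod p) := fun j =>
    ∑ i, MvPolynomial.C (f i j) * MvPolynomial.X i ^ (p - 1)
  have hdeg (j : σ) : (F j).totalDegree ≤ p - 1 := by
    refine MvPolynomial.totalDegree_finsetSum_le fun i _ => ?_
    refine (MvPolynomial.totalDegree_mul _ _).trans ?_
    rw [MvPolynomial.totalDegree_C, zero_add, MvPolynomial.totalDegree_X_pow]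
  have hsum : ∑ j, (F j).totalDegree < Fintype.card ι :=
    (Finset.sum_le_sum fun j _ => hdeg j).trans_lt (by simpa using h)
  have hdvd := char_dvd_card_solutions_of_fintype_sum_lt p hsum
  have hp0 : p - 1 ≠ 0 := by have := hp.two_le; omega
  let x₀ : {x : ι → ZMod p // ∀ j, MvPolynomial.eval x (F j) = 0} :=
    ⟨0, fun j => by simp [F, hp0]⟩
  have hcard : 1 < Fintype.card {x : ι → ZMod p // ∀ j, MvPolynomial.eval x (F j) = 0} :=
    hp.one_lt.trans_le (Nat.le_of_dvd (Fintype.card_pos_iff.2 ⟨x₀⟩) hdvd)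
  obtain ⟨x, hx⟩ := Fintype.exists_ne_of_one_lt_card hcard x₀
  refine ⟨Finset.univ.filter fun i => x.1 i ≠ 0, ?_, ?_⟩
  · rw [← Subtype.coe_ne_coe, Function.ne_iff] at hx
    obtain ⟨i, hi⟩ := hx
    exact ⟨i, by simpa [x₀] using hi⟩
  · ext j
    simpa [F, ZMod.pow_card_sub_one, Finset.sum_filter] using x.2 j

theorem Multiset.exists_le_sum_map_eq_zero {p : ℕ} [Fact p.Prime] {α σ : Type*} [Fintype σ]
    (f : α → σ → ZMod p) (S : Multiset α) (h : Fintype.card σ * (p - 1) < card S) :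
    ∃ T ≤ S, T ≠ 0 ∧ (T.map f).sum = 0 := by
  induction S using Quotient.inductionOn with | _ l
  obtain ⟨t, ht, hsum⟩ := exists_finset_sum_eq_zero_of_card_lt (fun i : Fin l.length => f (l.get i))
    (by simpa using h)
  refine ⟨t.val.map l.get, ?_, ?_, ?_⟩
  · have := Multiset.map_le_map (f := l.get) (Finset.val_le_iff.2 t.subset_univ)
    simpa [Fin.univ_def] using this
  · simpa [Finset.nonempty_iff_ne_empty] using ht
  · rw [Multiset.map_map]
    exact hsum

theorem Multiset.sum_map_apply {α σ M : Type*} [AddCommMonoid M] (f : α → σ → M)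
    (S : Multiset α) (j : σ) : (S.map f).sum j = (S.map fun a => f a j).sum := by
  have := map_multiset_sum (Pi.evalAddMonoidHom (fun _ : σ => M) j) (S.map f)
  rw [Multiset.map_map] at this
  exact this

theorem Multiset.intCast_sum_map {α : Type*} (n : ℕ) (f : α → ℤ) (S : Multiset α) :
    (S.map fun a => (f a : ZMod n)).sum = ((S.map f).sum : ℤ) := by
  have := map_multiset_sum (Int.castAddHom (ZMod n)) (S.map f)
  rw [Multiset.map_map] at this
  exact this.symm

/-- `S` is nonempty, with sum zero in `ZMod m × ZMod n`. -/
def IsZeroSumMod (m n : ℕ) (S : Multiset (ℤ × ℤ)) : Prop :=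
  S ≠ 0 ∧ (m : ℤ) ∣ S.sum.1 ∧ (n : ℤ) ∣ S.sum.2

theorem exists_isZeroSumMod_prime {p : ℕ} [Fact p.Prime] (S : Multiset (ℤ × ℤ))
    (h : 2 * p - 1 ≤ Multiset.card S) : ∃ T ≤ S, IsZeroSumMod p p T := by
  have hp : p.Prime := Fact.out
  obtain ⟨T, hTS, hT0, hT⟩ := Multiset.exists_le_sum_map_eq_zero
    (fun x : ℤ × ℤ => ![(x.1 : ZMod p), (x.2 : ZMod p)]) S
    (by have := hp.two_le; simp only [Fintype.card_fin]; omega)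
  refine ⟨T, hTS, hT0, ?_, ?_⟩
  · have := congrFun hT 0
    rw [Multiset.sum_map_apply] at this
    rwa [← ZMod.intCast_zmod_eq_zero_iff_dvd, Multiset.fst_sum, ← Multiset.intCast_sum_map]
  · have := congrFun hT 1
    rw [Multiset.sum_map_apply] at this
    rwa [← ZMod.intCast_zmod_eq_zero_iff_dvd, Multiset.snd_sum, ← Multiset.intCast_sum_map]

theorem IsZeroSumMod.sub {m n : ℕ} {S T : Multiset (ℤ × ℤ)} (hS : IsZeroSumMod m n S)
    (hT : IsZeroSumMod m n T) (h : T < S) : IsZeroSumMod m n (S - T) := by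
  have hsum : (S - T).sum = S.sum - T.sum := by
    rw [eq_sub_iff_add_eq, ← Multiset.sum_add, tsub_add_cancel_of_le h.le]
  refine ⟨fun h0 => h.not_ge (tsub_eq_zero_iff_le.1 h0), ?_, ?_⟩
  · rw [hsum]
    exact dvd_sub hS.2.1 hT.2.1
  · rw [hsum]
    exact dvd_sub hS.2.2 hT.2.2

theorem exists_short_isZeroSumMod_prime {p : ℕ} [Fact p.Prime] (S : Multiset (ℤ × ℤ))
    (h : 3 * p - 2 ≤ Multiset.card S) : ∃ T ≤ S, IsZeroSumMod p p T ∧ Multiset.card T ≤ p := by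
  have hp : p.Prime := Fact.out
  have hp2 := hp.two_le
  obtain ⟨S', hS', hcard⟩ := Multiset.exists_le_card_eq h
  obtain ⟨T, hTS, hT0, hT⟩ := Multiset.exists_le_sum_map_eq_zero
    (fun x : ℤ × ℤ => ![(x.1 : ZMod p), (x.2 : ZMod p), 1]) S'
    (by simp only [Fintype.card_fin]; omega)
  have hT' : IsZeroSumMod p p T := by
    refine ⟨hT0, ?_, ?_⟩
    · have := congrFun hT 0
      rw [Multiset.sum_map_apply] at this
      rwa [← ZMod.intCast_zmod_eq_zero_iff_dvd, Multiset.fst_sum, ← Multiset.intCast_sum_map]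
    · have := congrFun hT 1
      rw [Multiset.sum_map_apply] at this
      rwa [← ZMod.intCast_zmod_eq_zero_iff_dvd, Multiset.snd_sum, ← Multiset.intCast_sum_map]
  have hdvd : p ∣ Multiset.card T := by
    have := congrFun hT 2
    rw [Multiset.sum_map_apply] at this
    simpa [← ZMod.natCast_eq_zero_iff] using this
  have hle := Multiset.card_le_card hTS
  have hTS' := hTS.trans hS'
  obtain ⟨k, hk⟩ := hdvd
  have hk3 : k < 3 := by
    by_contra! hk3
    have := Nat.mul_le_mul_left p hk3
    omega
  rcases (show k ≤ 1 ∨ k = 2 by omega) with hk1 | rfl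
  · exact ⟨T, hTS', hT', by rw [hk]; simpa using Nat.mul_le_mul_left p hk1⟩
  obtain ⟨R, hRT, hR⟩ := Multiset.exists_le_card_eq (show 2 * p - 1 ≤ Multiset.card T by omega)
  obtain ⟨U, hUR, hU⟩ := exists_isZeroSumMod_prime R hR.ge
  have hUT := hUR.trans hRT
  have hUc := Multiset.card_le_card hUR
  by_cases hUp : Multiset.card U ≤ p
  · exact ⟨U, hUT.trans hTS', hU, hUp⟩
  · have hlt : U < T := hUT.lt_of_ne (by rintro rfl; omega)
    refine ⟨T - U, tsub_le_self.trans hTS', hT'.sub hU hlt, ?_⟩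
    rw [Multiset.card_sub hUT]
    omega

theorem Multiset.exists_sum_le_of_forall_exists_le {α : Type*} {P : Multiset α → Prop} {e p : ℕ}
    (h : ∀ S : Multiset α, e ≤ card S → ∃ T ≤ S, P T ∧ card T ≤ p) (k : ℕ) (S : Multiset α)
    (hS : e + k * p ≤ card S + p) :
    ∃ B : Multiset (Multiset α), B.sum ≤ S ∧ card B = k ∧ card B.sum ≤ k * p ∧ ∀ T ∈ B, P T := by
  classical
  induction k generalizing S with
  | zero => exact ⟨0, by simp⟩
  | succ k ih =>
    obtain ⟨T, hTS, hT, hTp⟩ := h S (by rw [Nat.succ_mul] at hS; omega)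
    obtain ⟨B, hBS, hBk, hBp, hB⟩ := ih (S - T) (by
      rw [card_sub hTS]; rw [Nat.succ_mul] at hS; omega)
    refine ⟨T ::ₘ B, ?_, by simp [hBk], ?_, ?_⟩
    · rw [sum_cons]
      exact (add_le_add_right hBS T).trans (add_tsub_cancel_of_le hTS).le
    · rw [sum_cons, card_add, Nat.succ_mul]
      omega
    · simpa [hT] using hB

theorem exists_isZeroSumMod_one {n : ℕ} (hn : 0 < n) (S : Multiset (ℤ × ℤ))
    (h : n ≤ Multiset.card S) : ∃ T ≤ S, IsZeroSumMod 1 n T := by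
  obtain ⟨T, hT, hTn, hdvd⟩ := Int.erdos_ginzburg_ziv_multiset (n := n)
    (S.map Prod.snd + Multiset.replicate (n - 1) 0) (by simp; omega)
  obtain ⟨U, hU, hUT⟩ := Multiset.exists_map_eq_of_le_map
    (tsub_le_iff_right.2 hT : T - Multiset.replicate (n - 1) 0 ≤ S.map Prod.snd)
  have hinter : (T ∩ Multiset.replicate (n - 1) 0).sum = 0 :=
    Multiset.sum_eq_zero fun x hx => Multiset.eq_of_mem_replicate (Multiset.mem_inter.1 hx).2
  refine ⟨U, hU, ?_, by simp, ?_⟩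
  · rintro rfl
    have := Multiset.card_le_card (tsub_eq_zero_iff_le.1 hUT.symm)
    rw [Multiset.card_replicate] at this
    omega
  · rw [Multiset.snd_sum, hUT]
    rwa [← Multiset.sub_add_inter T (Multiset.replicate (n - 1) 0), Multiset.sum_add, hinter,
      add_zero] at hdvd

/-- Olson's upper bound for the Davenport constant of a group of rank at most two. -/
theorem exists_isZeroSumMod {m n : ℕ} (hn : 0 < n) (hmn : m ∣ n) (S : Multiset (ℤ × ℤ))
    (h : m + n - 1 ≤ Multiset.card S) : ∃ T ≤ S, IsZeroSumMod m n T := by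
  classical
  induction m using Nat.strong_induction_on generalizing n S with | _ m ih
  rcases eq_or_ne m 1 with rfl | hm1
  · exact exists_isZeroSumMod_one hn S (by omega)
  obtain ⟨p, hp, m, rfl⟩ := Nat.exists_prime_and_dvd hm1
  obtain ⟨c, rfl⟩ := hmn
  have := Fact.mk hp
  have hp2 := hp.two_le
  have hmc : 0 < m * c := Nat.pos_of_ne_zero fun h0 => by simp [mul_assoc, h0] at hn
  have hm : 0 < m := Nat.pos_of_mul_pos_right hmc
  have hmul : p * m + p * m * c = (m + m * c - 2) * p + 2 * p := by
    rw [← add_mul, Nat.sub_add_cancel (by omega)]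
    ring
  obtain ⟨B, hBS, hBk, hBp, hB⟩ := Multiset.exists_sum_le_of_forall_exists_le
    (fun S => exists_short_isZeroSumMod_prime (p := p) S) (m + m * c - 2) S (by omega)
  obtain ⟨R, hRS, hR⟩ := exists_isZeroSumMod_prime (p := p) (S - B.sum) (by
    rw [Multiset.card_sub hBS]; omega)
  have hRB : ∀ T ∈ R ::ₘ B, IsZeroSumMod p p T := by simpa [hR] using hB
  obtain ⟨T, hT, hT0, hT1, hT2⟩ := ih m (by nlinarith) hmc (dvd_mul_right m c)
    ((R ::ₘ B).map fun T => (T.sum.1 / p, T.sum.2 / p)) (by simp [hBk]; omega)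
  obtain ⟨C, hC, rfl⟩ := Multiset.exists_map_eq_of_le_map hT
  have hC0 : C ≠ 0 := by rintro rfl; exact hT0 rfl
  have hsum : C.sum ≤ S := by
    obtain ⟨D, hD⟩ := Multiset.le_iff_exists_add.1 hC
    have : C.sum ≤ R + B.sum := by
      rw [← Multiset.sum_cons, hD, Multiset.sum_add]
      exact le_self_add
    exact this.trans ((add_le_add_left hRS _).trans (tsub_add_cancel_of_le hBS).le)
  have hCB : ∀ T ∈ C, IsZeroSumMod p p T := fun T hTC => hRB T (Multiset.mem_of_le hC hTC)
  have hss : C.sum.sum = (C.map Multiset.sum).sum := Multiset.sum_join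
  refine ⟨C.sum, hsum, ?_, ?_, ?_⟩
  · obtain ⟨T, hTC⟩ := Multiset.exists_mem_of_ne_zero hC0
    intro h0
    exact (hCB T hTC).1 (le_zero_iff.1 (h0 ▸ Multiset.single_le_sum (by simp) T hTC))
  · rw [Multiset.fst_sum, Multiset.map_map] at hT1
    have hC1 : C.map (Prod.fst ∘ Multiset.sum) = C.map fun T => (p : ℤ) * (T.sum.1 / p) :=
      Multiset.map_congr rfl fun T hTC => (Int.mul_ediv_cancel' (hCB T hTC).2.1).symm
    rw [hss, Multiset.fst_sum, Multiset.map_map, hC1, Multiset.sum_map_mul_left]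
    push_cast
    exact mul_dvd_mul_left _ hT1
  · rw [Multiset.snd_sum, Multiset.map_map] at hT2
    have hC2 : C.map (Prod.snd ∘ Multiset.sum) = C.map fun T => (p : ℤ) * (T.sum.2 / p) :=
      Multiset.map_congr rfl fun T hTC => (Int.mul_ediv_cancel' (hCB T hTC).2.2).symm
    rw [hss, Multiset.snd_sum, Multiset.map_map, hC2, Multiset.sum_map_mul_left]
    push_cast
    rw [mul_assoc]
    exact mul_dvd_mul_left _ (by exact_mod_cast hT2)

theorem exists_sum_eq_zero_of_le_card {m n : ℕ} (hn : 0 < n) (hmn : m ∣ n)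
    (S : Multiset (ZMod m × ZMod n)) (h : m + n - 1 ≤ Multiset.card S) :
    ∃ T, T ≤ S ∧ T ≠ 0 ∧ T.sum = 0 := by
  let φ : ℤ × ℤ →+ ZMod m × ZMod n := (Int.castAddHom _).prodMap (Int.castAddHom _)
  have hφ : Function.Surjective φ := (ZMod.intCast_surjective).prodMap ZMod.intCast_surjective
  obtain ⟨S, rfl⟩ := Multiset.map_surjective_of_surjective hφ S
  obtain ⟨T, hTS, hT0, hT1, hT2⟩ := exists_isZeroSumMod hn hmn S (by simpa using h)
  refine ⟨T.map φ, Multiset.map_le_map hTS, by simpa using hT0, ?_⟩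
  rw [← map_multiset_sum]
  ext
  · exact (ZMod.intCast_zmod_eq_zero_iff_dvd _ _).2 hT1
  · exact (ZMod.intCast_zmod_eq_zero_iff_dvd _ _).2 hT2

theorem davenport_le {m n : ℕ} (hn : 0 < n) (hmn : m ∣ n) :
    davenport (ZMod m × ZMod n) ≤ m + n - 1 :=
  Nat.sInf_le fun S hS => exists_sum_eq_zero_of_le_card hn hmn S hS

theorem exists_sum_eq_zero_of_davenport_le {G : Type*} [AddCommGroup G] {d : ℕ}
    (hd : ∀ S : Multiset G, d ≤ Multiset.card S → ∃ T, T ≤ S ∧ T ≠ 0 ∧ T.sum = 0)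
    (S : Multiset G) (hS : davenport G ≤ Multiset.card S) : ∃ T, T ≤ S ∧ T ≠ 0 ∧ T.sum = 0 :=
  Nat.sInf_mem (s := {d : ℕ | ∀ S : Multiset G, d ≤ Multiset.card S →
    ∃ T, T ≤ S ∧ T ≠ 0 ∧ T.sum = 0}) ⟨d, hd⟩ S hS

theorem hasShortZeroSumSubseq_of_card_eq_succ {G : Type*} [AddCommGroup G] {d : ℕ}
    (hd : ∀ S : Multiset G, d ≤ Multiset.card S → ∃ T, T ≤ S ∧ T ≠ 0 ∧ T.sum = 0)
    (hexp : d ≤ 2 * AddMonoid.exponent G) (S : Multiset G) (hS : Multiset.card S = d + 1)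
    (h0 : S.sum = 0) : HasShortZeroSumSubseq S := by
  classical
  obtain ⟨R, hRS, hR⟩ := Multiset.exists_le_card_eq (show d ≤ Multiset.card S by omega)
  obtain ⟨T, hTR, hT0, hT⟩ := hd R hR.ge
  have hTS := hTR.trans hRS
  have hc := Multiset.card_le_card hTR
  have hc0 := Multiset.card_pos.2 hT0
  by_cases hTe : Multiset.card T ≤ AddMonoid.exponent G
  · exact ⟨T, hTS, hT, hc0, hTe⟩
  refine ⟨S - T, tsub_le_self, ?_, ?_, ?_⟩
  · rwa [← tsub_add_cancel_of_le hTS, Multiset.sum_add, hT, add_zero] at h0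
  all_goals rw [Multiset.card_sub hTS]; omega

theorem hasShortZeroSumSubseq_of_card_mul_exponent_le {G : Type*} [AddCommGroup G] [Fintype G]
    (S : Multiset G) (hS : Fintype.card G * AddMonoid.exponent G ≤ Multiset.card S) :
    HasShortZeroSumSubseq S := by
  classical
  obtain ⟨g, -, hg⟩ := Finset.exists_le_of_sum_le (s := (Finset.univ : Finset G))
    (f := fun _ => AddMonoid.exponent G) (g := fun g => S.count g) Finset.univ_nonempty
    (by simpa [Multiset.sum_count_eq_card] using hS)
  refine ⟨Multiset.replicate (AddMonoid.exponent G) g, Multiset.le_count_iff_replicate_le.1 hg,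
    ?_, ?_, ?_⟩
  · rw [Multiset.sum_replicate, AddMonoid.exponent_nsmul_eq_zero]
  · rw [Multiset.card_replicate]
    exact Nat.pos_of_ne_zero AddMonoid.exponent_ne_zero_of_finite
  · rw [Multiset.card_replicate]

theorem lt_etaConst {G : Type*} [AddCommGroup G] [Fintype G] (S : Multiset G)
    (hS : ¬ HasShortZeroSumSubseq S) : Multiset.card S < etaConst G := by
  by_contra! h
  exact hS (Nat.sInf_mem (s := {d : ℕ | ∀ S : Multiset G, d ≤ Multiset.card S →
    HasShortZeroSumSubseq S}) ⟨_, hasShortZeroSumSubseq_of_card_mul_exponent_le⟩ S h)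

theorem Multiset.exists_add_eq_of_le_add {α : Type*} {S A B : Multiset α} (h : S ≤ A + B) :
    ∃ T ≤ A, ∃ U ≤ B, S = T + U := by
  classical
  exact ⟨S ∩ A, inter_le_right, S - A, tsub_le_iff_left.2 h,
    by rw [add_comm, sub_add_inter]⟩

theorem exponent_zmod_prod {m n : ℕ} (hmn : m ∣ n) :
    AddMonoid.exponent (ZMod m × ZMod n) = n := by
  rw [AddMonoid.exponent_prod, ZMod.exponent, ZMod.exponent]
  exact Nat.lcm_eq_right hmn

theorem le_etaConst {m n : ℕ} (hm : 0 < m) (hn : 0 < n) (hmn : m ∣ n) :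
    2 * m + n - 2 ≤ etaConst (ZMod m × ZMod n) := by
  have := NeZero.of_pos hm
  have := NeZero.of_pos hn
  have hmle := Nat.le_of_dvd hn hmn
  let S : Multiset (ZMod m × ZMod n) := Multiset.replicate (m - 1) (1, 0) +
    (Multiset.replicate (n - 1) (0, 1) + Multiset.replicate (m - 1) (1, 1))
  have hS : ¬ HasShortZeroSumSubseq S := by
    rintro ⟨T, hTS, hT0, hT1, hTn⟩
    obtain ⟨A, hA, T, hT, rfl⟩ := Multiset.exists_add_eq_of_le_add hTS
    obtain ⟨B, hB, C, hC, rfl⟩ := Multiset.exists_add_eq_of_le_add hT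
    obtain ⟨a, ha, rfl⟩ := Multiset.le_replicate_iff.1 hA
    obtain ⟨b, hb, rfl⟩ := Multiset.le_replicate_iff.1 hB
    obtain ⟨c, hc, rfl⟩ := Multiset.le_replicate_iff.1 hC
    simp only [Multiset.sum_add, Multiset.sum_replicate, Multiset.card_add,
      Multiset.card_replicate, exponent_zmod_prod hmn] at hT0 hT1 hTn
    have h1 : m ∣ a + c := by
      rw [← ZMod.natCast_eq_zero_iff]
      simpa using congrArg Prod.fst hT0
    have h2 : n ∣ b + c := by
      rw [← ZMod.natCast_eq_zero_iff]
      simpa using congrArg Prod.snd hT0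
    have h3 : 0 < a + c → m ≤ a + c := fun h => Nat.le_of_dvd h h1
    have h4 : 0 < b + c → n ≤ b + c := fun h => Nat.le_of_dvd h h2
    omega
  have := lt_etaConst S hS
  simp only [S, Multiset.card_add, Multiset.card_replicate] at this
  omega

theorem stmt_0 (n1 n2 : ℕ) (hn1 : 3 ≤ n1) (hdvd : n1 ∣ n2) (hn2 : 0 < n2) :
    (C0 (ZMod n1 × ZMod n2)).Nonempty := by
  have hD := davenport_le hn2 hdvd
  have hη := le_etaConst (by omega) hn2 hdvd
  have hle := Nat.le_of_dvd hn2 hdvd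
  refine ⟨davenport (ZMod n1 × ZMod n2) + 1, le_rfl, by omega, ?_⟩
  refine hasShortZeroSumSubseq_of_card_eq_succ (exists_sum_eq_zero_of_davenport_le
    (exists_sum_eq_zero_of_le_card hn2 hdvd)) ?_
  rw [exponent_zmod_prod hdvd]
  omega
end

section
/- Let a, b be nonnegative integers with a ≥ 1 or b ≥ 2, and let G = C_{3^a 5^b}^3 (the direct sum of three copies of the cyclic group of order 3^a 5^b). Then C_0(G) is nonempty. -/
/-! ### The search for short-free sequences over `C₅³`, in the form evaluated by the kernel -/

namespace Search

/-- `Bool` case distinction, written with the recursor so that the kernel unfolds nothing. -/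
local notation "cond[" c "," a "," b "]" => Bool.rec (motive := fun _ => Bool) b a c

/-- Positions are `1000 + x₀ + 10 x₁ + 100 x₂`. -/
def pos (x₀ x₁ x₂ : ℕ) : ℕ := Nat.pow 2 (Nat.add 1000 (Nat.add (Nat.mod x₀ 5) (Nat.add (Nat.mul 10 (Nat.mod x₁ 5)) (Nat.mul 100 (Nat.mod x₂ 5)))))

def lowPart : ℕ := 18446744073709551615
def unitBit : ℕ := 2 ^ 1000
def window : ℕ := 1161359735309809487492772179777990878909388261334397317307499452241552045724454390353632747904077709015677872470222640960672535393161854906281417978374259664348653132662859165403791828175424652817209426191808004690011458198162906212831007432494610517124177950018178003562276073293767464477457553775467419608620628745681286390590346261292795680762782944032211993974347585764174786850701917975457652913060126654679784618764340664527867437897551491726596875462430896029556127627415329355157988576256790831229453485921347314326734866061776712590595505150802527218081705408437205948308433371345494871353718198518621763060159110430375348259464821252319149906159839806905720583601080145950199827847010543899637887655175030229877119252610974133367274723750797589882892120813842611313196993233605690125879807995329922755693010909397360668385881800817495562614951702563069861770944271306715397127717968805213612334548161246443524017584984217137560545708977897505360270731974437227961097630772938444849182451216393210750217377530516063984637357614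025669759480662462702601847429249212787394751424144397792484550669945436652787613016962666950483930112023497275426501693541586203401778483460004701072677081930825966860853099985237140292461224659256186270178817995902117641003472306119241961921710004948422299409505221851767975368392037088375554042757120
def spread : ℕ := 121621835956163061756237034374061469615199839328098716641780105268897425369455881663472099646118455023761148684539536449663339190720154004242246610211444408132506222625
def startMask : ℕ := 1717868336763497725268546500119473555258457189745223542605071850981034765622590523391490292533138989962906365663153125629543939342645236537014934836525638082652825953696372878523055545828217520712116663696965318292631312897885749627048828235588909701516983404611957638131775286166538313266761857175765734850772763429612118146214396647819065852621000375397996804668198969529119846179127178171433928613346512017609700535042733590012178898461338192728453102857558602217787548810665591740182748222869540481389886776258368619760402242520203821482479318573833385712289628086763328162782276116463098519830891129221554848954512127756389500054963406002845255656678959685449662425580223687607571918194336857105144694528985138081817847274480038732940489579713129370274724364793765232117702090104694768394311689856950520446873793598651801958653803231912929412482613610878134811983228326675242008204316548181802721688506036871364320664433817309171740082074464142699783653532657963878633711744579132719220519864468878948965649081113301787077040259267399265451379412848220958684740743336080311982967774500025923520806657453353457352927149005788453281956097458492862035806652566055609790895261749999528211562431616425243547899660564633421785125090439623135291209969439808370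3269092724112536488614752595879014862779973225044764106482978466196179917489027807594313151670152905653383851429229963867646997606866733249746671665515156677969504357045819677782847024325476751438345682773838251287067158396634424069361961445907673550401327229537036717794956226495984558153062035262080766446654409943493314035734203451597368436103015048407163633847833971937148661381667085818204800473924538204160000
def line : ℕ := 300022410012154849865559013736800506957193347277549410084250108743698294314982114298095546068394840275726508416914881111052400679993847932207568172091560094510167897695078467591790088941746391972582717100285301299540294355487165491656635230490157761607993501375223180694492035286273482831441758705942528
def plane₀ : ℕ := 365579224548785134834747324513604832775700911665359478130950468660091535909410369453891751829763670788405397710350760753907616265953582120923828784840225873846976328570198880978786305017851126678727055459482064954474247653407404697879489034700628969372431887679937208474391153808494041457944429786186967579570995200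
def plane₁ : ℕ := 857739920785501724541250207793798045515153113347082599740869666609026034415190721710362702125151817896024408996279100514679404337602468145664458177732388102495452845975057146703840764917794807453767408548406747765050776099093058953986737305189239572937197683569853837482922942654928848547681350427867668166143656594742437360168758330965356589956921570335235420038603826749949350114967524065592738577110299506505953390362624
def plane₂ : ℕ := 943095016511324297691205182828713886527311868383259175573253031299525944875983851257923131566941130729071035973024577486210824015601430735920734166446851210155974987303874019572708234438595536284589408007598546403614701029048921276689122042135128155971127904728500849528946788572842914171653762745182046480944876780659933050421971054708630389703328694562149040889518019770910915000763507222951063259408264453625753204723009933488947200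
def plane₃ : ℕ := 920991227061840134464067561356165195998871700054846315328882166288281979744021288230359543195958392251112976691369367037702213515966214036508792979205483713563009011521982431580310126939771400512703450495834680753551199454120692695134355649741781659751602804885774274565720423193438625725991156130193853157301587923286877631772456492873878007418064905620181087590894417480992206463030751384901383273077459141575234474414756279091200
def plane₄ : ℕ := 899405495177578256312566721857668508089371153375036118638456968065848373837099471630407859431238577128412327201376207413195479813141491857880535711709719382055396427934989215534022920220310255163385565889599328189389544698601724520763627124899153313729237286224567199638307210763907817890366868236655430483388144841671087643985116340724744015104295995681433859394121617114895677267435755449288198092351243557868590877386158899200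
def plane₅ : ℕ := 878325678884353765930240213489662154903929968290730042344343476912489012846646664347160549154656704850967933129791943231313638238069809190576877794001232980322313340612645111759409241500538066880294181704158394955034033550633983613597287923165694388272007259691996755302867965948674093661846787808897215927673983081367046942869485296137049129586732791118326603140134906921495410225549124145224093353294028037592998061749043200

noncomputable section

def add (F b : ℕ) : ℕ :=
  Nat.xor (Nat.lor F (Nat.mul (Nat.land (Nat.div F b) window) spread)) (Nat.mod F 1152921504606846883)

def avail (P F : ℕ) : ℕ := Nat.xor P (Nat.land (Nat.lor P lowPart) F)

/-- `roomFor n Ps F D`: the planes in `Ps` can lose at most `D` altogether. -/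
def roomStep (n : ℕ) (ih : ℕ → Bool) (D a : ℕ) : Bool :=
  cond[Nat.ble unitBit (Nat.land a (Nat.sub a unitBit)), ih D,
    cond[Nat.ble unitBit a,
      cond[Nat.ble n (Nat.add D 4), ih (Nat.sub D (Nat.sub n 4)), false],
      cond[Nat.ble n D, ih (Nat.sub D n), false]]]

def room (n F : ℕ) (Ps : List ℕ) : ℕ → Bool :=
  List.rec (motive := fun _ => ℕ → Bool) (fun _ => true)
    (fun P _ ih D => roomStep n ih D (avail P F)) Ps

abbrev Acc := List (ℕ × ℕ)
abbrev Rest := ℕ → ℕ → Acc → ℕ → ℕ → Bool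
abbrev Next := ℕ → Acc → ℕ → Bool

def take₄ (ih : Rest) (c F : ℕ) (acc : Acc) (k D b : ℕ) : Bool :=
  ih (avail c F) F ((b, 4) :: acc) (Nat.sub k 4) D

def take₃ (ih : Rest) (c F : ℕ) (acc : Acc) (k D b : ℕ) : Bool :=
  cond[Nat.beq (Nat.land F b) 0, take₄ ih c (add F b) acc k D b, true]

def take₂ (h : ℕ) (ih : Rest) (c F : ℕ) (acc : Acc) (k D b : ℕ) : Bool :=
  cond[ih (avail c F) F ((b, 2) :: acc) (Nat.sub k 2) D,
    cond[Nat.ble 4 h, cond[Nat.ble 4 k, cond[Nat.beq (Nat.land F b) 0,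
      take₃ ih c (add F b) acc k D b, true], true], true], false]

def take₁ (h : ℕ) (ih : Rest) (c F : ℕ) (acc : Acc) (k D b : ℕ) : Bool :=
  cond[ih (avail c F) F ((b, 1) :: acc) (Nat.sub k 1) D,
    cond[Nat.ble 2 h, cond[Nat.ble 2 k, cond[Nat.beq (Nat.land F b) 0,
      take₂ h ih c (add F b) acc k D b, true], true], true], false]

def tryTake (h n : ℕ) (Ps : List ℕ) (ih : Rest) (c F : ℕ) (acc : Acc) (k D b : ℕ) : Bool :=
  cond[room n F Ps D, take₁ h ih c F acc k D b, true]

def split (h n : ℕ) (Ps : List ℕ) (ih : Rest) (c F : ℕ) (acc : Acc) (k D b : ℕ) : Bool :=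
  cond[ih c F acc k D, tryTake h n Ps ih c (add F b) acc k D b, false]

def pick (h n : ℕ) (Ps : List ℕ) (ih : Rest) (c F : ℕ) (acc : Acc) (k D c' : ℕ) : Bool :=
  split h n Ps ih c' F acc k D (Nat.sub c c')

def step (h n : ℕ) (Ps : List ℕ) (next : Next) (ih : Rest) (c F : ℕ) (acc : Acc) (k D : ℕ) : Bool :=
  cond[Nat.ble unitBit c,
    cond[Nat.beq k 0, next F acc D, pick h n Ps ih c F acc k D (Nat.land c (Nat.sub c unitBit))],
    cond[Nat.ble k D, next F acc (Nat.sub D k), true]]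

def go (h n : ℕ) (Ps : List ℕ) (next : Next) (fuel : ℕ) : Rest :=
  Nat.rec (motive := fun _ => Rest) (fun _ _ _ _ _ => false)
    (fun _ ih => step h n Ps next ih) fuel

def cnt (acc : Acc) (b : ℕ) : ℕ :=
  List.rec (motive := fun _ => ℕ) 0
    (fun p _ ih => Bool.rec (motive := fun _ => ℕ) ih p.2 (Nat.beq p.1 b)) acc

def sum₅ (f : ℕ → ℕ) : ℕ := Nat.add (f 0) (Nat.add (f 1) (Nat.add (f 2) (Nat.add (f 3) (f 4))))

def moment (acc : Acc) (f : ℕ → ℕ → ℕ → ℕ) : ℕ :=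
  Nat.mod (sum₅ fun i => sum₅ fun j => sum₅ fun k => Nat.mul (cnt acc (pos i j k)) (f i j k)) 5

def leaf (acc : Acc) (D : ℕ) : Bool :=
  cond[Nat.beq D 0,
    cond[Nat.beq (moment acc fun i _ _ => i) 0, cond[Nat.beq (moment acc fun _ j _ => j) 0,
      cond[Nat.beq (moment acc fun _ _ k => k) 0, false, true], true], true], false]

def planes (h n : ℕ) (Ps : List ℕ) : Next :=
  List.rec (motive := fun _ => Next) (fun _ => leaf)
    (fun P Ps ih F acc D => go h n Ps ih 21 (avail P F) F acc n D) Ps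

def keyStep (acc : Acc) (x y : ℕ × ℕ × ℕ) (a r : ℕ) : ℕ :=
  Nat.add (Nat.mul 5 r) (cnt acc (pos (Nat.add (Nat.mul a x.1) y.1) (Nat.add (Nat.mul a x.2.1) y.2.1) (Nat.add (Nat.mul a x.2.2) y.2.2)))

def key (acc : Acc) (x y : ℕ × ℕ × ℕ) : ℕ :=
  keyStep acc x y 1 (keyStep acc x y 2 (keyStep acc x y 3 (keyStep acc x y 4 0)))

def cross (a b c d : ℕ) : ℕ := Nat.mod (Nat.add (Nat.mul a d) (Nat.mul 4 (Nat.mul b c))) 5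
def crossNe (x y : ℕ × ℕ × ℕ) : Bool :=
  cond[Nat.beq (cross x.1 x.2.1 y.1 y.2.1) 0, cond[Nat.beq (cross x.1 x.2.2 y.1 y.2.2) 0, false, true], true]

def plane₀Pts : List (ℕ × ℕ × ℕ) :=
  [(1,0,0),(2,0,0),(3,0,0),(4,0,0),(0,1,0),(1,1,0),(2,1,0),(3,1,0),(4,1,0),(0,2,0),(1,2,0),(2,2,0),(3,2,0),(4,2,0),
   (0,3,0),(1,3,0),(2,3,0),(3,3,0),(4,3,0),(0,4,0),(1,4,0),(2,4,0),(3,4,0),(4,4,0)]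
def plane₁Pts : List (ℕ × ℕ × ℕ) :=
  [(1,0,0),(2,0,0),(3,0,0),(4,0,0),(0,0,1),(1,0,1),(2,0,1),(3,0,1),(4,0,1),(0,0,2),(1,0,2),(2,0,2),(3,0,2),(4,0,2),
   (0,0,3),(1,0,3),(2,0,3),(3,0,3),(4,0,3),(0,0,4),(1,0,4),(2,0,4),(3,0,4),(4,0,4)]

/-- The union of the `b` with `(b, m) ∈ acc`. -/
def level (acc : Acc) (m : ℕ) : ℕ :=
  List.rec (motive := fun _ => ℕ) 0
    (fun p _ ih => Bool.rec (motive := fun _ => ℕ) ih (Nat.lor p.1 ih) (Nat.beq p.2 m)) acc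

def canonAt (acc : Acc) (pts : List (ℕ × ℕ × ℕ)) (x : ℕ × ℕ × ℕ) (m K A : ℕ) : Bool :=
  List.rec (motive := fun _ => Bool) true (fun y _ ih =>
    cond[Nat.beq (Nat.land A (pos y.1 y.2.1 y.2.2)) 0, ih,
     cond[Nat.beq (cnt acc (pos y.1 y.2.1 y.2.2)) m, cond[crossNe x y, cond[Nat.ble (key acc x y) K, ih, false], ih], ih]]) pts

def canon (acc : Acc) (pts : List (ℕ × ℕ × ℕ)) (h m K A A' : ℕ) : Bool :=
  List.rec (motive := fun _ => Bool) true (fun x _ ih =>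
    cond[Nat.beq (Nat.land A (pos x.1 x.2.1 x.2.2)) 0, ih,
      cond[Nat.beq (cnt acc (pos x.1 x.2.1 x.2.2)) h, cond[canonAt acc pts x m K A', ih, false], ih]]) pts

def addn (F b m : ℕ) : ℕ := Nat.rec (motive := fun _ => ℕ) F (fun _ F => add F b) m

def stage₃ (v h m₂ m₃ n₀ q r n₁ : ℕ) (F : ℕ) (acc : Acc) : Bool :=
  cond[Nat.beq (Nat.mod F q) r,
    cond[cond[Nat.beq n₁ n₀, cond[Nat.ble m₃ m₂, cond[Nat.beq m₃ m₂,
        canon acc plane₁Pts h m₂ (key acc (1, 0, 0) (0, 1, 0)) (level acc h) (level acc m₂),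
        true], false], true],
      cond[canonAt acc plane₁Pts (1, 0, 0) m₃ (key acc (1, 0, 0) (0, 0, 1)) (level acc m₃),
        planes h n₁ [plane₂, plane₃, plane₄, plane₅] F acc
          (Nat.sub (Nat.add v (Nat.add n₀ (Nat.mul 5 n₁))) 32),
        true], true], true]

def enter₂ (v h m₂ n₀ q r m₃ lo : ℕ) (F : ℕ) (acc : Acc) : Bool :=
  go m₃ 0 [] (fun F acc D => stage₃ v h m₂ m₃ n₀ q r (Nat.add lo D) F acc) 21
    (avail (Nat.sub plane₁ (pos 0 0 1)) F) F ((pos 0 0 1, m₃) :: acc)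
    (Nat.sub n₀ m₃) (Nat.sub n₀ lo)

def stage₂ (v h m₂ n₀ q r : ℕ) (F : ℕ) (acc : Acc) (m₃ : ℕ) : Bool :=
  cond[Nat.ble m₃ h, cond[Nat.ble m₃ n₀, cond[Nat.beq (Nat.land F (pos 0 0 1)) 0,
    enter₂ v h m₂ n₀ q r m₃ (Nat.div (Nat.sub 36 (Nat.add v n₀)) 5) (addn F (pos 0 0 1) m₃) acc,
    true], true], true]

def exit₁ (v h m₂ q₀ r₀ q r n₀ : ℕ) (F : ℕ) (acc : Acc) : Bool :=
  cond[Nat.beq (Nat.mod n₀ q₀) r₀,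
    cond[canon acc plane₀Pts h m₂ (key acc (1, 0, 0) (0, 1, 0)) (level acc h) (level acc m₂),
      cond[Nat.ble 32 (Nat.add v n₀), false,
        cond[stage₂ v h m₂ n₀ q r F acc 1, cond[stage₂ v h m₂ n₀ q r F acc 2,
          stage₂ v h m₂ n₀ q r F acc 4, false], false]],
      true], true]

def enter₁ (v h m₂ q₀ r₀ q r lo : ℕ) (F : ℕ) (acc : Acc) : Bool :=
  go m₂ 0 [] (fun F acc D => exit₁ v h m₂ q₀ r₀ q r (Nat.add lo D) F acc) 21
    (avail (Nat.sub plane₀ (pos 0 1 0)) F) F ((pos 0 1 0, m₂) :: acc)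
    (Nat.sub 100 m₂) (Nat.sub 100 lo)

def stage₁ (h m₂ q₀ r₀ q r v : ℕ) (F : ℕ) (acc : Acc) : Bool :=
  cond[Nat.beq (Nat.land F (pos 0 1 0)) 0,
    enter₁ v h m₂ q₀ r₀ q r (Nat.div (Nat.sub 37 v) 6) (addn F (pos 0 1 0) m₂) acc, true]

def enter₀ (h m₂ q₀ r₀ q r : ℕ) (F : ℕ) : Bool :=
  go h 0 [] (fun F acc D => stage₁ h m₂ q₀ r₀ q r (Nat.add h D) F acc)
    4 (avail line F) F [(pos 1 0 0, h)] 20 20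

def search (h m₂ q₀ r₀ q r : ℕ) : Bool :=
  enter₀ h m₂ q₀ r₀ q r (addn startMask (pos 1 0 0) h)

end

end Search

/-! ### Sets of positions as bit masks -/

namespace Search

theorem add_eq_lor_of_land_eq_zero {a b : ℕ} (h : a &&& b = 0) : a + b = a ||| b := by
  induction a using Nat.strong_induction_on generalizing b with
  | _ a ih =>
    rcases Nat.eq_zero_or_pos a with rfl | ha
    · simp
    have h2 : a / 2 &&& b / 2 = 0 := by rw [← Nat.and_div_two, h]
    have h1 := ih (a / 2) (by omega) h2
    have h3 : a % 2 = 0 ∨ b % 2 = 0 := by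
      have := congrArg (Nat.testBit · 0) h
      simp only [Nat.testBit_zero] at this
      by_contra! hc
      simp [show a % 2 = 1 by omega, show b % 2 = 1 by omega] at this
    have h4 : (a ||| b) / 2 = a / 2 ||| b / 2 := Nat.or_div_two
    have h6 : (a ||| b) % 2 = 1 ↔ a % 2 = 1 ∨ b % 2 = 1 := by simp
    omega

theorem window_digits : ∀ (a : Fin 5) (b c d : Fin 10),
    window.testBit (1000 * a.1 + 100 * b.1 + 10 * c.1 + d.1) →
      1 ≤ a.1 ∧ b.1 ≤ 4 ∧ c.1 ≤ 4 ∧ d.1 ≤ 4 := by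
  decide +kernel

set_option exponentiation.threshold 6000 in
theorem window_lt : window < 2 ^ 5000 := by decide +kernel

set_option exponentiation.threshold 6000 in
theorem window_spec {q : ℕ} (h : window.testBit q) :
    1000 ≤ q ∧ q % 10 ≤ 4 ∧ q / 10 % 10 ≤ 4 ∧ q / 100 % 10 ≤ 4 := by
  have hq : q < 5000 := by
    by_contra! hq
    have := window_lt.trans_le (Nat.pow_le_pow_right (n := 2) (by norm_num) hq)
    simp [Nat.testBit_lt_two_pow this] at h
  have := window_digits ⟨q / 1000, by omega⟩ ⟨q / 100 % 10, by omega⟩ ⟨q / 10 % 10, by omega⟩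
    ⟨q % 10, by omega⟩
  dsimp only at this
  rw [show 1000 * (q / 1000) + 100 * (q / 100 % 10) + 10 * (q / 10 % 10) + q % 10 = q by omega] at this
  have := this h
  omega

theorem testBit_mul_two_pow_add_one {A M k p : ℕ} (hA : A &&& M = A) (hM : M &&& (M * 2 ^ k) = 0)
    (h : (A * (2 ^ k + 1)).testBit p) : A.testBit p ∨ k ≤ p ∧ A.testBit (p - k) := by
  have hd : A &&& (A * 2 ^ k) = 0 := by
    apply Nat.eq_of_testBit_eq
    intro i
    have h1 := congrArg (Nat.testBit · i) hM
    have h2 : ∀ j, A.testBit j → M.testBit j := fun j hj => by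
      rw [← hA, Nat.testBit_and] at hj
      exact (Bool.and_eq_true _ _ ▸ hj).2
    simp only [Nat.testBit_and, Nat.testBit_mul_two_pow, Nat.zero_testBit] at h1 ⊢
    have := h2 i; have := h2 (i - k)
    revert h1 this; revert this
    cases A.testBit i <;> cases A.testBit (i - k) <;> cases M.testBit i <;> cases M.testBit (i - k) <;> simp
  rw [mul_add, mul_one, add_comm, add_eq_lor_of_land_eq_zero hd, Nat.testBit_or, Nat.testBit_mul_two_pow] at h
  simpa using h

theorem land_mul_two_pow_add_one {A M k : ℕ} (hA : A &&& M = A) (hM : M &&& (M * 2 ^ k) = 0) :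
    (A * (2 ^ k + 1)) &&& (M * (2 ^ k + 1)) = A * (2 ^ k + 1) := by
  apply Nat.eq_of_testBit_eq
  intro i
  have h2 : ∀ j, A.testBit j → M.testBit j := fun j hj => by
      rw [← hA, Nat.testBit_and] at hj
      exact (Bool.and_eq_true _ _ ▸ hj).2
  rw [Nat.testBit_and]
  cases h : (A * (2 ^ k + 1)).testBit i
  · simp
  · rw [mul_add M, mul_one, add_comm (M * _), add_eq_lor_of_land_eq_zero hM, Nat.testBit_or, Nat.testBit_mul_two_pow]
    rcases testBit_mul_two_pow_add_one hA hM h with h | ⟨h1, h⟩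
    · simp [h2 _ h]
    · simp [h1, h2 _ h]

theorem window_mul_spread {W p : ℕ} (hW : W &&& window = W) (h : (W * spread).testBit p) :
    ∃ q a b c, W.testBit q ∧ a ≤ 1 ∧ b ≤ 1 ∧ c ≤ 1 ∧ p = q + 5 * a + 50 * b + 500 * c := by
  have hs : spread = (2 ^ 5 + 1) * (2 ^ 50 + 1) * (2 ^ 500 + 1) := by decide +kernel
  have h1 : window &&& (window * 2 ^ 5) = 0 := by decide +kernel
  have h2 : (window * (2 ^ 5 + 1)) &&& ((window * (2 ^ 5 + 1)) * 2 ^ 50) = 0 := by decide +kernel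
  have h3 : (window * (2 ^ 5 + 1) * (2 ^ 50 + 1)) &&&
      ((window * (2 ^ 5 + 1) * (2 ^ 50 + 1)) * 2 ^ 500) = 0 := by decide +kernel
  have k1 := land_mul_two_pow_add_one hW h1
  have k2 := land_mul_two_pow_add_one k1 h2
  rw [hs, ← mul_assoc, ← mul_assoc] at h
  obtain ⟨p₁, c, hc, hp, h⟩ : ∃ p₁ c, c ≤ 1 ∧ p = p₁ + 500 * c ∧ (W * (2 ^ 5 + 1) * (2 ^ 50 + 1)).testBit p₁ := by
    rcases testBit_mul_two_pow_add_one k2 h3 h with h | ⟨h', h⟩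
    · exact ⟨p, 0, by simp, by simp, h⟩
    · exact ⟨p - 500, 1, by simp, by omega, h⟩
  obtain ⟨p₂, b, hb, hp', h⟩ : ∃ p₂ b, b ≤ 1 ∧ p₁ = p₂ + 50 * b ∧ (W * (2 ^ 5 + 1)).testBit p₂ := by
    rcases testBit_mul_two_pow_add_one k1 h2 h with h | ⟨h', h⟩
    · exact ⟨p₁, 0, by simp, by simp, h⟩
    · exact ⟨p₁ - 50, 1, by simp, by omega, h⟩
  obtain ⟨p₃, a, ha, hp'', h⟩ : ∃ p₃ a, a ≤ 1 ∧ p₂ = p₃ + 5 * a ∧ W.testBit p₃ := by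
    rcases testBit_mul_two_pow_add_one hW h1 h with h | ⟨h', h⟩
    · exact ⟨p₂, 0, by simp, by simp, h⟩
    · exact ⟨p₂ - 5, 1, by simp, by omega, h⟩
  exact ⟨p₃, a, b, c, h, ha, hb, hc, by omega⟩

end Search

/-! ### Bit masks recording the sums of short subsequences -/

namespace Search

/-- The group `C₅³`. -/
abbrev V := Fin 3 → ZMod 5

def idx (x : V) : ℕ := 1000 + (x 0).val + 10 * (x 1).val + 100 * (x 2).val

def coord (p : ℕ) : V := ![(p : ZMod 5), ((p / 10 : ℕ) : ZMod 5), ((p / 100 : ℕ) : ZMod 5)]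

theorem cast_add_five (n k : ℕ) : ((n + 5 * k : ℕ) : ZMod 5) = n := by
  push_cast
  rw [show (5 : ZMod 5) = 0 from rfl, zero_mul, add_zero]

theorem le_idx (x : V) : 1000 ≤ idx x := by unfold idx; omega

theorem coord_idx (x : V) : coord (idx x) = x := by
  have h0 := (x 0).val_lt; have h1 := (x 1).val_lt; have h2 := (x 2).val_lt
  have e0 : idx x = (x 0).val + 5 * (200 + 2 * (x 1).val + 20 * (x 2).val) := by unfold idx; omega
  have e1 : idx x / 10 = (x 1).val + 5 * (20 + 2 * (x 2).val) := by unfold idx; omega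
  have e2 : idx x / 100 = (x 2).val + 5 * 2 := by unfold idx; omega
  unfold coord
  rw [e1, e2, e0, cast_add_five, cast_add_five, cast_add_five]
  ext i
  fin_cases i <;> simp

theorem idx_injective : Function.Injective idx := fun x y h => by
  rw [← coord_idx x, h, coord_idx]

/-- The bits of `F` record sums of short subsequences of `R`. -/
def Valid (F : ℕ) (R : Multiset V) : Prop :=
  ∀ p, 1000 ≤ p → F.testBit p → ∃ T ≤ R, Multiset.card T + p / 1000 ≤ 5 ∧ T.sum = -coord p

theorem testBit_xor_salt {A B p : ℕ} (hp : 1000 ≤ p) :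
    (A ^^^ (B % 1152921504606846883)).testBit p = A.testBit p := by
  have h : B % 1152921504606846883 < 2 ^ p :=
    (Nat.mod_lt B (by norm_num)).trans (lt_of_lt_of_le (b := 2 ^ 60) (by norm_num)
      (Nat.pow_le_pow_right (by norm_num) (by omega)))
  rw [Nat.testBit_xor, Nat.testBit_lt_two_pow h, Bool.xor_false]

theorem add_def (F b : ℕ) :
    add F b = (F ||| ((F / b) &&& window) * spread) ^^^ (F % 1152921504606846883) := rfl

theorem coord_add {p : ℕ} {a b c : ℕ} (h0 : p % 10 ≤ 4) (h1 : p / 10 % 10 ≤ 4)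
    (ha : a ≤ 1) (hb : b ≤ 1) :
    coord (p + 5 * a + 50 * b + 500 * c) = coord p := by
  have e0 : p + 5 * a + 50 * b + 500 * c = p + 5 * (a + 10 * b + 100 * c) := by omega
  have e1 : (p + 5 * a + 50 * b + 500 * c) / 10 = p / 10 + 5 * (b + 10 * c) := by omega
  have e2 : (p + 5 * a + 50 * b + 500 * c) / 100 = p / 100 + 5 * c := by
    rw [show 100 = 10 * 10 from rfl, ← Nat.div_div_eq_div_mul, ← Nat.div_div_eq_div_mul, e1]
    omega
  unfold coord
  rw [e1, e2, e0, cast_add_five, cast_add_five, cast_add_five]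

theorem coord_add_idx {p : ℕ} (h0 : p % 10 ≤ 4) (h1 : p / 10 % 10 ≤ 4) (x : V) : coord (p + idx x) = coord p + x := by
  have k0 := (x 0).val_lt; have k1 := (x 1).val_lt; have k2 := (x 2).val_lt
  have e0 : p + idx x = p + (x 0).val + 5 * (200 + 2 * (x 1).val + 20 * (x 2).val) := by
    unfold idx; omega
  have e1 : (p + idx x) / 10 = p / 10 + (x 1).val + 5 * (20 + 2 * (x 2).val) := by unfold idx; omega
  have e2 : (p + idx x) / 100 = p / 100 + (x 2).val + 5 * 2 := by unfold idx; omega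
  unfold coord
  rw [e1, e2, e0, cast_add_five, cast_add_five, cast_add_five]
  ext i
  fin_cases i <;> simp

theorem Valid.add {F : ℕ} {R : Multiset V} (h : Valid F R) (x : V) :
    Valid (add F (2 ^ idx x)) (x ::ₘ R) := by
  intro p hp hF
  rw [add_def, testBit_xor_salt hp, Nat.testBit_or, Bool.or_eq_true] at hF
  rcases hF with hF | hF
  · obtain ⟨T, hT, hc⟩ := h p hp hF
    exact ⟨T, hT.trans (Multiset.le_cons_self R x), hc⟩
  · obtain ⟨q, a, b, c, hq, ha, hb, hc, rfl⟩ := window_mul_spread (by rw [Nat.land_assoc, Nat.and_self]) hF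
    rw [Nat.testBit_and, Bool.and_eq_true, Nat.testBit_div_two_pow] at hq
    obtain ⟨hq0, hq1, hq2, hq3⟩ := window_spec hq.2
    obtain ⟨T, hT, hcard, hsum⟩ := h (q + idx x) (by omega) hq.1
    refine ⟨x ::ₘ T, Multiset.cons_le_cons x hT, ?_, ?_⟩
    · have h0 := (x 0).val_lt; have h1 := (x 1).val_lt; have h2 := (x 2).val_lt
      rw [Multiset.card_cons]
      unfold idx at hcard
      omega
    · rw [Multiset.sum_cons, hsum, coord_add hq1 hq2 ha hb, coord_add_idx hq1 hq2]
      abel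

set_option exponentiation.threshold 6000 in
theorem valid_startMask : Valid startMask 0 := by
  intro p hp h
  have hlt : p < 6000 := by
    by_contra! hq
    have h6 : startMask < 2 ^ 6000 := by decide +kernel
    simp [Nat.testBit_lt_two_pow (h6.trans_le (Nat.pow_le_pow_right (n := 2) (by norm_num) hq))] at h
  have key : ∀ (a : Fin 6) (b c d : Fin 10),
    startMask.testBit (1000 * a.1 + 100 * b.1 + 10 * c.1 + d.1) →
      b.1 % 5 = 0 ∧ c.1 % 5 = 0 ∧ d.1 % 5 = 0 := by decide +kernel
  have := key ⟨p / 1000, by omega⟩ ⟨p / 100 % 10, by omega⟩ ⟨p / 10 % 10, by omega⟩ ⟨p % 10, by omega⟩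
  dsimp only at this
  rw [show 1000 * (p / 1000) + 100 * (p / 100 % 10) + 10 * (p / 10 % 10) + p % 10 = p by omega] at this
  have := this h
  refine ⟨0, le_rfl, by simp; omega, ?_⟩
  have e0 : (p : ZMod 5) = 0 := (ZMod.natCast_eq_zero_iff _ _).2 (by omega)
  have e1 : ((p / 10 : ℕ) : ZMod 5) = 0 := (ZMod.natCast_eq_zero_iff _ _).2 (by omega)
  have e2 : ((p / 100 : ℕ) : ZMod 5) = 0 := (ZMod.natCast_eq_zero_iff _ _).2 (by omega)
  unfold coord
  rw [e0, e1, e2]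
  ext i
  fin_cases i <;> simp

/-- No nonempty subsequence of length at most `5` has sum `0`. -/
def ShortFree (S : Multiset V) : Prop := ∀ T ≤ S, T ≠ 0 → Multiset.card T ≤ 5 → T.sum ≠ 0

theorem Valid.testBit_idx {F : ℕ} {R S : Multiset V} (h : Valid F R) (hS : ShortFree S) {x : V}
    (hx : x ::ₘ R ≤ S) : F.testBit (idx x) = false := by
  by_contra hF
  rw [Bool.not_eq_false] at hF
  obtain ⟨T, hT, hc, hs⟩ := h _ (le_idx x) hF
  have := le_idx x
  refine hS (x ::ₘ T) ((Multiset.cons_le_cons x hT).trans hx) (by simp)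
    (by rw [Multiset.card_cons]; omega) ?_
  rw [Multiset.sum_cons, hs, coord_idx, add_neg_cancel]

end Search

/-! ### Elementary steps of the search -/

namespace Search

theorem land_sub_one {C : ℕ} (hC : C ≠ 0) : ∃ j, C.testBit j ∧ C - (C &&& (C - 1)) = 2 ^ j ∧
    ∀ p, (C &&& (C - 1)).testBit p = (C.testBit p && decide (p ≠ j)) := by
  induction C using Nat.strong_induction_on with
  | _ C ih =>
    rcases Nat.even_or_odd' C with ⟨m, rfl | rfl⟩
    · obtain ⟨j, h1, h2, h3⟩ := ih m (by omega) (by omega)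
      have e : 2 * m - 1 = 2 * (m - 1) + 1 := by omega
      have hd : (2 * m &&& (2 * m - 1)) / 2 = m &&& (m - 1) := by
        rw [Nat.and_div_two, e]; congr 1 <;> omega
      have hm : (2 * m &&& (2 * m - 1)) % 2 = 0 := by
        have : (2 * m &&& (2 * m - 1)) % 2 = 1 ↔ _ := Nat.and_mod_two_eq_one
        omega
      have hle : m &&& (m - 1) ≤ m := Nat.and_le_left
      refine ⟨j + 1, by rwa [Nat.testBit_succ, Nat.mul_div_cancel_left _ two_pos], by rw [pow_succ]; omega, ?_⟩
      rintro (_ | p)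
      · simp [Nat.testBit_zero, hm]
      · rw [Nat.testBit_succ, hd, h3, Nat.testBit_succ, Nat.mul_div_cancel_left _ two_pos]
        simp
    · have e : (2 * m + 1 &&& (2 * m + 1 - 1)) = 2 * m := by
        have hd : (2 * m + 1 &&& (2 * m + 1 - 1)) / 2 = m := by
          rw [Nat.and_div_two, show (2 * m + 1) / 2 = m by omega,
            show (2 * m + 1 - 1) / 2 = m by omega, Nat.and_self]
        have hm : (2 * m + 1 &&& (2 * m + 1 - 1)) % 2 = 0 := by
          have : (2 * m + 1 &&& (2 * m + 1 - 1)) % 2 = 1 ↔ _ := Nat.and_mod_two_eq_one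
          omega
        omega
      refine ⟨0, by simp [Nat.testBit_zero], by rw [e]; simp, ?_⟩
      rw [e]
      rintro (_ | p)
      · simp [Nat.testBit_zero]
      · rw [Nat.testBit_succ, Nat.testBit_succ, show (2 * m + 1) / 2 = 2 * m / 2 by omega]
        simp

theorem unitBit_eq : unitBit = 2 ^ 1000 := rfl

theorem lowBit {c : ℕ} (hc : unitBit ≤ c) : ∃ j, 1000 ≤ j ∧ c.testBit j ∧
    c - (c &&& (c - unitBit)) = 2 ^ j ∧
    ∀ p, 1000 ≤ p → (c &&& (c - unitBit)).testBit p = (c.testBit p && decide (p ≠ j)) := by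
  rw [unitBit_eq] at *
  generalize 1000 = N at *
  have hs := Nat.mod_lt c (Nat.two_pow_pos N)
  have hC : c / 2 ^ N ≠ 0 := (Nat.div_pos hc (Nat.two_pow_pos N)).ne'
  obtain ⟨j, h1, h2, h3⟩ := land_sub_one hC
  have e1 := Nat.div_add_mod c (2 ^ N)
  generalize c / 2 ^ N = C at *
  generalize c % 2 ^ N = s at *
  subst e1
  have e2 : 2 ^ N * C + s - 2 ^ N = 2 ^ N * (C - 1) + s := by
    obtain ⟨C, rfl⟩ := Nat.exists_eq_succ_of_ne_zero hC
    rw [Nat.succ_eq_add_one, mul_add, Nat.add_sub_cancel]; omega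
  have e3 : ((2 ^ N * C + s) &&& (2 ^ N * C + s - 2 ^ N)) = 2 ^ N * (C &&& (C - 1)) + s := by
    apply Nat.eq_of_testBit_eq
    intro i
    rw [e2, Nat.testBit_and, Nat.testBit_two_pow_mul_add _ hs, Nat.testBit_two_pow_mul_add _ hs,
      Nat.testBit_two_pow_mul_add _ hs]
    split_ifs <;> simp
  have hle : C &&& (C - 1) ≤ C := Nat.and_le_left
  refine ⟨N + j, by omega, ?_, ?_, ?_⟩
  · rw [Nat.testBit_two_pow_mul_add _ hs, if_neg (by omega), Nat.add_sub_cancel_left, h1]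
  · rw [e3, Nat.add_sub_add_right, ← Nat.mul_sub, h2, pow_add]
  · intro p hp
    rw [e3, Nat.testBit_two_pow_mul_add _ hs, if_neg (by omega), h3, Nat.testBit_two_pow_mul_add _ hs,
      if_neg (by omega)]
    congr 2
    simp only [ne_eq, eq_iff_iff]
    omega

theorem testBit_avail {P F p : ℕ} (hp : 1000 ≤ p) :
    (avail P F).testBit p = (P.testBit p && !F.testBit p) := by
  have hl : lowPart.testBit p = false := Nat.testBit_lt_two_pow
    (lt_of_lt_of_le (b := 2 ^ 64) (by decide +kernel) (Nat.pow_le_pow_right (by norm_num) (by omega)))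
  have e : avail P F = P ^^^ ((P ||| lowPart) &&& F) := rfl
  rw [e, Nat.testBit_xor, Nat.testBit_and, Nat.testBit_or, hl]
  cases P.testBit p <;> cases F.testBit p <;> rfl

theorem cond_iff (c a b : Bool) : Bool.rec (motive := fun _ => Bool) b a c = true ↔
    (c = true ∧ a = true) ∨ (c = false ∧ b = true) := by
  cases c <;> simp

theorem cnt_cons (b m : ℕ) (acc : Acc) (b' : ℕ) :
    cnt ((b, m) :: acc) b' = if b = b' then m else cnt acc b' := by
  have e : cnt ((b, m) :: acc) b' =
    Bool.rec (motive := fun _ => ℕ) (cnt acc b') m (Nat.beq b b') := rfl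
  rw [e]
  split_ifs with h
  · simp [h]
  · rw [show Nat.beq b b' = false by rw [Bool.eq_false_iff]; simpa using h]

end Search

/-! ### Bounds used for pruning -/

namespace Search

attribute [local irreducible] unitBit

theorem ble_false {a b : ℕ} : Nat.ble a b = false ↔ ¬ a ≤ b := by
  rw [← Bool.not_eq_true, Nat.ble_eq]

theorem beq_false {a b : ℕ} : Nat.beq a b = false ↔ a ≠ b := by
  rw [← Bool.not_eq_true, Nat.beq_eq]

theorem land_def (a b : ℕ) : Nat.land a b = a &&& b := rfl

theorem take₃_iff {ih c F acc k D b} : take₃ ih c F acc k D b = true ↔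
    (F &&& b = 0 → take₄ ih c (add F b) acc k D b = true) := by
  simp only [take₃, cond_iff, Nat.beq_eq, beq_false, land_def]
  tauto

theorem take₂_iff {h ih c F acc k D b} : take₂ h ih c F acc k D b = true ↔
    ih (avail c F) F ((b, 2) :: acc) (k - 2) D = true ∧
    (4 ≤ h → 4 ≤ k → F &&& b = 0 → take₃ ih c (add F b) acc k D b = true) := by
  simp only [take₂, cond_iff, Nat.ble_eq, Nat.beq_eq, ble_false, beq_false, land_def, Nat.sub_eq]
  tauto

theorem take₁_iff {h ih c F acc k D b} : take₁ h ih c F acc k D b = true ↔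
    ih (avail c F) F ((b, 1) :: acc) (k - 1) D = true ∧
    (2 ≤ h → 2 ≤ k → F &&& b = 0 → take₂ h ih c (add F b) acc k D b = true) := by
  simp only [take₁, cond_iff, Nat.ble_eq, Nat.beq_eq, ble_false, beq_false, land_def, Nat.sub_eq]
  tauto

theorem split_iff {h n Ps ih c F acc k D b} : split h n Ps ih c F acc k D b = true ↔
    ih c F acc k D = true ∧
    (room n (add F b) Ps D = true → take₁ h ih c (add F b) acc k D b = true) := by
  simp only [split, tryTake, cond_iff]
  cases room n (add F b) Ps D <;> simp

theorem step_iff {h n Ps next ih c F acc k D} : step h n Ps next ih c F acc k D = true ↔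
    (unitBit ≤ c → (k = 0 → next F acc D = true) ∧
      (k ≠ 0 → split h n Ps ih (c &&& (c - unitBit)) F acc k D (c - (c &&& (c - unitBit))) = true)) ∧
    (c < unitBit → k ≤ D → next F acc (D - k) = true) := by
  unfold step pick
  generalize unitBit = u
  simp only [cond_iff, Nat.ble_eq, Nat.beq_eq, ble_false, beq_false, land_def, Nat.sub_eq, not_le]
  by_cases h : u ≤ c
  · have h' := not_lt.2 h
    simp only [h, h', true_and, false_and, or_false, false_imp_iff, and_true, forall_const]
    by_cases hk : k = 0 <;> simp [hk]
  · simp only [h, not_le.1 h, true_and, false_and, false_or, false_imp_iff, forall_const]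
    by_cases hk : k ≤ D
    · simp [hk]
    · simp [hk, not_le.1 hk]

theorem room_nil {n F D} : room n F [] D = true := rfl

theorem room_cons_iff {n F P Ps D} : room n F (P :: Ps) D = true ↔
    (unitBit ≤ avail P F &&& (avail P F - unitBit) → room n F Ps D = true) ∧
    (¬ unitBit ≤ avail P F &&& (avail P F - unitBit) → unitBit ≤ avail P F →
      n ≤ D + 4 ∧ room n F Ps (D - (n - 4)) = true) ∧
    (¬ unitBit ≤ avail P F &&& (avail P F - unitBit) → ¬ unitBit ≤ avail P F →
      n ≤ D ∧ room n F Ps (D - n) = true) := by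
  have e : room n F (P :: Ps) D = roomStep n (room n F Ps) D (avail P F) := rfl
  rw [e]
  unfold roomStep
  generalize unitBit = u
  simp only [ cond_iff, Nat.ble_eq, ble_false, land_def, Nat.sub_eq, Nat.add_eq]
  tauto

theorem ShortFree.mono {S T : Multiset V} (hS : ShortFree S) (h : T ≤ S) : ShortFree T :=
  fun U hU => hS U (hU.trans h)

theorem ShortFree.count_le {S : Multiset V} (hS : ShortFree S) (x : V) : S.count x ≤ 4 := by
  by_contra! h
  refine hS (Multiset.replicate 5 x) (Multiset.le_count_iff_replicate_le.1 h) (by simp [Multiset.replicate_succ]) (by simp) ?_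
  rw [Multiset.sum_replicate]
  ext i
  simp [show (5 : ZMod 5) = 0 from rfl]

/-- Every term of `M` is marked in `c`. -/
def Covers (c : ℕ) (M : Multiset V) : Prop := ∀ x ∈ M, c.testBit (idx x)

/-- Every mark of `c` belongs to a point outside `R`. -/
def Clean (c : ℕ) (R : Multiset V) : Prop := ∀ p, 1000 ≤ p → c.testBit p → ∃ x, p = idx x ∧ x ∉ R

theorem covers_avail {S R M : Multiset V} {c F : ℕ} (hS : ShortFree S) (hF : Valid F R)
    (hM : R + M ≤ S) (h : Covers c M) : Covers (avail c F) M := by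
  intro x hx
  rw [testBit_avail (le_idx x), h x hx, hF.testBit_idx hS (x := x)]
  · rfl
  · refine le_trans ?_ hM
    rw [← Multiset.singleton_add, add_comm]
    exact add_le_add le_rfl (Multiset.singleton_le.2 hx)

theorem Clean.avail {c F : ℕ} {R : Multiset V} (h : Clean c R) : Clean (avail c F) R :=
  fun p hp hc => h p hp (by rw [testBit_avail hp, Bool.and_eq_true] at hc; exact hc.1)

theorem covers_lt {c : ℕ} {M : Multiset V} (h : Covers c M) (hc : c < unitBit) : M = 0 := by
  refine Multiset.eq_zero_of_forall_notMem fun x hx => ?_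
  have := Nat.ge_two_pow_of_testBit (h x hx)
  have h2 := Nat.pow_le_pow_right (n := 2) (by norm_num) (le_idx x)
  rw [unitBit_eq] at hc
  omega

def loss (n : ℕ) (Ms : List (Multiset V)) : ℕ := (Ms.map fun M => n - Multiset.card M).sum

theorem room_sound {S : Multiset V} (hS : ShortFree S) {n F : ℕ} {Ps : List ℕ}
    {Ms : List (Multiset V)} (hPM : List.Forall₂ Covers Ps Ms) :
    ∀ {R D}, Valid F R → R + Ms.sum ≤ S → loss n Ms ≤ D → room n F Ps D = true := by
  induction hPM with
  | nil => exact fun _ _ _ => room_nil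
  | @cons P M Ps Ms hP hPM ih =>
    intro R D hF hle hD
    rw [List.sum_cons] at hle
    have hle1 : R + M ≤ S := le_trans (by rw [← add_assoc]; exact Multiset.le_add_right _ _) hle
    have hle2 : R + Ms.sum ≤ S := le_trans (by gcongr; exact Multiset.le_add_left _ _) hle
    have hc := covers_avail hS hF hle1 hP
    simp only [loss, List.map_cons, List.sum_cons] at hD
    rw [room_cons_iff]
    refine ⟨fun _ => ih hF hle2 (by unfold loss; omega), fun h1 h2 => ?_, fun _ h2 => ?_⟩
    · obtain ⟨j, hj, -, -, h3⟩ := lowBit h2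
      have hM : Multiset.card M ≤ 4 := by
        rcases Multiset.empty_or_exists_mem M with rfl | ⟨x, hx⟩
        · simp
        have hall : ∀ y ∈ M, y = x := by
          have key : ∀ y ∈ M, idx y = j := fun y hy => by
            by_contra hne
            have := h3 _ (le_idx y)
            rw [hc y hy, Bool.true_and, decide_eq_true hne] at this
            have h4 := Nat.ge_two_pow_of_testBit this
            have h5 := Nat.pow_le_pow_right (n := 2) (by norm_num) (le_idx y)
            rw [unitBit_eq] at h1 h4
            omega
          exact fun y hy => idx_injective ((key y hy).trans (key x hx).symm)
        have := (hS.mono hle1).count_le x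
        rw [Multiset.eq_replicate_card.2 hall, Multiset.count_add, Multiset.count_replicate_self] at this
        omega
      exact ⟨by omega, ih hF hle2 (by unfold loss; omega)⟩
    · rw [not_le] at h2
      have := covers_lt hc h2
      subst this
      rw [Multiset.card_zero] at hD
      exact ⟨by omega, ih hF hle2 (by unfold loss; omega)⟩

end Search

/-! ### Soundness of the search along a line or plane -/

namespace Search

attribute [local irreducible] unitBit

/-- The state `(F, acc)` of the search describes the sequence `R`. -/
def Good (F : ℕ) (acc : Acc) (R : Multiset V) : Prop :=
  Valid F R ∧ ∀ x, cnt acc (2 ^ idx x) = R.count x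

/-- `R` has been decided, `M` is to be found among the marks of `c`, and `Ms` comes later. -/
structure Ready (S : Multiset V) (h n : ℕ) (Ms : List (Multiset V)) (c k D : ℕ)
    (R M : Multiset V) : Prop where
  clean : Clean c R
  covers : Covers c M
  count_le : ∀ x, M.count x ≤ h
  count_mem : ∀ x, M.count x = 0 ∨ M.count x = 1 ∨ M.count x = 2 ∨ M.count x = 4
  le : R + M + Ms.sum ≤ S
  card_le : Multiset.card M ≤ k
  le_card : k ≤ Multiset.card M + D
  loss_le : loss n Ms + (k - Multiset.card M) ≤ D

def Sound {ι : Type} (S : Multiset V) (h n : ℕ) (Ms : List (Multiset V)) (next : ι → Next)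
    (g : ι → Rest) : Prop :=
  ∀ c F acc k D R M, Good F acc R → Ready S h n Ms c k D R M → (∀ i, g i c F acc k D = true) →
    ∃ F' acc', Good F' acc' (R + M) ∧ ∀ i, next i F' acc' (D - (k - Multiset.card M)) = true

variable {ι : Type} {S : Multiset V} {h n : ℕ} {Ms : List (Multiset V)} {next : ι → Next}
  {g : ι → Rest} {c F k D m : ℕ} {acc : Acc} {R M : Multiset V} {x : V}

theorem Sound.finish (hS : ShortFree S) (hg : Sound S h n Ms next g)
    (hacc : ∀ x, cnt acc (2 ^ idx x) = R.count x) (hx : c.testBit (idx x) = false) (hxR : x ∉ R)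
    (hclean : Clean c R) (hr : Ready S h n Ms (c ||| 2 ^ idx x) k D R (Multiset.replicate m x + M))
    (hcov : Covers c M) (hF : Valid F (Multiset.replicate m x + R))
    (hi : ∀ i, g i (avail c F) F ((2 ^ idx x, m) :: acc) (k - m) D = true) :
    ∃ F' acc', Good F' acc' (R + (Multiset.replicate m x + M)) ∧
      ∀ i, next i F' acc' (D - (k - (m + Multiset.card M))) = true := by
  have hxM : x ∉ M := fun hM => by simp [hcov x hM] at hx
  have hle := hr.le
  have h1 := hr.card_le
  have h2 := hr.le_card
  have h3 := hr.loss_le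
  simp only [Multiset.card_add, Multiset.card_replicate] at h1 h2 h3
  have e1 : R + (Multiset.replicate m x + M) = Multiset.replicate m x + R + M := by
    rw [← add_assoc, add_comm R]
  rw [e1] at hle ⊢
  rw [show k - (m + Multiset.card M) = k - m - Multiset.card M by omega]
  refine hg _ _ _ _ _ _ _ ⟨hF, ?_⟩ ⟨?_, ?_, ?_, ?_, hle, ?_, ?_, ?_⟩ hi
  · intro y
    rw [cnt_cons, hacc, Multiset.count_add, Multiset.count_replicate]
    by_cases hxy : x = y
    · subst hxy
      simp [Multiset.count_eq_zero_of_notMem hxR]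
    · have : ¬ 2 ^ idx x = 2 ^ idx y := fun e => hxy (idx_injective (Nat.pow_right_injective le_rfl e))
      simp [hxy, this]
  · refine Clean.avail fun p hp hc => ?_
    obtain ⟨y, rfl, hy⟩ := hclean p hp hc
    refine ⟨y, rfl, ?_⟩
    rw [Multiset.mem_add, not_or]
    refine ⟨fun hy' => ?_, hy⟩
    rw [Multiset.eq_of_mem_replicate hy', hx] at hc
    simp at hc
  · exact covers_avail hS hF (le_trans (Multiset.le_add_right _ _) hle) hcov
  · intro y
    refine le_trans ?_ (hr.count_le y)
    simp
  · intro y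
    by_cases hxy : x = y
    · subst hxy
      simp [Multiset.count_eq_zero_of_notMem hxM]
    · have := hr.count_mem y
      simpa [Multiset.count_replicate, hxy] using this
  · omega
  · omega
  · omega

theorem land_two_pow_eq_zero (hS : ShortFree S) {j : ℕ} (hF : Valid F (Multiset.replicate j x + R))
    (hle : R + (Multiset.replicate m x + M) ≤ S) (hj : j < m) : F &&& 2 ^ idx x = 0 := by
  have : x ::ₘ (Multiset.replicate j x + R) ≤ S := by
    refine le_trans ?_ hle
    rw [← Multiset.cons_add, ← Multiset.replicate_succ, add_comm]
    gcongr
    exact (Multiset.replicate_mono x hj).trans (Multiset.le_add_right _ _)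
  rw [Nat.and_two_pow, hF.testBit_idx hS this]
  simp

theorem valid_replicate_succ {j : ℕ} (hF : Valid F (Multiset.replicate j x + R)) :
    Valid (add F (2 ^ idx x)) (Multiset.replicate (j + 1) x + R) := by
  rw [Multiset.replicate_succ, Multiset.cons_add]
  exact hF.add x

theorem Sound.take (hS : ShortFree S) (hg : Sound S h n Ms next g)
    (hacc : ∀ x, cnt acc (2 ^ idx x) = R.count x) (hx : c.testBit (idx x) = false) (hxR : x ∉ R)
    (hclean : Clean c R) (hr : Ready S h n Ms (c ||| 2 ^ idx x) k D R (Multiset.replicate m x + M))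
    (hcov : Covers c M) (hF : Valid F R) (hm : m = 1 ∨ m = 2 ∨ m = 4)
    (hi : ∀ i, take₁ h (g i) c (add F (2 ^ idx x)) acc k D (2 ^ idx x) = true) :
    ∃ F' acc', Good F' acc' (R + (Multiset.replicate m x + M)) ∧
      ∀ i, next i F' acc' (D - (k - (m + Multiset.card M))) = true := by
  have hle := le_trans (Multiset.le_add_right _ _) hr.le
  have hk := hr.card_le
  simp only [Multiset.card_add, Multiset.card_replicate] at hk
  have hh := hr.count_le x
  rw [Multiset.count_add, Multiset.count_replicate_self] at hh
  have v1 : Valid (add F (2 ^ idx x)) (Multiset.replicate 1 x + R) :=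
    valid_replicate_succ (j := 0) (by simpa using hF)
  have v2 := valid_replicate_succ v1
  have v3 := valid_replicate_succ v2
  have v4 := valid_replicate_succ v3
  simp only [take₁_iff] at hi
  rcases hm with rfl | rfl | rfl
  · exact hg.finish hS hacc hx hxR hclean hr hcov v1 fun i => (hi i).1
  · refine hg.finish hS hacc hx hxR hclean hr hcov v2 fun i => ?_
    have := (hi i).2 (by omega) (by omega) (land_two_pow_eq_zero hS v1 hle (by norm_num))
    exact (take₂_iff.1 this).1
  · refine hg.finish hS hacc hx hxR hclean hr hcov v4 fun i => ?_
    have h2 := (hi i).2 (by omega) (by omega) (land_two_pow_eq_zero hS v1 hle (by norm_num))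
    have h3 := (take₂_iff.1 h2).2 (by omega) (by omega) (land_two_pow_eq_zero hS v2 hle (by norm_num))
    exact take₃_iff.1 h3 (land_two_pow_eq_zero hS v3 hle (by norm_num))

theorem Sound.step (hS : ShortFree S) (hg : Sound S h n Ms next g) {Ps : List ℕ}
    (hPM : List.Forall₂ Covers Ps Ms) : Sound S h n Ms next fun i => step h n Ps (next i) (g i) := by
  intro c F acc k D R M ⟨hF, hacc⟩ hr hi
  simp only [step_iff] at hi
  have hle := le_trans (Multiset.le_add_right _ _) hr.le
  rcases lt_or_ge c unitBit with hc | hc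
  · have := covers_lt hr.covers hc
    subst this
    have hk := hr.le_card
    simp only [Multiset.card_zero, zero_add, add_zero, Nat.sub_zero] at hk ⊢
    exact ⟨F, acc, ⟨hF, hacc⟩, fun i => (hi i).2 hc hk⟩
  rcases Nat.eq_zero_or_pos k with rfl | hk
  · have := hr.card_le
    obtain rfl : M = 0 := Multiset.card_eq_zero.1 (by omega)
    exact ⟨F, acc, by simpa using ⟨hF, hacc⟩, fun i => by simpa using ((hi i).1 hc).1 rfl⟩
  have hi := fun i => ((hi i).1 hc).2 hk.ne'
  obtain ⟨j, hj, hcj, hpow, hbits⟩ := lowBit hc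
  obtain ⟨x, rfl, hxR⟩ := hr.clean j hj hcj
  rw [hpow] at hi
  simp only [split_iff] at hi
  generalize c &&& (c - unitBit) = c' at *
  have hclean : Clean c' R := fun p hp hcp => hr.clean p hp (by
    rw [hbits p hp, Bool.and_eq_true] at hcp; exact hcp.1)
  have hx : c'.testBit (idx x) = false := by simp [hbits _ hj]
  have hcov : ∀ M' ≤ M, x ∉ M' → Covers c' M' := fun M' hM' hxM y hy => by
    rw [hbits _ (le_idx y), hr.covers y (Multiset.mem_of_le hM' hy), Bool.true_and, decide_eq_true_eq]
    intro e
    exact hxM (idx_injective e ▸ hy)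
  by_cases hxM : x ∈ M
  · have e : Multiset.replicate (M.count x) x + M.filter (x ≠ ·) = M := by
      rw [← Multiset.filter_eq, Multiset.filter_add_not]
    have hroom : room n (add F (2 ^ idx x)) Ps D = true := by
      refine room_sound hS hPM (hF.add x) (le_trans ?_ hr.le) (by have := hr.loss_le; omega)
      gcongr
      rw [← Multiset.singleton_add, add_comm]
      gcongr
      exact Multiset.singleton_le.2 hxM
    have hm : M.count x = 1 ∨ M.count x = 2 ∨ M.count x = 4 := by
      have := hr.count_mem x
      have := Multiset.count_pos.2 hxM
      omega
    have hcard := congrArg Multiset.card e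
    rw [Multiset.card_add, Multiset.card_replicate] at hcard
    have := hg.take (M := M.filter (x ≠ ·)) hS hacc hx hxR hclean (m := M.count x) (k := k) (D := D) (F := F) ?_
      (hcov _ (Multiset.filter_le _ _) (by simp)) hF hm fun i => (hi i).2 hroom
    · rwa [e, hcard] at this
    · rw [e]
      refine { hr with clean := ?_, covers := fun y hy => ?_ }
      · intro p hp hcp
        rw [Nat.testBit_or, Bool.or_eq_true] at hcp
        rcases hcp with hcp | hcp
        · exact hclean p hp hcp
        · rw [Nat.testBit_two_pow, decide_eq_true_eq] at hcp
          exact ⟨x, hcp.symm, hxR⟩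
      · rw [Nat.testBit_or, hbits _ (le_idx y), hr.covers y hy, Nat.testBit_two_pow]
        by_cases hxy : idx y = idx x <;> simp [hxy]
  · exact hg c' F acc k D R M ⟨hF, hacc⟩ { hr with clean := hclean, covers := hcov M le_rfl hxM }
      fun i => (hi i).1

theorem sound_go [Nonempty ι] (hS : ShortFree S) {Ps : List ℕ} (hPM : List.Forall₂ Covers Ps Ms) (fuel : ℕ) :
    Sound S h n Ms next fun i => go h n Ps (next i) fuel := by
  induction fuel with
  | zero =>
    intro c F acc k D R M _ _ hi
    exact absurd (hi (Classical.arbitrary ι)) (by simp [go])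
  | succ fuel ih => exact Sound.step hS ih hPM

end Search

/-! ### Conditions tested at a leaf -/

namespace Search

theorem pos_eq (i j k : Fin 5) : pos i j k = 2 ^ idx ![(i : ZMod 5), (j : ZMod 5), (k : ZMod 5)] := by
  have e : pos i j k = 2 ^ (1000 + (i.1 % 5 + (10 * (j.1 % 5) + 100 * (k.1 % 5)))) := rfl
  rw [e, Nat.mod_eq_of_lt i.2, Nat.mod_eq_of_lt j.2, Nat.mod_eq_of_lt k.2]
  unfold idx
  congr 1
  change _ = 1000 + i.1 + 10 * j.1 + 100 * k.1
  omega

def coordEquiv : Fin 5 × Fin 5 × Fin 5 ≃ V where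
  toFun p := ![(p.1 : ZMod 5), (p.2.1 : ZMod 5), (p.2.2 : ZMod 5)]
  invFun x := (x 0, x 1, x 2)
  left_inv _ := rfl
  right_inv x := by ext i; fin_cases i <;> rfl

theorem sum₅_eq (f : ℕ → ℕ) : sum₅ f = ∑ i : Fin 5, f i := by
  rw [Fin.sum_univ_five]
  change f 0 + (f 1 + (f 2 + (f 3 + f 4))) = f 0 + f 1 + f 2 + f 3 + f 4
  ring

theorem moment_eq_zero {F : ℕ} {acc : Acc} {R : Multiset V} (hR : Good F acc R) (h0 : R.sum = 0)
    (f : ℕ → ℕ → ℕ → ℕ) (t : Fin 3)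
    (hf : ∀ i j k : Fin 5, ((f i j k : ℕ) : ZMod 5) = coordEquiv (i, j, k) t) :
    moment acc f = 0 := by
  have h1 : ∑ x : V, (R.count x : ZMod 5) * x t = 0 := by
    have := congrFun h0 t
    rw [Finset.sum_multiset_count_of_subset R Finset.univ (Finset.subset_univ _)] at this
    simpa using this
  rw [← Equiv.sum_comp coordEquiv, Fintype.sum_prod_type] at h1
  simp only [Fintype.sum_prod_type] at h1
  have e : moment acc f = (sum₅ fun i => sum₅ fun j => sum₅ fun k => cnt acc (pos i j k) * f i j k) % 5 := rfl
  rw [e, ← Nat.dvd_iff_mod_eq_zero, ← ZMod.natCast_eq_zero_iff]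
  simp only [sum₅_eq]
  push_cast
  rw [← h1]
  refine Finset.sum_congr rfl fun i _ => Finset.sum_congr rfl fun j _ => Finset.sum_congr rfl fun k _ => ?_
  rw [pos_eq, hR.2, hf]
  rfl

theorem leaf_sound {F D : ℕ} {acc : Acc} {R : Multiset V} (hR : Good F acc R)
    (h : leaf acc D = true) : D = 0 ∧ R.sum ≠ 0 := by
  simp only [leaf, cond_iff, Nat.beq_eq, beq_false] at h
  refine ⟨by tauto, fun h0 => ?_⟩
  have m0 := moment_eq_zero hR h0 (fun i _ _ => i) 0 (by decide)
  have m1 := moment_eq_zero hR h0 (fun _ j _ => j) 1 (by decide)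
  have m2 := moment_eq_zero hR h0 (fun _ _ k => k) 2 (by decide)
  simp [m0, m1, m2] at h

theorem planes_sound {S : Multiset V} (hS : ShortFree S) {h n : ℕ} {Ps : List ℕ} {Ms : List (Multiset V)}
    (hPM : List.Forall₂ Covers Ps Ms) : ∀ {F acc D R}, Good F acc R →
    (∀ M ∈ Ms, Multiset.card M ≤ n ∧ ∀ x, M.count x ≤ h ∧
      (M.count x = 0 ∨ M.count x = 1 ∨ M.count x = 2 ∨ M.count x = 4)) →
    loss n Ms ≤ D → R + Ms.sum = S → (∀ P ∈ Ps, Clean P R) →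
    Ps.Pairwise (fun P Q => ∀ x, P.testBit (idx x) → Q.testBit (idx x) = false) →
    planes h n Ps F acc D = true → D = loss n Ms ∧ S.sum ≠ 0 := by
  induction hPM with
  | nil =>
    intro F acc D R hR _ _ hle _ _ hl
    simp only [List.sum_nil, add_zero] at hle
    subst hle
    exact leaf_sound hR hl
  | @cons P M Ps Ms hP hPM ih =>
    intro F acc D R hR hM hD hle hcl hdisj hl
    rw [List.sum_cons] at hle
    simp only [loss, List.map_cons, List.sum_cons] at hD ⊢
    have hl : go h n Ps (planes h n Ps) 21 (avail P F) F acc n D = true := hl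
    obtain ⟨h1, h2⟩ := hM M List.mem_cons_self
    rw [List.pairwise_cons] at hdisj
    obtain ⟨F', acc', hR', hl'⟩ := sound_go (ι := Unit) (h := h) (n := n) (next := fun _ => planes h n Ps)
      hS hPM 21 (avail P F) F acc n D R M hR
      { clean := (hcl P List.mem_cons_self).avail
        covers := covers_avail hS hR.1 (hle ▸ (by rw [← add_assoc]; exact Multiset.le_add_right _ _)) hP
        count_le := fun x => (h2 x).1
        count_mem := fun x => (h2 x).2
        le := by rw [← hle, add_assoc]
        card_le := h1
        le_card := by omega
        loss_le := by unfold loss; omega } fun _ => hl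
    have := ih hR' (fun M' hM' => hM M' (List.mem_cons_of_mem _ hM')) (by unfold loss; omega)
      (by rw [← hle, add_assoc]) (fun Q hQ p hp hpQ => ?_) hdisj.2 (hl' ())
    · unfold loss at this
      exact ⟨by omega, this.2⟩
    · obtain ⟨x, rfl, hx⟩ := hcl Q (List.mem_cons_of_mem _ hQ) p hp hpQ
      refine ⟨x, rfl, ?_⟩
      rw [Multiset.mem_add, not_or]
      refine ⟨hx, fun hxM => ?_⟩
      rw [hdisj.1 Q hQ x (hP x hxM)] at hpQ
      simp at hpQ

end Search

/-! ### Normal form of a sequence under linear automorphisms -/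

namespace Search

instance factPrimeFive : Fact (Nat.Prime 5) := ⟨by norm_num⟩

theorem exists_equiv (x y z : V) (h : x 0 * (y 1 * z 2 - z 1 * y 2) - y 0 * (x 1 * z 2 - z 1 * x 2) +
      z 0 * (x 1 * y 2 - y 1 * x 2) ≠ 0) :
    ∃ θ : V ≃ₗ[ZMod 5] V, ∀ w, θ w = w 0 • x + w 1 • y + w 2 • z := by
  let A : Matrix (Fin 3) (Fin 3) (ZMod 5) := (Matrix.of ![x, y, z]).transpose
  have hA : IsUnit A := by
    rw [Matrix.isUnit_iff_isUnit_det, isUnit_iff_ne_zero, Matrix.det_transpose, Matrix.det_fin_three]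
    simp only [Matrix.of_apply, Matrix.cons_val_zero, Matrix.cons_val_one, Matrix.cons_val]
    intro h'
    apply h
    rw [← h']
    ring
  refine ⟨LinearEquiv.ofInjectiveEndo A.mulVecLin (Matrix.mulVec_injective_iff_isUnit.2 hA), fun w => ?_⟩
  ext i
  change A.mulVec w i = _
  simp only [Matrix.mulVec, dotProduct, A,
    Fin.sum_univ_three, Matrix.transpose_apply, Matrix.of_apply, Pi.add_apply, Pi.smul_apply, smul_eq_mul,
    Matrix.cons_val_zero, Matrix.cons_val_one, Matrix.cons_val]
  ring

def keyOf (f : V → ℕ) (x y : V) : ℕ :=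
  5 * (5 * (5 * f (4 • x + y) + f (3 • x + y)) + f (2 • x + y)) + f (x + y)

def total₀ (f : V → ℕ) : ℕ := ∑ x with x 2 = 0, f x
def total₁ (f : V → ℕ) : ℕ := ∑ x with x 1 = 0, f x

abbrev e₁ : V := ![1, 0, 0]
abbrev e₂ : V := ![0, 1, 0]
abbrev e₃ : V := ![0, 0, 1]

def stat (f : V → ℕ) : ℕ ×ₗ ℕ ×ₗ ℕ ×ₗ ℕ ×ₗ ℕ ×ₗ ℕ ×ₗ ℕ :=
  toLex (f e₁, toLex (total₀ f, toLex (f e₂, toLex (keyOf f e₁ e₂,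
    toLex (total₁ f, toLex (f e₃, keyOf f e₁ e₃))))))

/-- No linear change of coordinates improves the statistics of `f`. -/
def Best (f : V → ℕ) : Prop := ∀ θ : V ≃ₗ[ZMod 5] V, stat (f ∘ θ) ≤ stat f

theorem exists_best (f : V → ℕ) : ∃ θ : V ≃ₗ[ZMod 5] V, Best (f ∘ θ) := by
  have : Finite (V ≃ₗ[ZMod 5] V) := Finite.of_injective (fun θ => (θ : V → V)) DFunLike.coe_injective
  obtain ⟨θ, hθ⟩ := Finite.exists_max fun θ : V ≃ₗ[ZMod 5] V => stat (f ∘ θ)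
  exact ⟨θ, fun ψ => hθ (ψ.trans θ)⟩

theorem le_of_lex_le {a a' : ℕ} {α : Type*} [LinearOrder α] {b b' : α}
    (h : toLex (a, b) ≤ toLex (a', b')) : a ≤ a' := by
  rw [Prod.Lex.toLex_le_toLex] at h
  dsimp only at h
  omega

theorem le_of_lex_le_of_eq {a a' : ℕ} {α : Type*} [LinearOrder α] {b b' : α}
    (h : toLex (a, b) ≤ toLex (a', b')) (ha : a = a') : b ≤ b' := by
  rw [Prod.Lex.toLex_le_toLex] at h
  dsimp only at h
  rcases h with h | h
  · omega
  · exact h.2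

variable {f : V → ℕ}

theorem sum_comp_equiv (θ : V ≃ₗ[ZMod 5] V) (p q : V → Prop) [DecidablePred p] [DecidablePred q]
    (h : ∀ x, p x ↔ q (θ x)) : ∑ x with p x, f (θ x) = ∑ x with q x, f x := by
  rw [Finset.sum_filter, Finset.sum_filter]
  refine (Finset.sum_congr rfl fun x _ => ?_).trans
    (Equiv.sum_comp θ.toEquiv fun x => if q x then f x else 0)
  simp [h]

theorem Best.le_h (hf : Best f) {x : V} (hx : x ≠ 0) : f x ≤ f e₁ := by
  obtain ⟨y, z, h⟩ : ∃ y z : V, x 0 * (y 1 * z 2 - z 1 * y 2) - y 0 * (x 1 * z 2 - z 1 * x 2) +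
      z 0 * (x 1 * y 2 - y 1 * x 2) ≠ 0 := by
    obtain ⟨i, hi⟩ := Function.ne_iff.1 hx
    rw [Pi.zero_apply] at hi
    fin_cases i
    · exact ⟨e₂, e₃, by simpa using hi⟩
    · exact ⟨e₁, e₃, by simpa using hi⟩
    · exact ⟨e₁, e₂, by simpa using hi⟩
  obtain ⟨θ, hθ⟩ := exists_equiv x y z h
  have := le_of_lex_le (hf θ)
  simpa [hθ] using this

theorem Best.total_le (hf : Best f) (c : ZMod 5) : ∑ x with x 1 = c * x 2, f x ≤ total₀ f := by
  obtain ⟨θ, hθ⟩ := exists_equiv e₁ ![0, c, 1] e₂ (by simp)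
  have := le_of_lex_le (le_of_lex_le_of_eq (hf θ) (by simp [hθ]))
  refine le_trans (le_of_eq ?_) this
  refine (sum_comp_equiv θ (fun x => x 2 = 0) _ fun x => ?_).symm
  simp [hθ, mul_comm]

theorem Best.le_m₂ (hf : Best f) {x : V} (h2 : x 2 = 0) (h1 : x 1 ≠ 0) : f x ≤ f e₂ := by
  obtain ⟨θ, hθ⟩ := exists_equiv e₁ x e₃ (by simpa using h1)
  have h0 : total₀ (f ∘ θ) = total₀ f := sum_comp_equiv θ _ _ fun w => by
    rw [hθ]
    simp [h2, -Matrix.smul_cons]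
  have := le_of_lex_le (le_of_lex_le_of_eq (le_of_lex_le_of_eq (hf θ) (by simp [hθ])) h0)
  simpa [hθ] using this

theorem keyOf_comp (θ : V ≃ₗ[ZMod 5] V) (x y : V) : keyOf (f ∘ θ) x y = keyOf f (θ x) (θ y) := by
  simp only [keyOf, Function.comp, map_add, map_nsmul]

theorem Best.key_le (hf : Best f) {x y : V} (hx : x 2 = 0) (hy : y 2 = 0)
    (h : x 0 * y 1 - x 1 * y 0 ≠ 0) (h1 : f x = f e₁) (h2 : f y = f e₂) :
    keyOf f x y ≤ keyOf f e₁ e₂ := by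
  obtain ⟨θ, hθ⟩ := exists_equiv x y e₃ (by simpa [mul_comm] using h)
  have t1 : θ e₁ = x := by simp [hθ]
  have t2 : θ e₂ = y := by simp [hθ]
  have h0 : total₀ (f ∘ θ) = total₀ f := sum_comp_equiv θ _ _ fun x => by simp [hθ, hx, hy]
  have := le_of_lex_le (le_of_lex_le_of_eq (le_of_lex_le_of_eq (le_of_lex_le_of_eq (hf θ)
    (by simpa [t1] using h1)) h0) (by simpa [t2] using h2))
  rwa [keyOf_comp, t1, t2] at this

theorem keyOf_congr {f g : V → ℕ} {x y : V} (h : ∀ a : ℕ, f (a • x + y) = g (a • x + y)) :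
    keyOf f x y = keyOf g x y := by
  have := h 1
  rw [one_smul] at this
  rw [keyOf, keyOf, h 4, h 3, h 2, this]

theorem Best.fix_plane (hf : Best f) {z : V} (hz : z 2 ≠ 0) : ∃ θ : V ≃ₗ[ZMod 5] V,
    (∀ w, θ w = w 0 • e₁ + w 1 • e₂ + w 2 • z) ∧
    toLex (total₁ (f ∘ θ), toLex (f z, keyOf f e₁ z)) ≤
      toLex (total₁ f, toLex (f e₃, keyOf f e₁ e₃)) := by
  obtain ⟨θ, hθ⟩ := exists_equiv e₁ e₂ z (by simpa using hz)
  refine ⟨θ, hθ, ?_⟩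
  have t : ∀ w : V, w 2 = 0 → θ w = w := fun w hw => by
    rw [hθ, hw]
    ext i
    fin_cases i <;> simp [hw]
  have t3 : θ e₃ = z := by simp [hθ]
  have h0 : total₀ (f ∘ θ) = total₀ f := by
    refine Finset.sum_congr rfl fun x hx => ?_
    simp only [Finset.mem_filter] at hx
    simp only [Function.comp, t x hx.2]
  have := le_of_lex_le_of_eq (le_of_lex_le_of_eq (le_of_lex_le_of_eq (le_of_lex_le_of_eq (hf θ)
    (by simp only [Function.comp, t e₁ rfl])) h0) (by simp only [Function.comp, t e₂ rfl])) (by rw [keyOf_comp, t _ rfl, t _ rfl])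
  rw [keyOf_comp, Function.comp, t3, t e₁ rfl] at this
  exact this

theorem Best.total_le_total₁ (hf : Best f) (c : ZMod 5) : ∑ x with x 1 = c * x 2, f x ≤ total₁ f := by
  obtain ⟨θ, hθ, h⟩ := hf.fix_plane (z := ![0, c, 1]) (by simp)
  refine le_trans (le_of_eq ?_) (le_of_lex_le h)
  refine (sum_comp_equiv θ (fun x => x 1 = 0) _ fun x => ?_).symm
  simp [hθ, mul_comm]

theorem Best.le_m₃ (hf : Best f) {z : V} (h1 : z 1 = 0) (h2 : z 2 ≠ 0) :
    f z ≤ f e₃ ∧ (f z = f e₃ → keyOf f e₁ z ≤ keyOf f e₁ e₃) := by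
  obtain ⟨θ, hθ, h⟩ := hf.fix_plane h2
  have h0 : total₁ (f ∘ θ) = total₁ f := sum_comp_equiv θ _ _ fun x => by simp [hθ, h1]
  have h := le_of_lex_le_of_eq h h0
  exact ⟨le_of_lex_le h, le_of_lex_le_of_eq h⟩

theorem Best.swap (hf : Best f) (ht : total₁ f = total₀ f) {x y : V} (hx : x 1 = 0) (hy : y 1 = 0)
    (h : x 0 * y 2 - x 2 * y 0 ≠ 0) (h1 : f x = f e₁) :
    f y ≤ f e₂ ∧ (f y = f e₂ → keyOf f x y ≤ keyOf f e₁ e₂) := by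
  obtain ⟨θ, hθ⟩ := exists_equiv x y e₂ (by
    simp only [hx, hy]
    intro h'
    apply h
    simpa [mul_comm, sub_eq_zero, neg_add_eq_zero, eq_comm] using h')
  have t1 : θ e₁ = x := by simp [hθ]
  have t2 : θ e₂ = y := by simp [hθ]
  have h0 : total₀ (f ∘ θ) = total₀ f := by
    rw [← ht]
    exact sum_comp_equiv θ _ _ fun x => by simp [hθ, hx, hy]
  have := le_of_lex_le_of_eq (le_of_lex_le_of_eq (hf θ) (by simpa [t1] using h1)) h0
  rw [keyOf_comp, Function.comp, t1, t2] at this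
  exact ⟨le_of_lex_le this, fun e => le_of_lex_le (le_of_lex_le_of_eq this e)⟩

end Search

/-! ### Masks of lines and planes -/

namespace Search

/-- The marks of `c` are the points satisfying `p`. -/
def IsMask (c : ℕ) (p : V → Prop) : Prop :=
  (∀ x, c.testBit (idx x) ↔ p x) ∧ ∀ q, 1000 ≤ q → c.testBit q → ∃ x, q = idx x

set_option exponentiation.threshold 1500

theorem isMask_of {c : ℕ} {p : V → Prop} [DecidablePred p] (hc : c < 2 ^ 1500)
    (h1 : ∀ i j k : Fin 5, c.testBit (1000 + i.1 + 10 * j.1 + 100 * k.1) = decide (p (coordEquiv (i, j, k))))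
    (h2 : ∀ b d e : Fin 10, c.testBit (1000 + e.1 + 10 * d.1 + 100 * b.1) → b.1 < 5 ∧ d.1 < 5 ∧ e.1 < 5) :
    IsMask c p := by
  constructor
  · intro x
    obtain ⟨⟨i, j, k⟩, rfl⟩ := coordEquiv.surjective x
    rw [show idx (coordEquiv (i, j, k)) = 1000 + i.1 + 10 * j.1 + 100 * k.1 from rfl, h1, decide_eq_true_iff]
  · intro q hq hcq
    have hlt : q < 1500 := by
      by_contra! hq
      rw [Nat.testBit_lt_two_pow (hc.trans_le (Nat.pow_le_pow_right (n := 2) (by norm_num) hq))] at hcq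
      simp at hcq
    have e : q = 1000 + q % 10 + 10 * (q / 10 % 10) + 100 * ((q - 1000) / 100) := by omega
    have := h2 ⟨(q - 1000) / 100, by omega⟩ ⟨q / 10 % 10, by omega⟩ ⟨q % 10, by omega⟩
    dsimp only at this
    rw [← e] at this
    obtain ⟨h3, h4, h5⟩ := this hcq
    exact ⟨coordEquiv (⟨_, h5⟩, ⟨_, h4⟩, ⟨_, h3⟩), e⟩

theorem isMask_line : IsMask line fun x => x 1 = 0 ∧ x 2 = 0 ∧ x ≠ 0 ∧ x ≠ e₁ :=
  isMask_of (by decide +kernel) (by decide +kernel) (by decide +kernel)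

theorem isMask_plane₀ : IsMask (Nat.sub plane₀ (pos 0 1 0)) fun x => x 2 = 0 ∧ x 1 ≠ 0 ∧ x ≠ e₂ :=
  isMask_of (by decide +kernel) (by decide +kernel) (by decide +kernel)

theorem isMask_plane₁ : IsMask (Nat.sub plane₁ (pos 0 0 1)) fun x => x 1 = 0 ∧ x 2 ≠ 0 ∧ x ≠ e₃ :=
  isMask_of (by decide +kernel) (by decide +kernel) (by decide +kernel)

theorem isMask_plane₂ : IsMask plane₂ fun x => x 2 ≠ 0 ∧ x 1 = 1 * x 2 :=
  isMask_of (by decide +kernel) (by decide +kernel) (by decide +kernel)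

theorem isMask_plane₃ : IsMask plane₃ fun x => x 2 ≠ 0 ∧ x 1 = 2 * x 2 :=
  isMask_of (by decide +kernel) (by decide +kernel) (by decide +kernel)

theorem isMask_plane₄ : IsMask plane₄ fun x => x 2 ≠ 0 ∧ x 1 = 3 * x 2 :=
  isMask_of (by decide +kernel) (by decide +kernel) (by decide +kernel)

theorem isMask_plane₅ : IsMask plane₅ fun x => x 2 ≠ 0 ∧ x 1 = 4 * x 2 :=
  isMask_of (by decide +kernel) (by decide +kernel) (by decide +kernel)

variable {c : ℕ} {p : V → Prop}

theorem IsMask.covers [DecidablePred p] (h : IsMask c p) (S : Multiset V) : Covers c (S.filter p) :=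
  fun x hx => (h.1 x).2 (Multiset.mem_filter.1 hx).2

theorem IsMask.clean (h : IsMask c p) {R : Multiset V} (hR : ∀ x ∈ R, ¬ p x) : Clean c R := by
  intro q hq hcq
  obtain ⟨x, rfl⟩ := h.2 q hq hcq
  exact ⟨x, rfl, fun hx => hR x hx ((h.1 x).1 hcq)⟩

theorem IsMask.disjoint {c' : ℕ} {p' : V → Prop} (h : IsMask c p) (h' : IsMask c' p')
    (hd : ∀ x, p x → ¬ p' x) (x : V) (hx : c.testBit (idx x)) : c'.testBit (idx x) = false := by
  rw [← Bool.not_eq_true, h'.1]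
  exact hd x ((h.1 x).1 hx)

end Search

/-! ### Soundness of the canonicity tests -/

namespace Search

def pt (x : ℕ × ℕ × ℕ) : V := ![(x.1 : ZMod 5), (x.2.1 : ZMod 5), (x.2.2 : ZMod 5)]

theorem pos_eq_idx_pt (x : ℕ × ℕ × ℕ) : pos x.1 x.2.1 x.2.2 = 2 ^ idx (pt x) := by
  have e : pos x.1 x.2.1 x.2.2 = 2 ^ (1000 + (x.1 % 5 + (10 * (x.2.1 % 5) + 100 * (x.2.2 % 5)))) := rfl
  rw [e]
  congr 1
  simp only [idx, pt, Matrix.cons_val_zero, Matrix.cons_val_one, Matrix.cons_val, ZMod.val_natCast]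
  omega

variable {F : ℕ} {acc : Acc} {R : Multiset V}

theorem Good.cnt_pos (hR : Good F acc R) (x : ℕ × ℕ × ℕ) : cnt acc (pos x.1 x.2.1 x.2.2) = R.count (pt x) := by
  rw [pos_eq_idx_pt, hR.2]

theorem Good.keyStep_eq (hR : Good F acc R) (x y : ℕ × ℕ × ℕ) (a r : ℕ) :
    keyStep acc x y a r = 5 * r + R.count (a • pt x + pt y) := by
  have e : keyStep acc x y a r = 5 * r + cnt acc (pos (a * x.1 + y.1) (a * x.2.1 + y.2.1) (a * x.2.2 + y.2.2)) := rfl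
  rw [e, hR.cnt_pos (a * x.1 + y.1, a * x.2.1 + y.2.1, a * x.2.2 + y.2.2)]
  congr 2
  ext i
  fin_cases i <;> simp [pt]

theorem Good.key_eq (hR : Good F acc R) (x y : ℕ × ℕ × ℕ) :
    key acc x y = keyOf R.count (pt x) (pt y) := by
  unfold key keyOf
  simp only [hR.keyStep_eq, one_smul, mul_zero, zero_add]

theorem cross_eq_zero_iff (a b c d : ℕ) : cross a b c d = 0 ↔ (a * d - b * c : ZMod 5) = 0 := by
  have e : cross a b c d = (a * d + 4 * (b * c)) % 5 := rfl
  rw [e, ← Nat.dvd_iff_mod_eq_zero, ← ZMod.natCast_eq_zero_iff]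
  push_cast
  rw [show (4 : ZMod 5) = -1 from rfl, neg_one_mul, ← sub_eq_add_neg]

theorem crossNe_iff (x y : ℕ × ℕ × ℕ) : crossNe x y = true ↔
    pt x 0 * pt y 1 - pt x 1 * pt y 0 ≠ 0 ∨ pt x 0 * pt y 2 - pt x 2 * pt y 0 ≠ 0 := by
  simp only [crossNe, cond_iff, Nat.beq_eq, beq_false, cross_eq_zero_iff, ne_eq, pt,
    Matrix.cons_val_zero, Matrix.cons_val_one, Matrix.cons_val]
  tauto

theorem canonAt_eq_true (hR : Good F acc R) {pts : List (ℕ × ℕ × ℕ)} {x : ℕ × ℕ × ℕ} {m K : ℕ} (A : ℕ)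
    (h : ∀ y ∈ pts, R.count (pt y) = m → crossNe x y = true → keyOf R.count (pt x) (pt y) ≤ K) :
    canonAt acc pts x m K A = true := by
  induction pts with
  | nil => rfl
  | cons y pts ih =>
    have e : canonAt acc (y :: pts) x m K A = Bool.rec (motive := fun _ => Bool)
      (Bool.rec (motive := fun _ => Bool) (canonAt acc pts x m K A)
        (Bool.rec (motive := fun _ => Bool) (canonAt acc pts x m K A)
          (Bool.rec (motive := fun _ => Bool) false (canonAt acc pts x m K A) (Nat.ble (key acc x y) K))
          (crossNe x y)) (Nat.beq (cnt acc (pos y.1 y.2.1 y.2.2)) m))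
      (canonAt acc pts x m K A) (Nat.beq (Nat.land A (pos y.1 y.2.1 y.2.2)) 0) := rfl
    rw [e]
    have hih := ih fun y hy => h y (List.mem_cons_of_mem _ hy)
    have hy := h y List.mem_cons_self
    simp only [cond_iff, hih, Nat.beq_eq, beq_false, hR.cnt_pos, Nat.ble_eq, hR.key_eq]
    cases hc : crossNe x y
    · simp; tauto
    · simp; tauto

theorem canon_eq_true (hR : Good F acc R) {pts : List (ℕ × ℕ × ℕ)} {h m K : ℕ} (A A' : ℕ)
    (H : ∀ x ∈ pts, ∀ y ∈ pts, R.count (pt x) = h → R.count (pt y) = m → crossNe x y = true →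
      keyOf R.count (pt x) (pt y) ≤ K) :
    canon acc pts h m K A A' = true := by
  suffices ∀ l : List (ℕ × ℕ × ℕ), l ⊆ pts → List.rec (motive := fun _ => Bool) true (fun x _ ih =>
      Bool.rec (motive := fun _ => Bool) (Bool.rec (motive := fun _ => Bool) ih
        (Bool.rec (motive := fun _ => Bool) false ih (canonAt acc pts x m K A'))
        (Nat.beq (cnt acc (pos x.1 x.2.1 x.2.2)) h)) ih
        (Nat.beq (Nat.land A (pos x.1 x.2.1 x.2.2)) 0)) l = true from
    this pts fun _ hx => hx
  intro l hl
  induction l with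
  | nil => rfl
  | cons x l ih =>
    rw [List.cons_subset] at hl
    have hih := ih hl.2
    have hx := fun e => canonAt_eq_true hR (x := x) A' (fun y hy => H x hl.1 y hy e)
    dsimp only at hih ⊢
    rw [hih]
    simp only [cond_iff, Nat.beq_eq, beq_false, hR.cnt_pos]
    tauto

theorem plane₀Pts_spec : ∀ x ∈ plane₀Pts, pt x 2 = 0 := by decide
theorem plane₁Pts_spec : ∀ x ∈ plane₁Pts, pt x 1 = 0 := by decide
theorem pt_e₁ : pt (1, 0, 0) = e₁ := by decide
theorem pt_e₂ : pt (0, 1, 0) = e₂ := by decide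
theorem pt_e₃ : pt (0, 0, 1) = e₃ := by decide

end Search

/-! ### Extremal sequences -/

namespace Search

variable {F : ℕ} {acc : Acc} {R S : Multiset V}

theorem Good.addn (hR : Good F acc R) {x : V} (hx : x ∉ R) (m : ℕ) :
    Good (addn F (2 ^ idx x) m) ((2 ^ idx x, m) :: acc) (R + Multiset.replicate m x) := by
  rw [add_comm]
  constructor
  · induction m with
    | zero => simpa [Search.addn] using hR.1
    | succ m ih => exact valid_replicate_succ ih
  · intro y
    rw [cnt_cons, Multiset.count_add, Multiset.count_replicate, hR.2]
    by_cases hxy : x = y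
    · subst hxy
      simp [Multiset.count_eq_zero_of_notMem hx]
    · rw [if_neg fun e => hxy (idx_injective (Nat.pow_right_injective le_rfl e)), if_neg hxy, zero_add]

theorem card_filter_eq (S : Multiset V) (p : V → Prop) [DecidablePred p] :
    Multiset.card (S.filter p) = ∑ x with p x, S.count x := by
  rw [← Multiset.sum_count_eq_card (s := Finset.univ) fun _ _ => Finset.mem_univ _, Finset.sum_filter]
  exact Finset.sum_congr rfl fun x _ => Multiset.count_filter

/-- Every residue pair is dealt with by one of the searches. -/
def Covered (h m₂ : ℕ) : Prop := ∀ n F, ∃ q₀ r₀ q r, search h m₂ q₀ r₀ q r = true ∧ n % q₀ = r₀ ∧ F % q = r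

structure Extremal (S : Multiset V) : Prop where
  shortFree : ShortFree S
  best : Best (S.count ·)
  count_mem : ∀ x, S.count x = 0 ∨ S.count x = 1 ∨ S.count x = 2 ∨ S.count x = 4
  card : 32 ≤ Multiset.card S

namespace Extremal

theorem count_zero (hS : ShortFree S) : S.count 0 = 0 := by
  refine Multiset.count_eq_zero_of_notMem fun h => ?_
  exact hS {0} (Multiset.singleton_le.2 h) (by simp) (by simp) (by simp)

theorem line_add (hS : ShortFree S) : Multiset.replicate (S.count e₁) e₁ +
    S.filter (fun x => x 1 = 0 ∧ x 2 = 0 ∧ x ≠ 0 ∧ x ≠ e₁) = S.filter fun x => x 1 = 0 ∧ x 2 = 0 := by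
  ext x
  rw [Multiset.count_add, Multiset.count_replicate, Multiset.count_filter, Multiset.count_filter]
  have := count_zero hS
  by_cases h1 : e₁ = x
  · subst h1; simp
  · by_cases h0 : x = 0
    · subst h0; simp [this]
    · simp [h0, h1, Ne.symm h1]

theorem plane₀_add (S : Multiset V) : S.filter (fun x => x 1 = 0 ∧ x 2 = 0) + Multiset.replicate (S.count e₂) e₂ +
    S.filter (fun x => x 2 = 0 ∧ x 1 ≠ 0 ∧ x ≠ e₂) = S.filter fun x => x 2 = 0 := by
  ext x
  simp only [Multiset.count_add, Multiset.count_replicate, Multiset.count_filter]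
  by_cases h1 : e₂ = x
  · subst h1; simp
  · by_cases h0 : x 1 = 0 <;> simp [h0, h1, Ne.symm h1]

theorem plane₁_add (S : Multiset V) : S.filter (fun x => x 2 = 0) + Multiset.replicate (S.count e₃) e₃ +
    S.filter (fun x => x 1 = 0 ∧ x 2 ≠ 0 ∧ x ≠ e₃) = S.filter fun x => x 2 = 0 ∨ x 1 = 0 := by
  ext x
  simp only [Multiset.count_add, Multiset.count_replicate, Multiset.count_filter]
  by_cases h1 : e₃ = x
  · subst h1; simp
  · by_cases h0 : x 2 = 0 <;> simp [h0, h1, Ne.symm h1]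

theorem planes_add (S : Multiset V) : S.filter (fun x => x 2 = 0 ∨ x 1 = 0) +
    [S.filter fun x => x 2 ≠ 0 ∧ x 1 = 1 * x 2, S.filter fun x => x 2 ≠ 0 ∧ x 1 = 2 * x 2,
      S.filter fun x => x 2 ≠ 0 ∧ x 1 = 3 * x 2, S.filter fun x => x 2 ≠ 0 ∧ x 1 = 4 * x 2].sum = S := by
  ext x
  simp only [List.sum_cons, List.sum_nil, add_zero, Multiset.count_add, Multiset.count_filter]
  generalize S.count x = n
  generalize x 1 = y
  generalize x 2 = z
  have : ∀ y z : ZMod 5, (if z = 0 ∨ y = 0 then 1 else 0) + ((if z ≠ 0 ∧ y = 1 * z then 1 else 0) +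
    ((if z ≠ 0 ∧ y = 2 * z then 1 else 0) + ((if z ≠ 0 ∧ y = 3 * z then 1 else 0) +
    (if z ≠ 0 ∧ y = 4 * z then 1 else 0)))) = 1 := by decide
  have := congrArg (· * n) (this y z)
  simpa only [add_mul, ite_mul, one_mul, zero_mul] using this

theorem filter_count_le {h : ℕ} (p : V → Prop) [DecidablePred p]
    (hp : ∀ x, p x → S.count x ≤ h) (x : V) : (S.filter p).count x ≤ h := by
  rw [Multiset.count_filter]
  split_ifs with h
  · exact hp x h
  · exact Nat.zero_le _

theorem filter_count_mem (hS : Extremal S) (p : V → Prop) [DecidablePred p] (x : V) :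
    (S.filter p).count x = 0 ∨ (S.filter p).count x = 1 ∨ (S.filter p).count x = 2 ∨ (S.filter p).count x = 4 := by
  rw [Multiset.count_filter]
  split_ifs with h
  · exact hS.count_mem x
  · exact Or.inl rfl

theorem card_filter_le (hS : ShortFree S) (p : V → Prop) [DecidablePred p] {n : ℕ}
    (hn : (Finset.univ.filter p).card ≤ n) : Multiset.card (S.filter p) ≤ n * 4 := by
  rw [card_filter_eq]
  refine (Finset.sum_le_card_nsmul _ _ 4 fun x _ => hS.count_le x).trans ?_
  simpa using hn

theorem keyOf_filter (p : V → Prop) [DecidablePred p] {x y : V} (h : ∀ a : ℕ, p (a • x + y)) :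
    keyOf (S.filter p).count x y = keyOf S.count x y :=
  keyOf_congr fun a => by rw [Multiset.count_filter, if_pos (h a)]

theorem canon_exit (hS : Extremal S) {F : ℕ} {acc : Acc} (hR : Good F acc (S.filter fun x => x 2 = 0)) (A A' : ℕ) :
    canon acc plane₀Pts (S.count e₁) (S.count e₂) (key acc (1, 0, 0) (0, 1, 0)) A A' = true := by
  refine canon_eq_true hR _ _ fun x hx y hy h1 h2 hc => ?_
  have hx := plane₀Pts_spec x hx
  have hy := plane₀Pts_spec y hy
  rw [crossNe_iff] at hc
  rw [Multiset.count_filter, if_pos hx] at h1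
  rw [Multiset.count_filter, if_pos hy] at h2
  rw [hR.key_eq, pt_e₁, pt_e₂, keyOf_filter _ fun a => by simp [hx, hy], keyOf_filter _ fun a => by simp]
  refine hS.best.key_le hx hy ?_ h1 h2
  simpa [hx, hy] using hc

theorem canon_stage₃ (hS : Extremal S) {F : ℕ} {acc : Acc} (hR : Good F acc (S.filter fun x => x 2 = 0 ∨ x 1 = 0))
    (ht : total₁ S.count = total₀ S.count) (A A' : ℕ) :
    canon acc plane₁Pts (S.count e₁) (S.count e₂) (key acc (1, 0, 0) (0, 1, 0)) A A' = true := by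
  refine canon_eq_true hR _ _ fun x hx y hy h1 h2 hc => ?_
  have hx := plane₁Pts_spec x hx
  have hy := plane₁Pts_spec y hy
  rw [crossNe_iff] at hc
  rw [Multiset.count_filter, if_pos (Or.inr hx)] at h1
  rw [Multiset.count_filter, if_pos (Or.inr hy)] at h2
  rw [hR.key_eq, pt_e₁, pt_e₂, keyOf_filter _ fun a => by simp [hx, hy], keyOf_filter _ fun a => by simp]
  refine (hS.best.swap ht hx hy ?_ h1).2 h2
  simpa [hx, hy] using hc

theorem canonAt_stage₃ (hS : Extremal S) {F : ℕ} {acc : Acc} (hR : Good F acc (S.filter fun x => x 2 = 0 ∨ x 1 = 0)) (A : ℕ) :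
    canonAt acc plane₁Pts (1, 0, 0) (S.count e₃) (key acc (1, 0, 0) (0, 0, 1)) A = true := by
  refine canonAt_eq_true hR _ fun y hy h2 hc => ?_
  have hy := plane₁Pts_spec y hy
  rw [crossNe_iff] at hc
  rw [Multiset.count_filter, if_pos (Or.inr hy)] at h2
  rw [hR.key_eq, pt_e₁, pt_e₃, keyOf_filter _ fun a => by simp [hy], keyOf_filter _ fun a => by simp]
  refine (hS.best.le_m₃ hy ?_).2 h2
  simpa [pt_e₁, hy] using hc

end Extremal

end Search

/-! ### Structure of extremal sequences -/

namespace Search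

namespace Extremal

attribute [local irreducible] pos

theorem div_def (a b : ℕ) : Nat.div a b = a / b := rfl
theorem mod_def (a b : ℕ) : Nat.mod a b = a % b := rfl

theorem cond_true_iff (c a : Bool) : Bool.rec (motive := fun _ => Bool) true a c = true ↔ (c = true → a = true) := by
  cases c <;> simp

theorem cond_false_iff (c a : Bool) : Bool.rec (motive := fun _ => Bool) false a c = true ↔ (c = true ∧ a = true) := by
  cases c <;> simp

theorem cond_not_iff (c a : Bool) : Bool.rec (motive := fun _ => Bool) a false c = true ↔ (c = false ∧ a = true) := by
  cases c <;> simp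

variable {S : Multiset V}

theorem plane_card (S : Multiset V) (c : ZMod 5) : Multiset.card (S.filter fun x => x 1 = c * x 2) =
    Multiset.card (S.filter fun x => x 1 = 0 ∧ x 2 = 0) +
      Multiset.card (S.filter fun x => x 2 ≠ 0 ∧ x 1 = c * x 2) := by
  rw [← Multiset.card_add]
  congr 1
  ext x
  simp only [Multiset.count_add, Multiset.count_filter]
  by_cases h : x 2 = 0 <;> simp [h]

theorem plane₁_card (S : Multiset V) : Multiset.card (S.filter fun x => x 2 = 0 ∨ x 1 = 0) +
    Multiset.card (S.filter fun x => x 1 = 0 ∧ x 2 = 0) =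
      Multiset.card (S.filter fun x => x 2 = 0) + Multiset.card (S.filter fun x => x 1 = 0) := by
  rw [← Multiset.card_add, ← Multiset.card_add]
  congr 1
  ext x
  simp only [Multiset.count_add, Multiset.count_filter]
  by_cases h : x 2 = 0 <;> by_cases h' : x 1 = 0 <;> simp [h, h']

theorem search_eq {h m₂ q₀ r₀ q r : ℕ} : search h m₂ q₀ r₀ q r = go h 0 [] (fun F acc D => stage₁ h m₂ q₀ r₀ q r (h + D) F acc)
    4 (avail line (addn startMask (pos 1 0 0) h)) (addn startMask (pos 1 0 0) h) [(pos 1 0 0, h)] 20 20 := rfl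

theorem stage₁_iff {h m₂ q₀ r₀ q r v F : ℕ} {acc : Acc} : stage₁ h m₂ q₀ r₀ q r v F acc = true ↔
    (F &&& pos 0 1 0 = 0 → go m₂ 0 [] (fun F acc D => exit₁ v h m₂ q₀ r₀ q r ((37 - v) / 6 + D) F acc) 21
    (avail (Nat.sub plane₀ (pos 0 1 0)) (addn F (pos 0 1 0) m₂)) (addn F (pos 0 1 0) m₂) ((pos 0 1 0, m₂) :: acc)
    (100 - m₂) (100 - (37 - v) / 6) = true) := by
  simp only [stage₁, cond_true_iff, enter₁, Nat.beq_eq, land_def, Nat.sub_eq, Nat.add_eq, div_def]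

theorem exit₁_iff {v h m₂ q₀ r₀ q r n₀ F : ℕ} {acc : Acc} : exit₁ v h m₂ q₀ r₀ q r n₀ F acc = true ↔
    (n₀ % q₀ = r₀ → canon acc plane₀Pts h m₂ (key acc (1, 0, 0) (0, 1, 0)) (level acc h) (level acc m₂) = true →
      v + n₀ < 32 ∧ stage₂ v h m₂ n₀ q r F acc 1 = true ∧ stage₂ v h m₂ n₀ q r F acc 2 = true ∧
      stage₂ v h m₂ n₀ q r F acc 4 = true) := by
  simp only [exit₁, cond_true_iff, cond_false_iff, cond_not_iff, Nat.beq_eq, ble_false, not_le, Nat.add_eq, mod_def]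

theorem stage₂_iff {v h m₂ n₀ q r F m₃ : ℕ} {acc : Acc} : stage₂ v h m₂ n₀ q r F acc m₃ = true ↔
    (m₃ ≤ h → m₃ ≤ n₀ → F &&& pos 0 0 1 = 0 →
      go m₃ 0 [] (fun F acc D => stage₃ v h m₂ m₃ n₀ q r ((36 - (v + n₀)) / 5 + D) F acc) 21
    (avail (Nat.sub plane₁ (pos 0 0 1)) (addn F (pos 0 0 1) m₃)) (addn F (pos 0 0 1) m₃) ((pos 0 0 1, m₃) :: acc)
    (n₀ - m₃) (n₀ - (36 - (v + n₀)) / 5) = true) := by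
  simp only [stage₂, cond_true_iff, enter₂, Nat.beq_eq, Nat.ble_eq, land_def, Nat.sub_eq, Nat.add_eq, div_def]

theorem stage₃_iff {v h m₂ m₃ n₀ q r n₁ F : ℕ} {acc : Acc} : stage₃ v h m₂ m₃ n₀ q r n₁ F acc = true ↔
    (F % q = r → (n₁ = n₀ → m₃ ≤ m₂ ∧ (m₃ = m₂ →
        canon acc plane₁Pts h m₂ (key acc (1, 0, 0) (0, 1, 0)) (level acc h) (level acc m₂) = true)) →
      canonAt acc plane₁Pts (1, 0, 0) m₃ (key acc (1, 0, 0) (0, 0, 1)) (level acc m₃) = true →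
      planes h n₁ [plane₂, plane₃, plane₄, plane₅] F acc (v + (n₀ + 5 * n₁) - 32) = true) := by
  simp only [stage₃, cond_true_iff, cond_false_iff, Nat.beq_eq, Nat.ble_eq, Nat.add_eq, mod_def, Nat.sub_eq, Nat.mul_eq]

end Extremal

end Search

/-! ### Soundness of the whole search -/

namespace Search

namespace Extremal

variable {S : Multiset V}

attribute [local irreducible] pos unitBit idx

theorem land_pos_eq_zero (hS : ShortFree S) {F : ℕ} {acc : Acc} {R : Multiset V} {x : V} {m : ℕ}
    (hR : Good F acc R) (hle : R + Multiset.replicate m x ≤ S) (hm : 0 < m) : F &&& 2 ^ idx x = 0 := by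
  refine land_two_pow_eq_zero (m := m) (M := 0) (R := R) (j := 0) hS ?_ (by simpa using hle) hm
  simpa using hR.1

theorem good_start : Good startMask [] 0 := ⟨valid_startMask, fun _ => by simp [cnt]⟩

theorem sound_planes (hS : Extremal S) {w n₁ F : ℕ} {acc : Acc}
    (hG : Good F acc (S.filter fun x => x 2 = 0 ∨ x 1 = 0))
    (h : planes (S.count e₁) n₁ [plane₂, plane₃, plane₄, plane₅] F acc (w + 5 * n₁ - 32) = true)
    (hw : Multiset.card (S.filter fun x => x 2 = 0 ∨ x 1 = 0) = w + n₁)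
    (hn : ∀ c : ZMod 5, c ≠ 0 → Multiset.card (S.filter fun x => x 2 ≠ 0 ∧ x 1 = c * x 2) ≤ n₁) :
    Multiset.card S = 32 ∧ S.sum ≠ 0 := by
  have r3 := planes_add S
  have c3 := congrArg Multiset.card r3
  simp only [Multiset.card_add, List.sum_cons, List.sum_nil, add_zero] at c3
  have hcard := hS.card
  have h1 := hn 1 (by decide)
  have h2 := hn 2 (by decide)
  have h3 := hn 3 (by decide)
  have h4 := hn 4 (by decide)
  have hd : ∀ x y : ZMod 5, ∀ a b : ZMod 5, a ≠ b → (x ≠ 0 ∧ y = a * x) → ¬ (x ≠ 0 ∧ y = b * x) := by decide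
  have hl : loss n₁ [S.filter fun x => x 2 ≠ 0 ∧ x 1 = 1 * x 2, S.filter fun x => x 2 ≠ 0 ∧ x 1 = 2 * x 2,
      S.filter fun x => x 2 ≠ 0 ∧ x 1 = 3 * x 2, S.filter fun x => x 2 ≠ 0 ∧ x 1 = 4 * x 2] =
      w + 5 * n₁ - Multiset.card S := by
    simp only [loss, List.map_cons, List.map_nil, List.sum_cons, List.sum_nil]
    omega
  have hp : ∀ c : ZMod 5, c ≠ 0 → ∀ x ∈ S.filter (fun x => x 2 = 0 ∨ x 1 = 0), ¬ (x 2 ≠ 0 ∧ x 1 = c * x 2) := by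
    intro c hc x hx h
    rcases (Multiset.mem_filter.1 hx).2 with h1 | h1
    · exact h.1 h1
    · rw [h1, eq_comm, mul_eq_zero] at h
      exact h.2.elim hc h.1
  have hF := List.Forall₂.cons (isMask_plane₂.covers S) (.cons (isMask_plane₃.covers S)
    (.cons (isMask_plane₄.covers S) (.cons (isMask_plane₅.covers S) .nil)))
  have hM : ∀ M ∈ [S.filter fun x => x 2 ≠ 0 ∧ x 1 = 1 * x 2, S.filter fun x => x 2 ≠ 0 ∧ x 1 = 2 * x 2,
      S.filter fun x => x 2 ≠ 0 ∧ x 1 = 3 * x 2, S.filter fun x => x 2 ≠ 0 ∧ x 1 = 4 * x 2],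
      Multiset.card M ≤ n₁ ∧ ∀ x, M.count x ≤ S.count e₁ ∧
        (M.count x = 0 ∨ M.count x = 1 ∨ M.count x = 2 ∨ M.count x = 4) := by
    have (c : ZMod 5) (hc : c ≠ 0) : Multiset.card (S.filter fun x => x 2 ≠ 0 ∧ x 1 = c * x 2) ≤ n₁ ∧
        ∀ x, (S.filter fun x => x 2 ≠ 0 ∧ x 1 = c * x 2).count x ≤ S.count e₁ ∧
          ((S.filter fun x => x 2 ≠ 0 ∧ x 1 = c * x 2).count x = 0 ∨
            (S.filter fun x => x 2 ≠ 0 ∧ x 1 = c * x 2).count x = 1 ∨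
            (S.filter fun x => x 2 ≠ 0 ∧ x 1 = c * x 2).count x = 2 ∨
            (S.filter fun x => x 2 ≠ 0 ∧ x 1 = c * x 2).count x = 4) :=
      ⟨hn c hc, fun x => ⟨filter_count_le _ (fun x hx => hS.best.le_h fun h => hx.1 (by simp [h])) x,
        hS.filter_count_mem _ x⟩⟩
    simp only [List.forall_mem_cons, List.not_mem_nil, false_imp_iff, implies_true, and_true]
    exact ⟨this 1 (by decide), this 2 (by decide), this 3 (by decide), this 4 (by decide)⟩
  have hC : ∀ P ∈ [plane₂, plane₃, plane₄, plane₅], Clean P (S.filter fun x => x 2 = 0 ∨ x 1 = 0) := by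
    simp only [List.forall_mem_cons, List.not_mem_nil, false_imp_iff, implies_true, and_true]
    exact ⟨isMask_plane₂.clean (hp 1 (by decide)), isMask_plane₃.clean (hp 2 (by decide)),
      isMask_plane₄.clean (hp 3 (by decide)), isMask_plane₅.clean (hp 4 (by decide))⟩
  have hD : [plane₂, plane₃, plane₄, plane₅].Pairwise
      fun P Q => ∀ x, P.testBit (idx x) → Q.testBit (idx x) = false := by
    simp only [List.pairwise_cons, List.forall_mem_cons, List.not_mem_nil, false_imp_iff, implies_true,
      and_true, List.Pairwise.nil]
    exact ⟨⟨isMask_plane₂.disjoint isMask_plane₃ fun x => hd _ _ _ _ (by decide),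
      isMask_plane₂.disjoint isMask_plane₄ fun x => hd _ _ _ _ (by decide),
      isMask_plane₂.disjoint isMask_plane₅ fun x => hd _ _ _ _ (by decide)⟩,
      ⟨isMask_plane₃.disjoint isMask_plane₄ fun x => hd _ _ _ _ (by decide),
      isMask_plane₃.disjoint isMask_plane₅ fun x => hd _ _ _ _ (by decide)⟩,
      isMask_plane₄.disjoint isMask_plane₅ fun x => hd _ _ _ _ (by decide)⟩
  have := planes_sound hS.shortFree hF hG hM (by rw [hl]; omega) r3 hC hD h
  rw [hl] at this
  exact ⟨by omega, this.2⟩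

set_option maxHeartbeats 1000000 in
theorem sound (hS : Extremal S)
    (H : ∀ h m₂, (h = 1 ∨ h = 2 ∨ h = 4) → (m₂ = 1 ∨ m₂ = 2 ∨ m₂ = 4) → m₂ ≤ h → Covered h m₂) :
    Multiset.card S = 32 ∧ S.sum ≠ 0 := by
  have hSF := hS.shortFree
  have p1 : pos 1 0 0 = 2 ^ idx e₁ := by rw [← pt_e₁]; exact pos_eq_idx_pt (1, 0, 0)
  have p2 : pos 0 1 0 = 2 ^ idx e₂ := by rw [← pt_e₂]; exact pos_eq_idx_pt (0, 1, 0)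
  have p3 : pos 0 0 1 = 2 ^ idx e₃ := by rw [← pt_e₃]; exact pos_eq_idx_pt (0, 0, 1)
  -- sizes of the parts
  have c0 := congrArg Multiset.card (line_add hSF)
  have c1 := congrArg Multiset.card (plane₀_add S)
  have c2 := congrArg Multiset.card (plane₁_add S)
  have c3 := congrArg Multiset.card (planes_add S)
  simp only [Multiset.card_add, Multiset.card_replicate, List.sum_cons, List.sum_nil, add_zero] at c0 c1 c2 c3
  have b0 := card_filter_le hSF (fun x => x 1 = 0 ∧ x 2 = 0 ∧ x ≠ 0 ∧ x ≠ e₁) (n := 3) (by decide)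
  have b1 := card_filter_le hSF (fun x => x 2 = 0 ∧ x 1 ≠ 0 ∧ x ≠ e₂) (n := 19) (by decide +kernel)
  have k0 := hSF.count_le e₁
  have k1 := hSF.count_le e₂
  have hcard := hS.card
  have e0 : total₀ S.count = Multiset.card (S.filter fun x => x 2 = 0) := (card_filter_eq S _).symm
  have e1 : total₁ S.count = Multiset.card (S.filter fun x => x 1 = 0) := (card_filter_eq S _).symm
  have e2 := plane₁_card S
  have q0 : ∀ c : ZMod 5, _ ≤ _ := fun c => hS.best.total_le c
  have q1 : ∀ c : ZMod 5, _ ≤ _ := fun c => hS.best.total_le_total₁ c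
  simp only [e0, e1, ← card_filter_eq, plane_card] at q0 q1
  have q00 : Multiset.card (S.filter fun x => x 1 = 0) ≤ Multiset.card (S.filter fun x => x 2 = 0) := by
    have := q0 0
    rw [← plane_card] at this
    simpa only [zero_mul] using this
  have q2 := q1 1
  have q3 := q1 2
  have q4 := q1 3
  have q5 := q1 4
  have r0 := line_add hSF
  have r1 := plane₀_add S
  have r2 := plane₁_add S
  have r3 := planes_add S
  have f0 := filter_count_le (S := S) (h := S.count e₁) (fun x => x 1 = 0 ∧ x 2 = 0 ∧ x ≠ 0 ∧ x ≠ e₁)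
    fun x hx => hS.best.le_h hx.2.2.1
  have f1 := filter_count_le (S := S) (h := S.count e₂) (fun x => x 2 = 0 ∧ x 1 ≠ 0 ∧ x ≠ e₂)
    fun x hx => hS.best.le_m₂ hx.1 hx.2.1
  have f2 := filter_count_le (S := S) (h := S.count e₃) (fun x => x 1 = 0 ∧ x 2 ≠ 0 ∧ x ≠ e₃)
    fun x hx => (hS.best.le_m₃ hx.1 hx.2.1).1
  have m₂_le : S.count e₂ ≤ S.count e₁ := hS.best.le_h (by decide)
  have m₃_le : S.count e₃ ≤ S.count e₁ := hS.best.le_h (by decide)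
  have z1 : S.count e₂ = 0 → Multiset.card (S.filter fun x => x 2 = 0 ∧ x 1 ≠ 0 ∧ x ≠ e₂) = 0 := fun h => by
    rw [Multiset.card_eq_zero, Multiset.eq_zero_iff_forall_notMem]
    intro x hx
    have := f1 x
    have := Multiset.count_pos.2 hx
    omega
  have z2 : S.count e₃ = 0 → Multiset.card (S.filter fun x => x 1 = 0 ∧ x 2 ≠ 0 ∧ x ≠ e₃) = 0 := fun h => by
    rw [Multiset.card_eq_zero, Multiset.eq_zero_iff_forall_notMem]
    intro x hx
    have := f2 x
    have := Multiset.count_pos.2 hx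
    omega
  have hm₂ : 0 < S.count e₂ := by omega
  have n2 : S.count e₂ = 1 ∨ S.count e₂ = 2 ∨ S.count e₂ = 4 := by
    have := hS.count_mem e₂; omega
  have n1 : S.count e₁ = 1 ∨ S.count e₁ = 2 ∨ S.count e₁ = 4 := by
    have := hS.count_mem e₁; omega
  have hcov := H _ _ n1 n2 m₂_le
  have g0 := hS.filter_count_mem fun x => x 1 = 0 ∧ x 2 = 0 ∧ x ≠ 0 ∧ x ≠ e₁
  have g1 := hS.filter_count_mem fun x => x 2 = 0 ∧ x 1 ≠ 0 ∧ x ≠ e₂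
  have g2 := hS.filter_count_mem fun x => x 1 = 0 ∧ x 2 ≠ 0 ∧ x ≠ e₃
  -- the line through `e₁`
  let ι := {p : ℕ × ℕ × ℕ × ℕ // search (S.count e₁) (S.count e₂) p.1 p.2.1 p.2.2.1 p.2.2.2 = true}
  have : Nonempty ι := by
    obtain ⟨q₀, r₀, q, r, h, -⟩ := hcov 0 0
    exact ⟨⟨(q₀, r₀, q, r), h⟩⟩
  have G0 := good_start.addn (Multiset.notMem_zero e₁) (S.count e₁)
  rw [zero_add, ← p1] at G0
  obtain ⟨F₁, acc₁, G1, s1⟩ := sound_go (ι := ι) (S := S) (h := S.count e₁) (n := 0)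
    (next := fun i F acc D => stage₁ (S.count e₁) (S.count e₂) i.1.1 i.1.2.1 i.1.2.2.1 i.1.2.2.2 (S.count e₁ + D) F acc)
    hSF List.Forall₂.nil 4 _ _ _ 20 20 _
    (S.filter fun x => x 1 = 0 ∧ x 2 = 0 ∧ x ≠ 0 ∧ x ≠ e₁) G0
    { clean := (isMask_line.clean (by simp +contextual [Multiset.mem_replicate])).avail
      covers := covers_avail hSF G0.1 (by rw [r0]; exact Multiset.filter_le _ _) (isMask_line.covers S)
      count_le := f0
      count_mem := g0
      le := by rw [r0]; simp
      card_le := by omega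
      le_card := by omega
      loss_le := by unfold loss; simp } fun i => search_eq.symm.trans i.2
  rw [r0] at G1
  -- the plane through `e₁` and `e₂`
  have G1' := G1.addn (x := e₂) (by simp) (S.count e₂)
  rw [← p2] at G1'
  have le1 : S.filter (fun x => x 1 = 0 ∧ x 2 = 0) + Multiset.replicate (S.count e₂) e₂ +
      S.filter (fun x => x 2 = 0 ∧ x 1 ≠ 0 ∧ x ≠ e₂) ≤ S := by rw [r1]; exact Multiset.filter_le _ _
  obtain ⟨v, hv⟩ : ∃ v, v = Multiset.card (S.filter fun x => x 1 = 0 ∧ x 2 = 0) := ⟨_, rfl⟩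
  dsimp only at s1
  rw [show S.count e₁ + (20 - (20 - Multiset.card (S.filter fun x => x 1 = 0 ∧ x 2 = 0 ∧ x ≠ 0 ∧ x ≠ e₁))) = v by omega] at s1
  have s1 := fun i => stage₁_iff.1 (s1 i) (by
    rw [p2]; exact land_pos_eq_zero hSF G1 ((Multiset.le_add_right _ _).trans le1) hm₂)
  obtain ⟨F₂, acc₂, G2, s2⟩ := sound_go (ι := ι) (S := S) (h := S.count e₂) (n := 0)
    (next := fun i F acc D => exit₁ v (S.count e₁) (S.count e₂) i.1.1 i.1.2.1 i.1.2.2.1 i.1.2.2.2 ((37 - v) / 6 + D) F acc)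
    hSF List.Forall₂.nil 21 _ _ _ _ _ _
    (S.filter fun x => x 2 = 0 ∧ x 1 ≠ 0 ∧ x ≠ e₂) G1'
    { clean := (isMask_plane₀.clean (by simp +contextual [Multiset.mem_replicate, or_imp])).avail
      covers := covers_avail hSF G1'.1 le1 (isMask_plane₀.covers S)
      count_le := f1
      count_mem := g1
      le := by simpa using le1
      card_le := by omega
      le_card := by omega
      loss_le := by simp only [loss, List.map_nil, List.sum_nil, zero_add]; omega } s1
  rw [r1] at G2
  obtain ⟨n₀, hn₀⟩ : ∃ n₀, v + n₀ = Multiset.card (S.filter fun x => x 2 = 0) :=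
    ⟨_, Nat.add_sub_of_le (by omega)⟩
  dsimp only at s2
  rw [show (37 - v) / 6 + (100 - (37 - v) / 6 - (100 - S.count e₂ -
    Multiset.card (S.filter fun x => x 2 = 0 ∧ x 1 ≠ 0 ∧ x ≠ e₂))) = n₀ by omega] at s2
  have s2 := fun (i : ι) hi => exit₁_iff.1 (s2 i) hi (hS.canon_exit G2 _ _)
  -- the plane through `e₁` and `e₃`
  let κ := {i : ι // n₀ % i.1.1 = i.1.2.1}
  have : Nonempty κ := by
    obtain ⟨q₀, r₀, q, r, h, h', -⟩ := hcov n₀ 0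
    exact ⟨⟨⟨(q₀, r₀, q, r), h⟩, h'⟩⟩
  have hw := (s2 _ (Classical.arbitrary κ).2).1
  have hm₃ : 0 < S.count e₃ := by omega
  have G2' := G2.addn (x := e₃) (by simp) (S.count e₃)
  rw [← p3] at G2'
  have le2 : S.filter (fun x => x 2 = 0) + Multiset.replicate (S.count e₃) e₃ +
      S.filter (fun x => x 1 = 0 ∧ x 2 ≠ 0 ∧ x ≠ e₃) ≤ S := by rw [r2]; exact Multiset.filter_le _ _
  have s2 : ∀ i : κ, stage₂ v (S.count e₁) (S.count e₂) n₀ i.1.1.2.2.1 i.1.1.2.2.2 F₂ acc₂ (S.count e₃) = true := by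
    intro i
    have := (s2 _ i.2).2
    rcases hS.count_mem e₃ with h | h | h | h
    · omega
    · rw [h]; exact this.1
    · rw [h]; exact this.2.1
    · rw [h]; exact this.2.2
  have s2 := fun i => stage₂_iff.1 (s2 i) m₃_le (by omega) (by
    rw [p3]; exact land_pos_eq_zero hSF G2 ((Multiset.le_add_right _ _).trans le2) hm₃)
  obtain ⟨F₃, acc₃, G3, s3⟩ := sound_go (ι := κ) (S := S) (h := S.count e₃) (n := 0)
    (next := fun i F acc D => stage₃ v (S.count e₁) (S.count e₂) (S.count e₃) n₀ i.1.1.2.2.1 i.1.1.2.2.2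
      ((36 - (v + n₀)) / 5 + D) F acc)
    hSF List.Forall₂.nil 21 _ _ _ _ _ _
    (S.filter fun x => x 1 = 0 ∧ x 2 ≠ 0 ∧ x ≠ e₃) G2'
    { clean := (isMask_plane₁.clean (by simp +contextual [Multiset.mem_replicate, or_imp])).avail
      covers := covers_avail hSF G2'.1 le2 (isMask_plane₁.covers S)
      count_le := f2
      count_mem := g2
      le := by simpa using le2
      card_le := by omega
      le_card := by omega
      loss_le := by simp only [loss, List.map_nil, List.sum_nil, zero_add]; omega } s2
  rw [r2] at G3
  obtain ⟨n₁, hn₁⟩ : ∃ n₁, v + n₀ + n₁ = Multiset.card (S.filter fun x => x 2 = 0 ∨ x 1 = 0) :=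
    ⟨_, Nat.add_sub_of_le (by omega)⟩
  dsimp only at s3
  rw [show (36 - (v + n₀)) / 5 + (n₀ - (36 - (v + n₀)) / 5 - (n₀ - S.count e₃ -
    Multiset.card (S.filter fun x => x 1 = 0 ∧ x 2 ≠ 0 ∧ x ≠ e₃))) = n₁ by omega] at s3
  obtain ⟨q₀, r₀, q, r, h, h', h''⟩ := hcov n₀ F₃
  have s3 := stage₃_iff.1 (s3 ⟨⟨(q₀, r₀, q, r), h⟩, h'⟩) h'' (fun hn => by
    have ht : total₁ S.count = total₀ S.count := by rw [e0, e1]; omega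
    refine ⟨(hS.best.swap ht (x := e₁) (y := e₃) (by simp) (by simp) (by simp) rfl).1, fun _ => ?_⟩
    exact hS.canon_stage₃ G3 ht _ _) (hS.canonAt_stage₃ G3 _)
  rw [← Nat.add_assoc] at s3
  exact hS.sound_planes (w := v + n₀) G3 s3 (by omega) (fun c _ => by have := q1 c; omega)

end Extremal

end Search

/-! ### The searches -/

namespace Search

set_option maxRecDepth 1000000

theorem search_1_1 : search 1 1 1 0 1 0 = true := by decide +kernel

theorem search_2_1 : search 2 1 1 0 1 0 = true := by decide +kernel

theorem search_2_2 : search 2 2 1 0 1 0 = true := by decide +kernel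

theorem search_4_1 : search 4 1 1 0 1 0 = true := by decide +kernel

theorem search_4_2 : search 4 2 1 0 1 0 = true := by decide +kernel

theorem search_4_4_0_0 : search 4 4 4 0 3 0 = true := by decide +kernel

theorem search_4_4_0_1 : search 4 4 4 0 3 1 = true := by decide +kernel

theorem search_4_4_0_2 : search 4 4 4 0 3 2 = true := by decide +kernel

theorem search_4_4_1_0 : search 4 4 4 1 2 0 = true := by decide +kernel

theorem search_4_4_1_1 : search 4 4 4 1 2 1 = true := by decide +kernel

theorem search_4_4_2_0 : search 4 4 4 2 4 0 = true := by decide +kernel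

theorem search_4_4_2_1 : search 4 4 4 2 4 1 = true := by decide +kernel

theorem search_4_4_2_2 : search 4 4 4 2 4 2 = true := by decide +kernel

theorem search_4_4_2_3 : search 4 4 4 2 4 3 = true := by decide +kernel

theorem search_4_4_3_0 : search 4 4 4 3 2 0 = true := by decide +kernel

theorem search_4_4_3_1 : search 4 4 4 3 2 1 = true := by decide +kernel

end Search

/-! ### Sequences over `C₅³` -/

namespace Search

theorem covered {h m₂ : ℕ} (hh : h = 1 ∨ h = 2 ∨ h = 4) (hm : m₂ = 1 ∨ m₂ = 2 ∨ m₂ = 4) (hle : m₂ ≤ h) :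
    Covered h m₂ := by
  intro n F
  have mod_one (k : ℕ) : k % 1 = 0 := Nat.mod_one k
  rcases hh with rfl | rfl | rfl <;> rcases hm with rfl | rfl | rfl <;> try omega
  · exact ⟨_, _, _, _, search_1_1, mod_one n, mod_one F⟩
  · exact ⟨_, _, _, _, search_2_1, mod_one n, mod_one F⟩
  · exact ⟨_, _, _, _, search_2_2, mod_one n, mod_one F⟩
  · exact ⟨_, _, _, _, search_4_1, mod_one n, mod_one F⟩
  · exact ⟨_, _, _, _, search_4_2, mod_one n, mod_one F⟩
  · have h4 : n % 4 = 0 ∨ n % 4 = 1 ∨ n % 4 = 2 ∨ n % 4 = 3 := by omega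
    have m2 : F % 2 = 0 ∨ F % 2 = 1 := by omega
    have m3 : F % 3 = 0 ∨ F % 3 = 1 ∨ F % 3 = 2 := by omega
    have m4 : F % 4 = 0 ∨ F % 4 = 1 ∨ F % 4 = 2 ∨ F % 4 = 3 := by omega
    rcases h4 with e | e | e | e
    · rcases m3 with e' | e' | e'
      exacts [⟨_, _, _, _, search_4_4_0_0, e, e'⟩, ⟨_, _, _, _, search_4_4_0_1, e, e'⟩, ⟨_, _, _, _, search_4_4_0_2, e, e'⟩]
    · rcases m2 with e' | e'
      exacts [⟨_, _, _, _, search_4_4_1_0, e, e'⟩, ⟨_, _, _, _, search_4_4_1_1, e, e'⟩]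
    · rcases m4 with e' | e' | e' | e'
      exacts [⟨_, _, _, _, search_4_4_2_0, e, e'⟩, ⟨_, _, _, _, search_4_4_2_1, e, e'⟩, ⟨_, _, _, _, search_4_4_2_2, e, e'⟩,
        ⟨_, _, _, _, search_4_4_2_3, e, e'⟩]
    · rcases m2 with e' | e'
      exacts [⟨_, _, _, _, search_4_4_3_0, e, e'⟩, ⟨_, _, _, _, search_4_4_3_1, e, e'⟩]

theorem ShortFree.map {S : Multiset V} (hS : ShortFree S) (θ : V ≃ₗ[ZMod 5] V) : ShortFree (S.map θ) := by
  intro T hT h0 hc hs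
  have e : (T.map θ.symm).map θ = T := by simp
  refine hS (T.map θ.symm) ?_ (by simpa using h0) (by simpa using hc) ?_
  · rw [← Multiset.map_le_map_iff θ.injective, e]
    exact hT
  · have := map_multiset_sum θ.symm T
    rw [← this, hs, map_zero]

variable {S : Multiset V}

theorem ShortFree.cons_of_count_eq_three (hS : ShortFree S) {x : V} (hx : S.count x = 3) :
    ShortFree (x ::ₘ S) := by
  intro T hT h0 hc hs
  have hcount := Multiset.count_le_of_le x hT
  rw [Multiset.count_cons_self, hx] at hcount
  by_cases h : T.count x ≤ 3
  · refine hS T (Multiset.le_iff_count.2 fun y => ?_) h0 hc hs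
    rcases eq_or_ne y x with rfl | hy
    · omega
    · simpa [hy] using Multiset.count_le_of_le y hT
  obtain ⟨U, rfl⟩ := Multiset.le_iff_exists_add.1 (Multiset.le_count_iff_replicate_le.1 (by omega : 4 ≤ T.count x))
  rw [Multiset.card_add, Multiset.card_replicate] at hc
  rw [Multiset.count_add, Multiset.count_replicate_self] at hcount
  have h4 : (4 : ℕ) • x = -x := by
    rw [eq_neg_iff_add_eq_zero, ← succ_nsmul]
    ext i
    simpa using Or.inl (by decide : (5 : ZMod 5) = 0)
  rw [Multiset.sum_add, Multiset.sum_replicate, h4] at hs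
  have hU : Multiset.card U = 0 ∨ Multiset.card U = 1 := by omega
  rcases hU with hU | hU
  · rw [Multiset.card_eq_zero] at hU
    subst hU
    have : x = 0 := by simpa using hs
    subst this
    have := Extremal.count_zero hS
    omega
  · obtain ⟨y, rfl⟩ := Multiset.card_eq_one.1 hU
    have : y = x := by
      rw [Multiset.sum_singleton, neg_add_eq_zero] at hs
      exact hs.symm
    subst this
    simp at hcount

theorem ShortFree.card_eq_of_maximal (hS : ShortFree S) (hc : 32 ≤ Multiset.card S)
    (hmax : ∀ x, ¬ ShortFree (x ::ₘ S)) : Multiset.card S = 32 ∧ S.sum ≠ 0 := by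
  obtain ⟨θ, hθ⟩ := exists_best S.count
  have hcount (x : V) : (S.map θ.symm).count x = S.count (θ x) := by
    conv_lhs => rw [← θ.symm_apply_apply x]
    exact Multiset.count_map_eq_count' _ _ θ.symm.injective _
  have h : Extremal (S.map θ.symm) :=
    { shortFree := hS.map θ.symm
      best := by
        have : ((S.map θ.symm).count ·) = S.count ∘ θ := funext hcount
        rwa [this]
      count_mem := fun x => by
        rw [hcount]
        have h1 := hS.count_le (θ x)
        have h2 : S.count (θ x) ≠ 3 := fun h => hmax _ (hS.cons_of_count_eq_three h)
        omega
      card := by simpa using hc }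
  have := h.sound fun _ _ => covered
  rw [Multiset.card_map] at this
  refine ⟨this.1, fun h0 => this.2 ?_⟩
  have := map_multiset_sum θ.symm S
  rw [← this, h0, map_zero]

theorem ShortFree.exists_maximal (hS : ShortFree S) :
    ∃ T, S ≤ T ∧ ShortFree T ∧ ∀ x, ¬ ShortFree (x ::ₘ T) := by
  by_contra! h
  have (n : ℕ) : ∃ T, S ≤ T ∧ ShortFree T ∧ n ≤ Multiset.card T := by
    induction n with
    | zero => exact ⟨S, le_rfl, hS, Nat.zero_le _⟩
    | succ n ih =>
      obtain ⟨T, h1, h2, h3⟩ := ih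
      obtain ⟨x, hx⟩ := h T h1 h2
      exact ⟨x ::ₘ T, h1.trans (Multiset.le_cons_self _ _), hx, by simpa using h3⟩
  obtain ⟨T, -, hT, hn⟩ := this 501
  have := Finset.sum_le_card_nsmul Finset.univ (fun x => T.count x) 4 fun x _ => hT.count_le x
  rw [Multiset.sum_count_eq_card fun x _ => Finset.mem_univ x] at this
  have hV : Finset.card (Finset.univ : Finset V) = 125 := by simp [V, Fintype.card_pi]
  rw [hV] at this
  simp at this
  omega

/-- `η(C₅³) ≤ 33`. -/
theorem ShortFree.card_le (hS : ShortFree S) : Multiset.card S ≤ 32 := by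
  obtain ⟨T, hle, hT, hmax⟩ := hS.exists_maximal
  have h1 := Multiset.card_le_card hle
  by_contra! h
  have := (hT.card_eq_of_maximal (by omega) hmax).1
  omega

theorem ShortFree.sum_ne_zero (hS : ShortFree S) (hc : Multiset.card S = 32) : S.sum ≠ 0 := by
  refine (hS.card_eq_of_maximal hc.ge fun x hx => ?_).2
  have := hx.card_le
  simp at this
  omega

end Search

/-! ### A search for caps in `C₃³` -/

namespace Cap

/-- `Bool` case distinction, written with the recursor so that the kernel unfolds nothing. -/
local notation "cond[" c "," a "," b "]" => Bool.rec (motive := fun _ => Bool) b a c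

noncomputable section

/-- The third point on the line through `p` and `q`, points of `C₃³` being coded in base `3`. -/
def third (p q : ℕ) : ℕ :=
  Nat.add (Nat.mod (Nat.mul 2 (Nat.add p q)) 3) (Nat.add
    (Nat.mul 3 (Nat.mod (Nat.mul 2 (Nat.add (Nat.div p 3) (Nat.div q 3))) 3))
    (Nat.mul 9 (Nat.mod (Nat.mul 2 (Nat.add (Nat.div p 9) (Nat.div q 9))) 3)))

def blocked (p : ℕ) (ch : List ℕ) : ℕ :=
  List.rec (motive := fun _ => ℕ) 0 (fun q _ m => Nat.lor m (Nat.pow 2 (third p q))) ch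

def remove (m : ℕ) (pts : List ℕ) : List ℕ :=
  List.rec (motive := fun _ => List ℕ) []
    (fun x _ ih => Bool.rec (motive := fun _ => List ℕ) ih (x :: ih) (Nat.beq (Nat.land m (Nat.pow 2 x)) 0)) pts

def leaf (ch : List ℕ) : Bool :=
  ch.length == 9 && ((ch.map (· % 3)).sum % 3 == 0 &&
          ((ch.map (· / 3 % 3)).sum % 3 == 0 && (ch.map (· / 9)).sum % 3 == 0))

def room (pts : List ℕ) (k : ℕ) : Bool :=
  List.rec (motive := fun _ => ℕ → Bool) (fun k => Nat.beq k 0)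
    (fun _ _ ih k => cond[Nat.beq k 0, true, ih (Nat.sub k 1)]) pts k

def search (n : ℕ) : List ℕ → List ℕ → ℕ → Bool :=
  Nat.rec (motive := fun _ => List ℕ → List ℕ → ℕ → Bool) (fun _ _ _ => false)
    (fun _ ih pts ch k => cond[room pts k,
      List.rec (motive := fun _ => Bool) (leaf ch)
        (fun p ps _ => cond[ih (remove (blocked p ch) ps) (p :: ch) (Nat.sub k 1), ih ps ch k, false]) pts, true]) n

theorem search_eq_true : search 27 (List.range' 1 26) [0] 8 = true := by
  decide +kernel

end

end Cap

/-! ### Caps in `C₃³` -/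

namespace Cap

theorem mem_blocked {p t : ℕ} {ch : List ℕ} : (blocked p ch).testBit t ↔ ∃ q ∈ ch, third p q = t := by
  induction ch with
  | nil => simp [blocked]
  | cons q ch ih =>
    have e : blocked p (q :: ch) = blocked p ch ||| 2 ^ third p q := rfl
    rw [e, Nat.testBit_or, Bool.or_eq_true, ih, Nat.testBit_two_pow]
    simp [or_comm]

theorem remove_eq (m : ℕ) (pts : List ℕ) : remove m pts = pts.filter fun x => !m.testBit x := by
  induction pts with
  | nil => rfl
  | cons x pts ih =>
    have e : remove m (x :: pts) = Bool.rec (remove m pts) (x :: remove m pts)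
      (Nat.beq (m &&& 2 ^ x) 0) := rfl
    rw [e, ih, List.filter_cons]
    cases h : m.testBit x with
    | false =>
      have : m &&& 2 ^ x = 0 := by rw [Nat.and_two_pow, h]; simp
      simp [this]
    | true =>
      have : m &&& 2 ^ x ≠ 0 := by rw [Nat.and_two_pow, h]; simp
      have : Nat.beq (m &&& 2 ^ x) 0 = false := by
        rw [← Bool.not_eq_true, Nat.beq_eq]; exact this
      simp [this]

theorem room_eq_true {pts : List ℕ} {k : ℕ} : room pts k = true ↔ k ≤ pts.length := by
  induction pts generalizing k with
  | nil => simp [room]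
  | cons p pts ih =>
    have e : room (p :: pts) k = Bool.rec (room pts (k - 1)) true (Nat.beq k 0) := rfl
    cases k with
    | zero => simp [e]
    | succ k =>
      rw [e]
      exact (ih (k := k)).trans Nat.succ_le_succ_iff.symm

theorem exists_perm_leaf {n : ℕ} {pts ch : List ℕ} {k : ℕ} (h : search n pts ch k = true)
    (hk : k = 9 - ch.length) {L : List ℕ} (hL : L.Sublist pts) (hn : (ch ++ L).Nodup)
    (hcap : ∀ p ∈ ch ++ L, ∀ q ∈ ch ++ L, p ≠ q → third p q ∉ ch ++ L) (hc : 9 ≤ (ch ++ L).length) :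
    ∃ C, C.Perm (ch ++ L) ∧ leaf C = true := by
  induction n generalizing pts ch k L with
  | zero => exact absurd h (by simp [search])
  | succ n ih =>
    have hlen := hL.length_le
    rw [List.length_append] at hc
    have hr : room pts k = true := room_eq_true.2 (by omega)
    cases pts with
    | nil =>
      obtain rfl := List.sublist_nil.1 hL
      have e : search (n + 1) [] ch k = Bool.rec true (leaf ch) (room [] k) := rfl
      rw [e, hr] at h
      exact ⟨ch, by simp, h⟩
    | cons p ps =>
      have e : search (n + 1) (p :: ps) ch k = Bool.rec true (Bool.rec false (search n ps ch k)
        (search n (remove (blocked p ch) ps) (p :: ch) (k - 1))) (room (p :: ps) k) := rfl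
      rw [e, hr] at h
      have h1 : search n (remove (blocked p ch) ps) (p :: ch) (k - 1) = true := by
        cases h' : search n (remove (blocked p ch) ps) (p :: ch) (k - 1) with
        | false => rw [h'] at h; exact h
        | true => rfl
      rw [h1] at h
      cases hL with
      | cons _ hL => exact ih h hk hL hn hcap (by simpa using hc)
      | cons_cons _ hL =>
        rename_i L
        have hp : (ch ++ p :: L).Perm (p :: ch ++ L) := List.perm_middle
        have hmem := fun x => hp.mem_iff (a := x)
        have hn' := hp.nodup_iff.1 hn
        obtain ⟨C, hC, hl⟩ := ih (L := L) h1 (by simp; omega) (by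
          have hf : L.filter (fun x => !(blocked p ch).testBit x) = L := by
            rw [List.filter_eq_self]
            intro x hx
            rw [Bool.not_eq_true', ← Bool.not_eq_true, mem_blocked]
            rintro ⟨q, hq, rfl⟩
            refine hcap p (by simp) q (by simp [hq]) ?_ (by simp [hx])
            rintro rfl
            simp [hq] at hn'
          rw [remove_eq, ← hf]
          exact hL.filter _) hn' (by simpa only [hmem] using hcap) (by rw [← hp.length_eq]; simpa using hc)
        exact ⟨C, hC.trans hp.symm, hl⟩

abbrev W := Fin 3 → ZMod 3

def code (x : W) : ℕ := (x 0).val + 3 * (x 1).val + 9 * (x 2).val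

theorem code_injective : Function.Injective code := by
  intro x y h
  have h0 := (x 0).val_lt
  have h1 := (x 1).val_lt
  have h2 := (x 2).val_lt
  have h0 := (y 0).val_lt
  have h1 := (y 1).val_lt
  have h2 := (y 2).val_lt
  unfold code at h
  ext i
  fin_cases i <;> (apply ZMod.val_injective; simp; omega)

theorem third_code : ∀ x y : W, third (code x) (code y) = code (-x - y) := by decide +kernel

theorem card_le_and_sum_eq {A : Finset W} (h0 : 0 ∈ A)
    (hA : ∀ x ∈ A, ∀ y ∈ A, x ≠ y → -x - y ∉ A) :
    A.card ≤ 9 ∧ (A.card = 9 → ∑ x ∈ A, x = 0) := by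
  by_cases hc : A.card < 9
  · exact ⟨by omega, by omega⟩
  obtain ⟨L, hL⟩ : ∃ L, L = (List.range' 1 26).filter fun n => n ∈ A.image code := ⟨_, rfl⟩
  have hn : ([0] ++ L).Nodup := by
    rw [List.singleton_append, List.nodup_cons, hL]
    exact ⟨by simp, (List.nodup_range' ..).filter _⟩
  have hmem : ∀ n, n ∈ [0] ++ L ↔ n ∈ A.toList.map code := by
    intro n
    simp only [hL, List.singleton_append, List.mem_cons, List.mem_filter, List.mem_range'_1,
      Finset.mem_image, List.mem_map, Finset.mem_toList, decide_eq_true_eq]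
    constructor
    · rintro (rfl | h)
      · exact ⟨0, h0, rfl⟩
      · exact h.2
    · rintro ⟨x, hx, rfl⟩
      have h0 := (x 0).val_lt
      have h1 := (x 1).val_lt
      have h2 := (x 2).val_lt
      by_cases h : code x = 0
      · exact .inl h
      · refine .inr ⟨⟨by omega, ?_⟩, x, hx, rfl⟩
        unfold code
        omega
  have hperm : ([0] ++ L).Perm (A.toList.map code) :=
    (List.perm_ext_iff_of_nodup hn (A.nodup_toList.map code_injective)).2 hmem
  obtain ⟨C, hC, hl⟩ := exists_perm_leaf search_eq_true rfl (hL ▸ List.filter_sublist) hn (by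
    simp only [hmem, List.mem_map, Finset.mem_toList]
    rintro _ ⟨x, hx, rfl⟩ _ ⟨y, hy, rfl⟩ hxy ⟨z, hz, h⟩
    rw [third_code, code_injective.eq_iff] at h
    exact hA x hx y hy (fun h => hxy (congrArg code h)) (h ▸ hz)) (by
    rw [hperm.length_eq]; simpa using hc)
  replace hC := hC.trans hperm
  simp only [leaf, Bool.and_eq_true, beq_iff_eq] at hl
  obtain ⟨l, s0, s1, s2⟩ := hl
  rw [hC.length_eq, List.length_map, Finset.length_toList] at l
  refine ⟨l.le, fun _ => ?_⟩
  have key (f : ℕ → ℕ) (i : Fin 3) (hf : ∀ x : W, f (code x) = (x i).val)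
      (hs : (C.map f).sum % 3 = 0) : (∑ x ∈ A, x) i = 0 := by
    rw [(hC.map f).sum_eq, List.map_map, ← Nat.dvd_iff_mod_eq_zero, ← ZMod.natCast_eq_zero_iff] at hs
    have e : f ∘ code = fun x => (x i).val := funext hf
    rw [e, Finset.sum_map_toList] at hs
    push_cast at hs
    simpa using hs
  have hlt (x : W) : (x 0).val < 3 ∧ (x 1).val < 3 ∧ (x 2).val < 3 :=
    ⟨(x 0).val_lt, (x 1).val_lt, (x 2).val_lt⟩
  ext i
  fin_cases i
  · exact key _ 0 (fun x => by have := hlt x; unfold code; omega) s0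
  · exact key _ 1 (fun x => by have := hlt x; unfold code; omega) s1
  · exact key _ 2 (fun x => by have := hlt x; unfold code; omega) s2

end Cap

/-! ### Sequences over `C₃³` -/

/-- `S` has a nonempty zero-sum subsequence of length at most `n`. -/
def HasZeroSum {G : Type*} [AddCommMonoid G] (n : ℕ) (S : Multiset G) : Prop :=
  ∃ T ≤ S, T ≠ 0 ∧ Multiset.card T ≤ n ∧ T.sum = 0

namespace Cap

variable {S : Multiset W}

theorem card_le_nine {A : Finset W} (hA : ∀ x ∈ A, ∀ y ∈ A, x ≠ y → -x - y ∉ A) : A.card ≤ 9 := by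
  rcases A.eq_empty_or_nonempty with rfl | ⟨a, ha⟩
  · simp
  rw [← A.card_image_of_injective (f := (· - a)) fun _ _ => sub_left_inj.1]
  refine (card_le_and_sum_eq ((Finset.mem_image (f := (· - a))).2 ⟨a, ha, sub_self a⟩) ?_).1
  simp only [Finset.mem_image]
  rintro _ ⟨x, hx, rfl⟩ _ ⟨y, hy, rfl⟩ hxy ⟨z, hz, h⟩
  have h3 : a + a + a = 0 := by
    have : ∀ t : ZMod 3, t + t + t = 0 := by decide
    ext i
    exact this _
  refine hA x hx y hy (fun h => hxy (by rw [h])) ?_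
  have : -x - y = z := by
    calc -x - y = (-(x - a) - (y - a)) + a - (a + a + a) := by abel
      _ = z := by rw [← h, h3]; abel
  rwa [this]

theorem three_nsmul (x : W) : 3 • x = 0 := by
  ext i
  simp [show (3 : ZMod 3) = 0 from rfl]

theorem count_le_two (hS : ∀ T ≤ S, Multiset.card T = 3 → T.sum ≠ 0) (x : W) : S.count x ≤ 2 := by
  by_contra! h
  exact hS (Multiset.replicate 3 x) (Multiset.le_count_iff_replicate_le.1 h) (by simp)
    (by rw [Multiset.sum_replicate, three_nsmul])

theorem sub_notMem (hS : ∀ T ≤ S, Multiset.card T = 3 → T.sum ≠ 0) {x y : W} (hx : x ∈ S) (hy : y ∈ S)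
    (hxy : x ≠ y) : -x - y ∉ S := by
  intro hz
  have key : ∀ x y : W, x ≠ y → x ≠ -x - y ∧ y ≠ -x - y := by decide +kernel
  obtain ⟨h1, h2⟩ := key x y hxy
  refine hS {x, y, -x - y} ?_ (by simp) (by simp)
  rw [Multiset.le_iff_subset (by simp [hxy, h1, h2])]
  intro z hz
  simp only [Multiset.insert_eq_cons, Multiset.mem_cons, Multiset.mem_singleton] at hz
  rcases hz with rfl | rfl | rfl <;> assumption

theorem le_two_nsmul (hS : ∀ x, S.count x ≤ 2) : S ≤ 2 • S.toFinset.val := by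
  rw [Multiset.le_iff_count]
  intro x
  rw [Multiset.count_nsmul, Multiset.toFinset_val]
  by_cases hx : x ∈ S
  · rw [Multiset.count_dedup, if_pos hx]
    exact hS x
  · simp [Multiset.count_eq_zero_of_notMem hx]

theorem exists_card_eq_three (h : 19 ≤ Multiset.card S) : ∃ T ≤ S, Multiset.card T = 3 ∧ T.sum = 0 := by
  by_contra! hS
  have h1 := Multiset.card_le_card (le_two_nsmul (count_le_two hS))
  have h2 := card_le_nine (A := S.toFinset) (by
    simpa only [Multiset.mem_toFinset] using fun x hx y hy => sub_notMem hS hx hy)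
  rw [Multiset.card_nsmul, Finset.card_val] at h1
  omega

theorem card_support (hS : ¬ HasZeroSum 3 S) : S.toFinset.card ≤ 8 ∧
    (S.toFinset.card = 8 → ∑ x ∈ S.toFinset, x = 0) ∧ S ≤ 2 • S.toFinset.val := by
  have hS3 : ∀ T ≤ S, Multiset.card T = 3 → T.sum ≠ 0 := fun T h1 h2 h3 =>
    hS ⟨T, h1, by rintro rfl; simp at h2, h2.le, h3⟩
  have h0 : 0 ∉ S.toFinset := fun h =>
    hS ⟨{0}, by simpa using h, by simp, by simp, by simp⟩
  have hneg {x : W} (hx : x ∈ S) : -x ∉ S := by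
    intro hy
    have key : ∀ x : W, x ≠ 0 → x ≠ -x := by decide +kernel
    have hx0 : x ≠ 0 := fun h => h0 (by simpa [h] using hx)
    refine hS ⟨{x, -x}, ?_, by simp, by simp, by simp⟩
    rw [Multiset.le_iff_subset (by simpa using key x hx0)]
    intro z hz
    simp only [Multiset.insert_eq_cons, Multiset.mem_cons, Multiset.mem_singleton] at hz
    rcases hz with rfl | rfl <;> assumption
  have := card_le_and_sum_eq (A := insert 0 S.toFinset) (Finset.mem_insert_self _ _) (by
    have aux {y : W} (hy : y ∈ S) : -y ≠ 0 ∧ -y ∉ S :=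
      ⟨fun h => h0 (by simpa [neg_eq_zero.1 h] using hy), hneg hy⟩
    simp only [Finset.mem_insert, Multiset.mem_toFinset]
    rintro x (rfl | hx) y (rfl | hy) hxy
    · exact absurd rfl hxy
    · simpa using aux hy
    · simpa using aux hx
    · rintro (h | h)
      · rw [sub_eq_zero] at h
        exact hneg hx (h ▸ hy)
      · exact sub_notMem hS3 hx hy hxy h)
  rw [Finset.card_insert_of_notMem h0, Finset.sum_insert h0, zero_add] at this
  exact ⟨by omega, fun h => this.2 (by omega), le_two_nsmul (count_le_two hS3)⟩

/-- `η(C₃³) ≤ 17`. -/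
theorem hasZeroSum_of_card (h : 17 ≤ Multiset.card S) : HasZeroSum 3 S := by
  by_contra hS
  obtain ⟨h1, -, h2⟩ := card_support hS
  replace h2 := Multiset.card_le_card h2
  rw [Multiset.card_nsmul, Finset.card_val] at h2
  omega

theorem hasZeroSum_of_card_eq_fifteen (h : Multiset.card S = 15) (h0 : S.sum = 0) : HasZeroSum 3 S := by
  by_contra hS
  obtain ⟨h1, h2, h3⟩ := card_support hS
  obtain ⟨T, hT⟩ := Multiset.le_iff_exists_add.1 h3
  have hc := congrArg Multiset.card hT
  have hs := congrArg Multiset.sum hT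
  rw [Multiset.card_nsmul, Multiset.card_add, Finset.card_val] at hc
  have h8 : S.toFinset.card = 8 := by omega
  obtain ⟨y, rfl⟩ := Multiset.card_eq_one.1 (show Multiset.card T = 1 by omega)
  have hv : S.toFinset.val.sum = 0 := by simpa [Finset.sum] using h2 h8
  rw [Multiset.sum_nsmul, hv, smul_zero, Multiset.sum_add, h0, zero_add, Multiset.sum_singleton] at hs
  have hy : y ∈ 2 • S.toFinset.val := by rw [hT]; simp
  replace hy := Multiset.mem_of_mem_nsmul hy
  rw [← hs] at hy
  exact hS ⟨{0}, by simpa using hy, by simp, by simp, by simp⟩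

theorem exists_two_of_card_eq_eighteen (h : Multiset.card S = 18) (h0 : S.sum = 0) :
    ∃ A B, A + B ≤ S ∧ (A ≠ 0 ∧ Multiset.card A ≤ 3 ∧ A.sum = 0) ∧ B ≠ 0 ∧ Multiset.card B ≤ 3 ∧ B.sum = 0 := by
  by_cases hS : ∀ T ≤ S, Multiset.card T = 3 → T.sum ≠ 0
  · have hle := le_two_nsmul (count_le_two hS)
    have h9 := card_le_nine (A := S.toFinset) (by
      simpa only [Multiset.mem_toFinset] using fun x hx y hy => sub_notMem hS hx hy)
    have he : S = 2 • S.toFinset.val := Multiset.eq_of_le_of_card_le hle (by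
      rw [Multiset.card_nsmul, Finset.card_val]
      omega)
    suffices ∃ B ≤ S.toFinset.val, B ≠ 0 ∧ Multiset.card B ≤ 3 ∧ B.sum = 0 by
      obtain ⟨B, hB, hB'⟩ := this
      refine ⟨B, B, ?_, hB', hB'⟩
      rw [he, two_nsmul]
      exact add_le_add hB hB
    obtain ⟨B, hB, hB0, hc, hs⟩ := hasZeroSum_of_card (S := S) (by omega)
    by_cases hn : B.Nodup
    · exact ⟨B, by rw [Multiset.toFinset_val, Multiset.le_dedup]; exact ⟨hB, hn⟩, hB0, hc, hs⟩
    · have hpos := Multiset.card_pos.2 hB0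
      have h3 := hS B hB
      have : Multiset.card B = 1 ∨ Multiset.card B = 2 := by
        have : Multiset.card B ≠ 3 := fun h => h3 h hs
        omega
      rcases this with hc | hc
      · obtain ⟨x, rfl⟩ := Multiset.card_eq_one.1 hc
        simp at hn
      · obtain ⟨x, y, rfl⟩ := Multiset.card_eq_two.1 hc
        have hxy : x = y := by simpa using hn
        subst hxy
        have hx : x = 0 := by
          have key : ∀ x : W, x + x = 0 → x = 0 := by decide +kernel
          exact key x (by simpa using hs)
        subst hx
        have : (0 : W) ∈ S := Multiset.mem_of_le hB (by simp)
        exact ⟨{0}, by simpa using this, by simp, by simp, by simp⟩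
  · push Not at hS
    obtain ⟨A, hA, hc, hs⟩ := hS
    obtain ⟨R, rfl⟩ := Multiset.le_iff_exists_add.1 hA
    rw [Multiset.card_add] at h
    rw [Multiset.sum_add, hs, zero_add] at h0
    obtain ⟨B, hB, hB'⟩ := hasZeroSum_of_card_eq_fifteen (S := R) (by omega) h0
    exact ⟨A, B, by gcongr, ⟨by rintro rfl; simp at hc, hc.le, hs⟩, hB'⟩

end Cap

/-! ### Families of disjoint subsequences -/

namespace Multiset

theorem exists_le_map_eq {α β : Type*} {f : α → β} {S : Multiset α} {T : Multiset β} (h : T ≤ S.map f) :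
    ∃ U ≤ S, U.map f = T := by
  induction S using Quotient.inductionOn with | _ s
  induction T using Quotient.inductionOn with | _ t
  obtain ⟨l, hl, hs⟩ := (show t.Subperm (s.map f) from h)
  obtain ⟨l', hl', rfl⟩ := List.sublist_map_iff.1 hs
  exact ⟨l', hl'.subperm, Quotient.sound hl⟩

theorem exists_disjoint_family {α : Type*} {P : Multiset α → Prop} {d p : ℕ} (hP : ∀ T, P T → card T ≤ p)
    (h : ∀ R, d ≤ card R → ∃ T ≤ R, P T) (k : ℕ) {S : Multiset α} (hS : d + p * k ≤ card S + p) :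
    ∃ 𝒯 : Multiset (Multiset α), card 𝒯 = k ∧ 𝒯.sum ≤ S ∧ ∀ T ∈ 𝒯, P T := by
  induction k generalizing S with
  | zero => exact ⟨0, by simp⟩
  | succ k ih =>
    rw [Nat.mul_succ] at hS
    obtain ⟨T, hT, hPT⟩ := h S (by omega)
    obtain ⟨R, rfl⟩ := Multiset.le_iff_exists_add.1 hT
    have := hP T hPT
    rw [card_add] at hS
    obtain ⟨𝒯, h1, h2, h3⟩ := ih (S := R) (by omega)
    exact ⟨T ::ₘ 𝒯, by simp [h1], by rw [sum_cons]; gcongr, by simpa using ⟨hPT, h3⟩⟩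

theorem card_sum_le {α : Type*} {p : ℕ} {𝒯 : Multiset (Multiset α)} (h : ∀ T ∈ 𝒯, card T ≤ p) :
    card 𝒯.sum ≤ p * card 𝒯 := by
  induction 𝒯 using Multiset.induction with
  | empty => simp
  | cons T 𝒯 ih =>
    have h1 := h T (mem_cons_self _ _)
    have h2 := ih fun T hT => h T (mem_cons_of_mem hT)
    rw [sum_cons, card_add, card_cons, mul_add]
    omega

end Multiset

section Quotient

variable {G H K : Type*} [AddCommGroup G] [AddCommGroup H] [AddCommGroup K]

theorem exists_le_of_map {φ : G →+ H} {S : Multiset G} {T : Multiset H} (h : T ≤ S.map φ) :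
    ∃ U ≤ S, Multiset.card U = Multiset.card T ∧ φ U.sum = T.sum := by
  obtain ⟨U, hU, rfl⟩ := Multiset.exists_le_map_eq h
  exact ⟨U, hU, by simp, map_multiset_sum φ U⟩

/-- Zero-sum sequences over a quotient can be combined along a zero-sum sequence over the kernel. -/
theorem exists_zeroSum_of_family {φ : G →+ H} {ψ : K →+ G} (hφψ : ∀ x, φ x = 0 → ∃ y, ψ y = x)
    {m : ℕ} {S : Multiset G} {𝒯 : Multiset (Multiset G)} (hle : 𝒯.sum ≤ S)
    (h : ∀ T ∈ 𝒯, T ≠ 0 ∧ φ T.sum = 0)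
    (hK : ∀ U : Multiset K, Multiset.card U = Multiset.card 𝒯 → ∃ V ≤ U, V ≠ 0 ∧ Multiset.card V ≤ m ∧ V.sum = 0) :
    ∃ 𝒰 ≤ 𝒯, 𝒰 ≠ 0 ∧ Multiset.card 𝒰 ≤ m ∧ 𝒰.sum ≠ 0 ∧ 𝒰.sum ≤ S ∧ 𝒰.sum.sum = 0 := by
  have (T : Multiset G) : ∃ y, φ T.sum = 0 → ψ y = T.sum := by
    by_cases hT : φ T.sum = 0
    · obtain ⟨y, hy⟩ := hφψ _ hT
      exact ⟨y, fun _ => hy⟩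
    · exact ⟨0, fun h => absurd h hT⟩
  choose y hy using this
  obtain ⟨V, hV, hV0, hm, hs⟩ := hK (𝒯.map y) (by simp)
  obtain ⟨𝒰, hU, rfl⟩ := Multiset.exists_le_map_eq hV
  have hU0 : 𝒰 ≠ 0 := by rintro rfl; simp at hV0
  refine ⟨𝒰, hU, hU0, by simpa using hm, ?_, le_trans ?_ hle, ?_⟩
  · obtain ⟨T, hT⟩ := Multiset.exists_mem_of_ne_zero hU0
    intro h0
    have := Multiset.single_le_sum (fun _ _ => zero_le) T hT
    rw [h0] at this
    exact (h T (Multiset.mem_of_le hU hT)).1 (le_antisymm this zero_le)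
  · obtain ⟨𝒱, rfl⟩ := Multiset.le_iff_exists_add.1 hU
    rw [Multiset.sum_add]
    exact Multiset.le_add_right _ _
  · have e1 : 𝒰.map Multiset.sum = 𝒰.map (ψ ∘ y) := Multiset.map_congr rfl fun T hT =>
      (hy T (h T (Multiset.mem_of_le hU hT)).2).symm
    rw [← Multiset.join, Multiset.sum_join, e1, ← Multiset.map_map, ← map_multiset_sum, hs, map_zero]

end Quotient

/-! ### The constant `η` of `C_n³` -/

/-- `η(C_n³) ≤ 8 * n - 7`. -/
def EtaLe (n : ℕ) : Prop := ∀ S : Multiset (Fin 3 → ZMod n), 8 * n - 7 ≤ Multiset.card S → HasZeroSum n S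

section ZMod

variable (p m : ℕ)

def reduce : (Fin 3 → ZMod (p * m)) →+ (Fin 3 → ZMod p) :=
  (ZMod.castHom (dvd_mul_right p m) (ZMod p)).toAddMonoidHom.compLeft (Fin 3)

def inclusion : (Fin 3 → ZMod m) →+ (Fin 3 → ZMod (p * m)) :=
  (ZMod.lift m ⟨(AddMonoidHom.mulLeft (p : ZMod (p * m))).comp (Int.castAddHom _), by
    have := ZMod.natCast_self (p * m)
    push_cast at this
    simpa using this⟩).compLeft (Fin 3)

variable {p m}

theorem exists_inclusion_eq [NeZero (p * m)] (x : Fin 3 → ZMod (p * m)) (hx : reduce p m x = 0) :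
    ∃ y, inclusion p m y = x := by
  have (i : Fin 3) : ∃ k : ℤ, (p : ZMod (p * m)) * k = x i := by
    have h : ((x i).cast : ZMod p) = 0 := congrFun hx i
    rw [ZMod.cast_eq_val, ZMod.natCast_eq_zero_iff] at h
    obtain ⟨k, hk⟩ := h
    refine ⟨k, ?_⟩
    have := ZMod.natCast_zmod_val (x i)
    rw [hk] at this
    simpa using this
  choose k hk using this
  refine ⟨fun i => (k i : ZMod m), funext fun i => ?_⟩
  rw [← hk i]
  simp [inclusion]

theorem exists_reduce_zeroSum {d : ℕ} (h : ∀ S : Multiset (Fin 3 → ZMod p), d ≤ Multiset.card S → HasZeroSum p S)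
    (R : Multiset (Fin 3 → ZMod (p * m))) (hR : d ≤ Multiset.card R) :
    ∃ T ≤ R, T ≠ 0 ∧ Multiset.card T ≤ p ∧ reduce p m T.sum = 0 := by
  obtain ⟨T, hT, h0, hc, hs⟩ := h (R.map (reduce p m)) (by simpa using hR)
  obtain ⟨U, hU, hc', hs'⟩ := exists_le_of_map hT
  exact ⟨U, hU, by rwa [← Multiset.card_pos, hc', Multiset.card_pos], hc'.trans_le hc, hs'.trans hs⟩

theorem HasZeroSum.of_family [NeZero (p * m)] (hm : EtaLe m) {S : Multiset (Fin 3 → ZMod (p * m))}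
    {𝒯 : Multiset (Multiset (Fin 3 → ZMod (p * m)))} (hle : 𝒯.sum ≤ S)
    (h : ∀ T ∈ 𝒯, T ≠ 0 ∧ Multiset.card T ≤ p ∧ reduce p m T.sum = 0)
    (hc : 8 * m - 7 ≤ Multiset.card 𝒯) : HasZeroSum (p * m) S := by
  obtain ⟨𝒰, h1, -, h2, h3, h4, h5⟩ := exists_zeroSum_of_family (exists_inclusion_eq (p := p) (m := m)) (m := m) hle
    (fun T hT => ⟨(h T hT).1, (h T hT).2.2⟩) fun U hU => hm U (hU ▸ hc)
  refine ⟨𝒰.sum, h4, h3, ?_, h5⟩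
  exact (Multiset.card_sum_le fun T hT => (h T (Multiset.mem_of_le h1 hT)).2.1).trans (Nat.mul_le_mul_left p h2)

theorem etaLe_mul [NeZero (p * m)] {d : ℕ} (hp : ∀ S : Multiset (Fin 3 → ZMod p), d ≤ Multiset.card S → HasZeroSum p S)
    (hm : EtaLe m) (hd : d + p * (8 * m - 7) ≤ 8 * (p * m) - 7 + p) : EtaLe (p * m) := by
  intro S hS
  obtain ⟨𝒯, hc, hle, h⟩ := Multiset.exists_disjoint_family (fun T hT => hT.2.1)
    (exists_reduce_zeroSum (p := p) (m := m) hp) (8 * m - 7) (S := S) (by omega)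
  exact .of_family hm hle h hc.ge

theorem etaLe_one : EtaLe 1 := by
  intro S hS
  obtain ⟨x, hx⟩ := Multiset.card_pos_iff_exists_mem.1 (show 0 < Multiset.card S by omega)
  exact ⟨{x}, by simpa using hx, by simp, by simp, Subsingleton.elim _ _⟩

end ZMod

theorem Search.hasZeroSum_of_not_shortFree {S : Multiset (Fin 3 → ZMod 5)} (h : ¬ ShortFree S) : HasZeroSum 5 S := by
  unfold ShortFree at h
  push Not at h
  exact h

theorem Search.hasZeroSum_of_card {S : Multiset (Fin 3 → ZMod 5)} (h : 33 ≤ Multiset.card S) : HasZeroSum 5 S :=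
  hasZeroSum_of_not_shortFree fun hS => by have := hS.card_le; omega

theorem Search.hasZeroSum_of_sum_eq_zero {S : Multiset (Fin 3 → ZMod 5)} (h : 32 ≤ Multiset.card S) (h0 : S.sum = 0) :
    HasZeroSum 5 S := by
  rcases h.lt_or_eq with h | h
  · exact hasZeroSum_of_card h
  · exact hasZeroSum_of_not_shortFree fun hS => hS.sum_ne_zero h.symm h0

theorem etaLe_three_mul {m : ℕ} (hm0 : 0 < m) (hm : EtaLe m) : EtaLe (3 * m) :=
  have : NeZero (3 * m) := ⟨by omega⟩
  etaLe_mul (fun _ => Cap.hasZeroSum_of_card) hm (by omega)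

theorem etaLe_five_mul {m : ℕ} (hm0 : 0 < m) (hm : EtaLe m) : EtaLe (5 * m) :=
  have : NeZero (5 * m) := ⟨by omega⟩
  etaLe_mul (fun _ => Search.hasZeroSum_of_card) hm (by omega)

theorem etaLe_three_pow_mul_five_pow (a b : ℕ) : EtaLe (3 ^ a * 5 ^ b) := by
  induction a with
  | zero =>
    rw [pow_zero, one_mul]
    induction b with
    | zero => exact etaLe_one
    | succ b ih => rw [pow_succ']; exact etaLe_five_mul (by positivity) ih
  | succ a ih => rw [pow_succ', mul_assoc]; exact etaLe_three_mul (by positivity) ih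

/-! ### Zero-sum sequences of prescribed length -/

theorem hasZeroSum_five_mul {m : ℕ} (hm0 : 0 < m) (hm : EtaLe m) {S : Multiset (Fin 3 → ZMod (5 * m))}
    (hc : Multiset.card S = 8 * (5 * m) - 8) (hs : S.sum = 0) : HasZeroSum (5 * m) S := by
  have : NeZero (5 * m) := ⟨by omega⟩
  obtain ⟨𝒯, hc', hle, h⟩ := Multiset.exists_disjoint_family (fun T hT => hT.2.1)
    (exists_reduce_zeroSum (p := 5) (m := m) fun _ => Search.hasZeroSum_of_card) (8 * m - 8) (S := S) (by omega)
  obtain ⟨R, rfl⟩ := Multiset.le_iff_exists_add.1 hle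
  have hcard := Multiset.card_sum_le fun T hT => (h T hT).2.1
  have hsum : reduce 5 m 𝒯.sum.sum = 0 := by
    rw [← Multiset.join, Multiset.sum_join, map_multiset_sum, Multiset.map_map]
    refine Multiset.sum_eq_zero fun x hx => ?_
    obtain ⟨T, hT, rfl⟩ := Multiset.mem_map.1 hx
    exact (h T hT).2.2
  rw [Multiset.sum_add] at hs
  rw [Multiset.card_add] at hc
  have hR : reduce 5 m R.sum = 0 := by
    have := congrArg (reduce 5 m) hs
    rwa [map_add, hsum, zero_add, map_zero] at this
  obtain ⟨T, hT, h0, hc1, hs1⟩ := Search.hasZeroSum_of_sum_eq_zero (S := R.map (reduce 5 m))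
    (by rw [Multiset.card_map]; omega) (by rw [← map_multiset_sum]; exact hR)
  obtain ⟨U, hU, hc2, hs2⟩ := exists_le_of_map hT
  refine .of_family hm (𝒯 := U ::ₘ 𝒯) (by rw [Multiset.sum_cons, add_comm]; gcongr) ?_ ?_
  · simp only [Multiset.mem_cons, forall_eq_or_imp]
    exact ⟨⟨by rwa [← Multiset.card_pos, hc2, Multiset.card_pos], hc2.trans_le hc1, hs2.trans hs1⟩, h⟩
  · rw [Multiset.card_cons]
    omega

theorem hasZeroSum_three_mul {m : ℕ} (hm1 : 2 ≤ m) (hm : EtaLe m) {S : Multiset (Fin 3 → ZMod (3 * m))}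
    (hc : Multiset.card S = 8 * (3 * m) - 9) (hs : S.sum = 0) : HasZeroSum (3 * m) S := by
  have : NeZero (3 * m) := ⟨by omega⟩
  obtain ⟨𝒯, hc', hle, h⟩ := Multiset.exists_disjoint_family (p := 3)
    (P := fun T : Multiset (Fin 3 → ZMod (3 * m)) => Multiset.card T = 3 ∧ reduce 3 m T.sum = 0)
    (d := 19) (fun T hT => hT.1.le) (fun R hR => by
      obtain ⟨T, hT, h3, h0⟩ := Cap.exists_card_eq_three (S := R.map (reduce 3 m)) (by simpa using hR)
      obtain ⟨U, hU, hc2, hs2⟩ := exists_le_of_map hT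
      exact ⟨U, hU, hc2.trans h3, hs2.trans h0⟩) (8 * m - 9) (S := S) (by omega)
  obtain ⟨R, rfl⟩ := Multiset.le_iff_exists_add.1 hle
  have hcard : Multiset.card 𝒯.sum = 3 * (8 * m - 9) := by
    rw [← Multiset.join, Multiset.card_join, Multiset.map_congr rfl fun T hT => (h T hT).1, Multiset.map_const',
      Multiset.sum_replicate, hc', smul_eq_mul, mul_comm]
  have hsum : reduce 3 m 𝒯.sum.sum = 0 := by
    rw [← Multiset.join, Multiset.sum_join, map_multiset_sum, Multiset.map_map]
    refine Multiset.sum_eq_zero fun x hx => ?_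
    obtain ⟨T, hT, rfl⟩ := Multiset.mem_map.1 hx
    exact (h T hT).2
  rw [Multiset.sum_add] at hs
  rw [Multiset.card_add] at hc
  have hR : reduce 3 m R.sum = 0 := by
    have := congrArg (reduce 3 m) hs
    rwa [map_add, hsum, zero_add, map_zero] at this
  obtain ⟨A, B, hAB, ⟨hA0, hAc, hAs⟩, hB0, hBc, hBs⟩ := Cap.exists_two_of_card_eq_eighteen (S := R.map (reduce 3 m))
    (by rw [Multiset.card_map]; omega) (by rw [← map_multiset_sum]; exact hR)
  obtain ⟨W, hW, hWAB⟩ := Multiset.exists_le_map_eq hAB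
  obtain ⟨U, hU, hUA⟩ := Multiset.exists_le_map_eq (hWAB ▸ Multiset.le_add_right A B)
  obtain ⟨V, rfl⟩ := Multiset.le_iff_exists_add.1 hU
  have hVB : V.map (reduce 3 m) = B := by
    rw [Multiset.map_add, hUA] at hWAB
    exact add_left_cancel hWAB
  refine .of_family hm (𝒯 := U ::ₘ V ::ₘ 𝒯) ?_ ?_ ?_
  · rw [Multiset.sum_cons, Multiset.sum_cons, ← add_assoc, add_comm]
    gcongr
  · subst hUA hVB
    simp only [Multiset.mem_cons, forall_eq_or_imp]
    rw [Multiset.card_map] at hAc hBc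
    rw [← map_multiset_sum] at hAs hBs
    refine ⟨⟨by rintro rfl; simp at hA0, hAc, hAs⟩, ⟨by rintro rfl; simp at hB0, hBc, hBs⟩, fun T hT => ?_⟩
    exact ⟨by rw [← Multiset.card_pos, (h T hT).1]; norm_num, (h T hT).1.le, (h T hT).2⟩
  · rw [Multiset.card_cons, Multiset.card_cons]
    omega

/-! ### Zero-sum subsequences of unrestricted length and extremal examples -/

section Davenport

open MvPolynomial

/-- A consequence of the Chevalley–Warning theorem: `D(C_p³) ≤ 3(p - 1) + 1`. -/
theorem exists_zeroSum_of_lt_card {p : ℕ} [Fact p.Prime] {S : Multiset (Fin 3 → ZMod p)}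
    (h : 3 * (p - 1) < Multiset.card S) : ∃ T ≤ S, T ≠ 0 ∧ T.sum = 0 := by
  classical
  have hp : 1 < p := Fact.out (p := p.Prime) |>.one_lt
  induction S using Quotient.inductionOn with | _ l
  let x : Fin l.length → Fin 3 → ZMod p := l.get
  let f : Fin 3 → MvPolynomial (Fin l.length) (ZMod p) := fun c => ∑ i, C (x i c) * X i ^ (p - 1)
  have hdeg (c : Fin 3) : (f c).totalDegree ≤ p - 1 := by
    refine totalDegree_finsetSum_le fun i _ => ?_
    exact (totalDegree_mul _ _).trans (by rw [totalDegree_C, totalDegree_X_pow, zero_add])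
  have hlt : ∑ c, (f c).totalDegree < Fintype.card (Fin l.length) := by
    rw [Fintype.card_fin]
    refine lt_of_le_of_lt (Finset.sum_le_card_nsmul _ _ _ fun c _ => hdeg c) (by simpa using h)
  have hdvd := char_dvd_card_solutions_of_fintype_sum_lt p hlt
  have h0 : ∀ c, eval (0 : Fin l.length → ZMod p) (f c) = 0 := fun c => by
    simp [f, show p - 1 ≠ 0 by omega]
  have hone : 1 < Fintype.card {y : Fin l.length → ZMod p // ∀ c, eval y (f c) = 0} :=
    hp.trans_le (Nat.le_of_dvd (Fintype.card_pos_iff.2 ⟨⟨0, h0⟩⟩) (by convert hdvd))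
  obtain ⟨⟨y, hy⟩, hne⟩ := Fintype.exists_ne_of_one_lt_card hone ⟨0, h0⟩
  have hy0 : y ≠ 0 := fun h => hne (Subtype.ext h)
  obtain ⟨j, hj⟩ := Function.ne_iff.1 hy0
  let s : Finset (Fin l.length) := {i | y i ≠ 0}
  refine ⟨s.val.map x, ?_, ?_, ?_⟩
  · have : (Finset.univ : Finset (Fin l.length)).val.map x = ↑l := by
      simp [x, Fin.univ_val_map]
    exact (Multiset.map_le_map (Finset.val_le_iff.2 (Finset.subset_univ s))).trans this.le
  · have : j ∈ s := by simpa [s] using hj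
    rw [← Multiset.card_pos, Multiset.card_map]
    exact Finset.card_pos.2 ⟨j, this⟩
  · change ∑ i ∈ s, x i = 0
    funext c
    rw [Finset.sum_apply, Pi.zero_apply, ← hy c, Finset.sum_filter]
    simp only [f, map_sum, map_mul, eval_C, map_pow, eval_X]
    refine Finset.sum_congr rfl fun i _ => ?_
    split_ifs with hi
    · rw [ZMod.pow_card_sub_one_eq_one hi, mul_one]
    · rw [not_not.1 hi, zero_pow (by omega), mul_zero]

theorem exists_zeroSum_of_card {p m d : ℕ} [Fact p.Prime] [NeZero (p * m)] (hm : EtaLe m)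
    (hp : ∀ S : Multiset (Fin 3 → ZMod p), d ≤ Multiset.card S → HasZeroSum p S)
    {S : Multiset (Fin 3 → ZMod (p * m))} (h1 : d + p * (8 * m - 8) ≤ Multiset.card S + p)
    (h2 : p * (8 * m - 8) + 3 * (p - 1) < Multiset.card S) : ∃ T ≤ S, T ≠ 0 ∧ T.sum = 0 := by
  obtain ⟨𝒯, hc, hle, h⟩ := Multiset.exists_disjoint_family (fun T hT => hT.2.1)
    (exists_reduce_zeroSum (p := p) (m := m) hp) (8 * m - 8) h1
  obtain ⟨R, rfl⟩ := Multiset.le_iff_exists_add.1 hle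
  have hcard := Multiset.card_sum_le fun T hT => (h T hT).2.1
  rw [Multiset.card_add] at h2
  rw [hc] at hcard
  obtain ⟨T, hT, h0, hs⟩ := exists_zeroSum_of_lt_card (S := R.map (reduce p m)) (by rw [Multiset.card_map]; omega)
  obtain ⟨U, hU, hc2, hs2⟩ := exists_le_of_map hT
  obtain ⟨𝒰, -, -, -, h3, h4, h5⟩ := exists_zeroSum_of_family (exists_inclusion_eq (p := p) (m := m)) (m := m)
    (S := 𝒯.sum + R) (𝒯 := U ::ₘ 𝒯) (by rw [Multiset.sum_cons, add_comm]; gcongr) (by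
      simp only [Multiset.mem_cons, forall_eq_or_imp]
      exact ⟨⟨by rwa [← Multiset.card_pos, hc2, Multiset.card_pos], hs2.trans hs⟩, fun T hT => ⟨(h T hT).1, (h T hT).2.2⟩⟩)
    fun V hV => hm V (by rw [hV, Multiset.card_cons]; omega)
  exact ⟨𝒰.sum, h4, h3, h5⟩

end Davenport

section LowerBound

/-- Eight points whose `(n - 1)`-fold repetition has no short zero-sum subsequence, for odd `n ≥ 3`. -/
def extremal (n : ℕ) : Multiset (Fin 3 → ZMod n) :=
  ![0, 0, 1] ::ₘ ![0, 1, 0] ::ₘ ![1, 0, 0] ::ₘ ![0, 1, 1] ::ₘ ![1, 0, 1] ::ₘ ![1, 1, 2] ::ₘ ![1, 2, 2] ::ₘ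
    ![2, 1, 2] ::ₘ 0

theorem exists_replicate_add_of_le_nsmul_cons {α : Type*} [AddCommMonoid α] {k : ℕ} {v : α} {s T : Multiset α}
    (h : T ≤ k • (v ::ₘ s)) :
    ∃ a ≤ k, ∃ T' ≤ k • s, Multiset.card T = a + Multiset.card T' ∧ T.sum = a • v + T'.sum := by
  classical
  rw [← Multiset.singleton_add, nsmul_add, Multiset.nsmul_singleton] at h
  refine ⟨Multiset.card (T ∩ Multiset.replicate k v), ?_, T - Multiset.replicate k v, ?_, ?_, ?_⟩
  · exact (Multiset.card_le_card Multiset.inter_le_right).trans (Multiset.card_replicate k v).le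
  · rwa [tsub_le_iff_left]
  · rw [← Multiset.card_add, add_comm, Multiset.sub_add_inter]
  · have : T ∩ Multiset.replicate k v = Multiset.replicate (Multiset.card (T ∩ Multiset.replicate k v)) v :=
      Multiset.eq_replicate_card.2 fun b hb => Multiset.eq_of_mem_replicate (Multiset.mem_of_le Multiset.inter_le_right hb)
    rw [← Multiset.sum_replicate, ← this, ← Multiset.sum_add, add_comm, Multiset.sub_add_inter]

theorem ZMod.eq_zero_or_eq_or_eq_of_le {n x : ℕ} (h : (x : ZMod n) = 0) (hx : x ≤ 2 * n) (hn : 0 < n) :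
    x = 0 ∨ x = n ∨ x = 2 * n := by
  obtain ⟨j, rfl⟩ := (ZMod.natCast_eq_zero_iff x n).1 h
  have : j ≤ 2 := by rw [mul_comm 2] at hx; exact Nat.le_of_mul_le_mul_left hx hn
  interval_cases j <;> omega

theorem not_hasZeroSum_extremal {n : ℕ} (hn : Odd n) (h3 : 3 ≤ n) :
    ¬ HasZeroSum n ((n - 1) • extremal n) := by
  rintro ⟨T, hT, h0, hc, hs⟩
  rw [extremal] at hT
  obtain ⟨a₁, h₁, T, hT, e₁, f₁⟩ := exists_replicate_add_of_le_nsmul_cons hT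
  obtain ⟨a₂, h₂, T, hT, e₂, f₂⟩ := exists_replicate_add_of_le_nsmul_cons hT
  obtain ⟨a₃, h₃, T, hT, e₃, f₃⟩ := exists_replicate_add_of_le_nsmul_cons hT
  obtain ⟨a₄, h₄, T, hT, e₄, f₄⟩ := exists_replicate_add_of_le_nsmul_cons hT
  obtain ⟨a₅, h₅, T, hT, e₅, f₅⟩ := exists_replicate_add_of_le_nsmul_cons hT
  obtain ⟨a₆, h₆, T, hT, e₆, f₆⟩ := exists_replicate_add_of_le_nsmul_cons hT
  obtain ⟨a₇, h₇, T, hT, e₇, f₇⟩ := exists_replicate_add_of_le_nsmul_cons hT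
  obtain ⟨a₈, h₈, T, hT, e₈, f₈⟩ := exists_replicate_add_of_le_nsmul_cons hT
  obtain rfl : T = 0 := le_antisymm (hT.trans (nsmul_zero (n - 1)).le) zero_le
  rw [← Multiset.card_pos] at h0
  rw [Multiset.card_zero, add_zero] at e₈
  rw [Multiset.sum_zero, add_zero] at f₈
  rw [f₁, f₂, f₃, f₄, f₅, f₆, f₇, f₈] at hs
  have g₀ : ((a₃ + a₅ + a₆ + a₇ + 2 * a₈ : ℕ) : ZMod n) = 0 := by
    refine Eq.trans ?_ (congrFun hs 0)
    simp
    ring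
  have g₁ : ((a₂ + a₄ + a₆ + 2 * a₇ + a₈ : ℕ) : ZMod n) = 0 := by
    refine Eq.trans ?_ (congrFun hs 1)
    simp
    ring
  have g₂ : ((a₁ + a₄ + a₅ + 2 * a₆ + 2 * a₇ + 2 * a₈ : ℕ) : ZMod n) = 0 := by
    refine Eq.trans ?_ (congrFun hs 2)
    simp
    ring
  have := ZMod.eq_zero_or_eq_or_eq_of_le g₀ (by omega) (by omega)
  have := ZMod.eq_zero_or_eq_or_eq_of_le g₁ (by omega) (by omega)
  have := ZMod.eq_zero_or_eq_or_eq_of_le g₂ (by omega) (by omega)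
  obtain ⟨k, rfl⟩ := hn
  omega

end LowerBound

/-! ### The set `C_0` -/

section C0

variable {n : ℕ}

theorem ZMod.exponent_pi_fin_three : AddMonoid.exponent (Fin 3 → ZMod n) = n := by
  rw [AddMonoid.exponent_pi]
  simp only [ZMod.exponent]
  exact Nat.dvd_antisymm (Finset.lcm_dvd fun _ _ => dvd_rfl) (Finset.dvd_lcm (Finset.mem_univ 0))

theorem HasZeroSum.hasShortZeroSumSubseq {S : Multiset (Fin 3 → ZMod n)} (h : HasZeroSum n S) :
    HasShortZeroSumSubseq S := by
  obtain ⟨T, hT, h0, hc, hs⟩ := h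
  exact ⟨T, hT, hs, Multiset.card_pos.2 h0, hc.trans_eq ZMod.exponent_pi_fin_three.symm⟩

theorem HasShortZeroSumSubseq.hasZeroSum {S : Multiset (Fin 3 → ZMod n)} (h : HasShortZeroSumSubseq S) :
    HasZeroSum n S := by
  obtain ⟨T, hT, hs, h0, hc⟩ := h
  exact ⟨T, hT, Multiset.card_pos.1 h0, hc.trans_eq ZMod.exponent_pi_fin_three, hs⟩

theorem le_etaConst_s1 (hn : Odd n) (h3 : 3 ≤ n) (h : EtaLe n) : 8 * n - 7 ≤ etaConst (Fin 3 → ZMod n) := by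
  refine le_csInf ⟨8 * n - 7, fun S hS => (h S hS).hasShortZeroSumSubseq⟩ fun d hd => ?_
  by_contra! hlt
  refine not_hasZeroSum_extremal hn h3 (hd _ ?_).hasZeroSum
  rw [Multiset.card_nsmul, extremal]
  simp only [Multiset.card_cons, Multiset.card_zero]
  omega

theorem mem_C0_of_eta {t : ℕ} (hn : Odd n) (h3 : 3 ≤ n) (h : EtaLe n) (ht : 0 < t) (ht' : t ≤ 8 * n - 8)
    (hD : ∀ S : Multiset (Fin 3 → ZMod n), t - 1 ≤ Multiset.card S → ∃ T ≤ S, T ≠ 0 ∧ T.sum = 0)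
    (hS : ∀ S : Multiset (Fin 3 → ZMod n), Multiset.card S = t → S.sum = 0 → HasZeroSum n S) :
    t ∈ C0 (Fin 3 → ZMod n) := by
  have hdav : davenport (Fin 3 → ZMod n) ≤ t - 1 := Nat.sInf_le hD
  have heta := le_etaConst_s1 hn h3 h
  exact ⟨by omega, by omega, fun S hc hs => (hS S hc hs).hasShortZeroSumSubseq⟩

theorem mem_C0_five_mul {m : ℕ} (hodd : Odd m) (hm : EtaLe m) :
    8 * (5 * m) - 8 ∈ C0 (Fin 3 → ZMod (5 * m)) := by
  have hm0 := hodd.pos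
  have : NeZero (5 * m) := ⟨by omega⟩
  have : Fact (Nat.Prime 5) := ⟨by norm_num⟩
  exact mem_C0_of_eta (Nat.odd_mul.2 ⟨by decide, hodd⟩) (by omega) (etaLe_five_mul hm0 hm) (by omega) le_rfl
    (fun S hS => exists_zeroSum_of_card hm (fun _ => Search.hasZeroSum_of_card) (by omega) (by omega))
    fun S => hasZeroSum_five_mul hm0 hm

theorem mem_C0_three_mul {m : ℕ} (hodd : Odd m) (hm : EtaLe m) :
    8 * (3 * m) - 9 ∈ C0 (Fin 3 → ZMod (3 * m)) := by
  have hm0 := hodd.pos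
  have : NeZero (3 * m) := ⟨by omega⟩
  refine mem_C0_of_eta (Nat.odd_mul.2 ⟨by decide, hodd⟩) (by omega) (etaLe_three_mul hm0 hm) (by omega) (by omega)
    (fun S hS => exists_zeroSum_of_card hm (fun _ => Cap.hasZeroSum_of_card) (by omega) (by omega)) fun S hc hs => ?_
  rcases Nat.lt_or_ge 1 m with h1 | h1
  · exact hasZeroSum_three_mul h1 hm hc hs
  · obtain rfl : m = 1 := by omega
    exact Cap.hasZeroSum_of_card_eq_fifteen hc hs

end C0

theorem stmt_1 (a b : ℕ) (hab : 1 ≤ a ∨ 2 ≤ b) :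
    (C0 (Fin 3 → ZMod (3 ^ a * 5 ^ b))).Nonempty := by
  have hodd (a b : ℕ) : Odd (3 ^ a * 5 ^ b) :=
    Nat.odd_mul.2 ⟨Odd.pow (by decide), Odd.pow (by decide)⟩
  rcases b with _ | b
  · obtain ⟨a, rfl⟩ := Nat.exists_eq_add_of_le' (show 1 ≤ a by omega)
    rw [pow_succ', mul_assoc]
    exact ⟨_, mem_C0_three_mul (hodd a 0) (etaLe_three_pow_mul_five_pow a 0)⟩
  · rw [pow_succ', mul_left_comm]
    exact ⟨_, mem_C0_five_mul (hodd a b) (etaLe_three_pow_mul_five_pow a b)⟩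
end
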